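/- arXiv:0905.0514 — 6 statements merged into one kernel-verified Lean document; each statement's English description precedes it below -/
import Mathlib

section
/- For every positive integer k, with η = e^{2πi/k}, the following identity of formal series holds: x_0^{-1} δ((x_1 - x_2)/x_0) - x_0^{-1} δ((x_2 - x_1)/(-x_0)) = (1/k) Σ_{j=0}^{k-1} x_2^{-1} δ(η^j (x_1 - x_0)^{1/k} / x_2^{1/k}), where δ(x) = Σ_{n∈Z} x^n, δ(η^j (x_1 - x_0)^{1/k}/x_2^{1/k}) = Σ_{n∈Z} η^{jn} (x_1 - x_0)^{n/k} x_2^{-n/k}, and every binomial expression (a ± b)^r is expanded as a formal series in nonnegative integral powers of its second listed variable. -/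
open scoped BigOperators
open Complex

noncomputable section

/-- Generalized binomial coefficient `C(r, i)` for `r ∈ ℂ`, `i ∈ ℕ`:
`C(r,i) = r (r-1) ⋯ (r-i+1) / i!`. -/
def cchoose (r : ℂ) (i : ℕ) : ℂ :=
  (∏ j ∈ Finset.range i, (r - (j : ℂ))) / (Nat.factorial i : ℂ)

theorem cchoose_natCast (n i : ℕ) : cchoose (n : ℂ) i = (n.choose i : ℂ) := by
  have hi : (i.factorial : ℂ) ≠ 0 := by exact_mod_cast i.factorial_ne_zero
  rw [cchoose, div_eq_iff hi, ← descPochhammer_eval_eq_prod_range,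
    descPochhammer_eval_eq_descFactorial, Nat.descFactorial_eq_factorial_mul_choose]
  push_cast
  ring

theorem cchoose_neg_natCast_sub_one (n i : ℕ) :
    cchoose (-(n : ℂ) - 1) i = (-1) ^ i * ((n + i).choose i : ℂ) := by
  have hi : (i.factorial : ℂ) ≠ 0 := by exact_mod_cast i.factorial_ne_zero
  have hprod : ∏ j ∈ Finset.range i, (-(n : ℂ) - 1 - j) =
      (-1) ^ i * (((n + 1).ascFactorial i : ℕ) : ℂ) := by
    rw [Nat.ascFactorial_eq_prod_range, Nat.cast_prod]
    conv_rhs => rw [← Finset.card_range i, ← Finset.prod_const, Finset.card_range,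
      ← Finset.prod_mul_distrib]
    refine Finset.prod_congr rfl fun j _ => ?_
    push_cast
    ring
  rw [cchoose, div_eq_iff hi, hprod, Nat.ascFactorial_eq_factorial_mul_choose]
  push_cast
  ring

/-- A doubly indexed sum whose support is contained in the single point `(s₀, i₀)`. -/
theorem finsum_finsum_ite_eq {α β M : Type*} [AddCommMonoid M] (P : α → β → Prop)
    [∀ s i, Decidable (P s i)] (f : α → β → M) (s₀ : α) (i₀ : β) (h₀ : P s₀ i₀)
    (h : ∀ s i, P s i → s = s₀ ∧ i = i₀) :
    (∑ᶠ s, ∑ᶠ i, if P s i then f s i else 0) = f s₀ i₀ := by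
  rw [finsum_eq_single _ s₀, finsum_eq_single _ i₀, if_pos h₀]
  · exact fun i hi => if_neg fun hP => hi (h _ _ hP).2
  · intro s hs
    exact finsum_eq_zero_of_forall_eq_zero fun i => if_neg fun hP => hs (h _ _ hP).1

theorem finsum_finsum_ite_eq_zero {α β M : Type*} [AddCommMonoid M] (P : α → β → Prop)
    [∀ s i, Decidable (P s i)] (f : α → β → M) (h : ∀ s i, ¬ P s i) :
    (∑ᶠ s, ∑ᶠ i, if P s i then f s i else 0) = 0 := by
  simp [h]

/-- Orthogonality of the characters of `ℤ / k`. -/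
theorem sum_exp_two_pi_I_mul_div (k : ℕ) (hk : 0 < k) (t : ℤ) :
    ∑ j ∈ Finset.range k,
      Complex.exp (2 * Real.pi * Complex.I * ((j : ℂ) * (t : ℂ)) / (k : ℂ)) =
      if (k : ℤ) ∣ t then (k : ℂ) else 0 := by
  have hζ := Complex.isPrimitiveRoot_exp k hk.ne'
  set ζ := Complex.exp (2 * Real.pi * Complex.I / k) with hζdef
  have hterm : ∀ j : ℕ, Complex.exp (2 * Real.pi * Complex.I * ((j : ℂ) * (t : ℂ)) / (k : ℂ)) =
      (ζ ^ t) ^ j := by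
    intro j
    rw [hζdef, ← Complex.exp_int_mul, ← Complex.exp_nat_mul]
    congr 1
    ring
  simp_rw [hterm]
  split_ifs with hdvd
  · simp [(hζ.zpow_eq_one_iff_dvd t).2 hdvd]
  · have hne : ζ ^ t ≠ 1 := fun h => hdvd ((hζ.zpow_eq_one_iff_dvd t).1 h)
    rw [geom_sum_eq hne, ← zpow_natCast, ← zpow_mul, mul_comm, zpow_mul, zpow_natCast,
      hζ.pow_eq_one]
    simp

/-- The coefficient identity when the exponents `m`, `n` of `x₁`, `x₂` are integers. -/
theorem finsum_sub_finsum_of_dvd (k : ℕ) (hk : 0 < k) (a m n : ℤ) (hmn : m + n = -a - 1) :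
    (∑ᶠ s : ℤ, ∑ᶠ i : ℕ,
        if a = -s - 1 ∧ k * m = k * (s - (i : ℤ)) ∧ k * n = k * (i : ℤ) then
          cchoose (s : ℂ) i * (-1 : ℂ) ^ (i : ℕ) else 0)
    - (∑ᶠ s : ℤ, ∑ᶠ i : ℕ,
        if a = -s - 1 ∧ k * m = k * (i : ℤ) ∧ k * n = k * (s - (i : ℤ)) then
          (-1 : ℂ) ^ s * cchoose (s : ℂ) i * (-1 : ℂ) ^ (i : ℕ) else 0)
    = if 0 ≤ a then cchoose (-(n : ℂ) - 1) a.toNat * (-1) ^ a.toNat else 0 := by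
  have hk0 : (k : ℤ) ≠ 0 := by exact_mod_cast hk.ne'
  simp only [mul_right_inj' hk0]
  have hfst : ∀ p : ℕ, n = p → (∑ᶠ s : ℤ, ∑ᶠ i : ℕ,
      if a = -s - 1 ∧ m = s - (i : ℤ) ∧ n = (i : ℤ) then
        cchoose (s : ℂ) i * (-1 : ℂ) ^ (i : ℕ) else 0) =
      cchoose ((-a - 1 : ℤ) : ℂ) p * (-1 : ℂ) ^ p := fun p hp =>
    finsum_finsum_ite_eq (fun s (i : ℕ) => a = -s - 1 ∧ m = s - (i : ℤ) ∧ n = (i : ℤ))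
      (fun s i => cchoose (s : ℂ) i * (-1 : ℂ) ^ (i : ℕ)) (-a - 1) p (by omega) (by omega)
  have hfst0 : n < 0 → (∑ᶠ s : ℤ, ∑ᶠ i : ℕ,
      if a = -s - 1 ∧ m = s - (i : ℤ) ∧ n = (i : ℤ) then
        cchoose (s : ℂ) i * (-1 : ℂ) ^ (i : ℕ) else 0) = 0 := fun hn =>
    finsum_finsum_ite_eq_zero _ _ (by omega)
  have hsnd : ∀ q : ℕ, m = q → (∑ᶠ s : ℤ, ∑ᶠ i : ℕ,
      if a = -s - 1 ∧ m = (i : ℤ) ∧ n = s - (i : ℤ) then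
        (-1 : ℂ) ^ s * cchoose (s : ℂ) i * (-1 : ℂ) ^ (i : ℕ) else 0) =
      (-1 : ℂ) ^ (-a - 1) * cchoose ((-a - 1 : ℤ) : ℂ) q * (-1 : ℂ) ^ q := fun q hq =>
    finsum_finsum_ite_eq (fun s (i : ℕ) => a = -s - 1 ∧ m = (i : ℤ) ∧ n = s - (i : ℤ))
      (fun s i => (-1 : ℂ) ^ s * cchoose (s : ℂ) i * (-1 : ℂ) ^ (i : ℕ)) (-a - 1) q
      (by omega) (by omega)
  have hsnd0 : m < 0 → (∑ᶠ s : ℤ, ∑ᶠ i : ℕ,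
      if a = -s - 1 ∧ m = (i : ℤ) ∧ n = s - (i : ℤ) then
        (-1 : ℂ) ^ s * cchoose (s : ℂ) i * (-1 : ℂ) ^ (i : ℕ) else 0) = 0 := fun hm =>
    finsum_finsum_ite_eq_zero _ _ (by omega)
  have hsq : ∀ q : ℕ, (-1 : ℂ) ^ q * (-1) ^ q = 1 := fun q => by
    rw [← mul_pow]; simp
  by_cases ha : 0 ≤ a
  · rw [if_pos ha]
    lift a to ℕ using ha
    have hneg : ((-(a : ℤ) - 1 : ℤ) : ℂ) = -(a : ℂ) - 1 := by push_cast; ring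
    rw [Int.toNat_natCast]
    rcases le_or_gt 0 n with hn | hn
    · lift n to ℕ using hn
      rw [hfst n rfl, hsnd0 (by omega), hneg, Int.cast_natCast, cchoose_neg_natCast_sub_one,
        cchoose_neg_natCast_sub_one, add_comm n a, Nat.choose_symm_add]
      linear_combination ((a + n).choose n : ℂ) * (hsq n - hsq a)
    · rw [hfst0 hn]
      obtain ⟨p, hp⟩ : ∃ p : ℕ, (p : ℤ) = -n - 1 := ⟨(-n - 1).toNat, by omega⟩
      have hp' : -(n : ℂ) - 1 = (p : ℂ) := by exact_mod_cast hp.symm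
      rw [hp', cchoose_natCast]
      rcases le_or_gt 0 m with hm | hm
      · lift m to ℕ using hm
        obtain rfl : p = a + m := by omega
        have hsign : (-1 : ℂ) ^ (-(a : ℤ) - 1) = -(-1) ^ a := by
          rw [zpow_sub₀ (by norm_num), zpow_neg, zpow_natCast, ← inv_pow]
          norm_num [div_neg]
        rw [hsnd m rfl, hneg, cchoose_neg_natCast_sub_one, hsign, Nat.choose_symm_add]
        linear_combination ((a + m).choose m : ℂ) * (-1) ^ a * hsq m
      · rw [hsnd0 hm, Nat.choose_eq_zero_of_lt (by omega)]
        simp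
  · rw [if_neg ha]
    obtain ⟨s, hs⟩ : ∃ s : ℕ, (s : ℤ) = -a - 1 := ⟨(-a - 1).toNat, by omega⟩
    rw [← hs] at hfst hsnd
    simp only [Int.cast_natCast, cchoose_natCast, zpow_natCast] at hfst hsnd
    rcases le_or_gt 0 n with hn | hn
    · lift n to ℕ using hn
      rw [hfst n rfl]
      rcases le_or_gt 0 m with hm | hm
      · lift m to ℕ using hm
        obtain rfl : s = m + n := by omega
        rw [hsnd m rfl, Nat.choose_symm_add, pow_add]
        linear_combination -((m + n).choose n : ℂ) * (-1) ^ n * hsq m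
      · rw [hsnd0 hm, Nat.choose_eq_zero_of_lt (by omega)]
        simp
    · lift m to ℕ using (by omega)
      rw [hfst0 hn, hsnd m rfl, Nat.choose_eq_zero_of_lt (by omega)]
      simp

/-- The formal-variable identity
`x₀⁻¹ δ((x₁-x₂)/x₀) - x₀⁻¹ δ((x₂-x₁)/(-x₀))
  = (1/k) ∑_{j=0}^{k-1} x₂⁻¹ δ(ηʲ (x₁-x₀)^{1/k} / x₂^{1/k})`,
where `η = e^{2πi/k}` and every binomial `(a ± b)^r` is expanded in nonnegative integral
powers of its second listed variable.  A series in `x₀, x₁^{1/k}, x₂^{1/k}` is recorded by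
its coefficients: `a` is the exponent of `x₀`, and `b`, `c` encode the exponents `b/k`,
`c/k` of `x₁`, `x₂`.  Each side is written below by expanding the defining series:
`x₀⁻¹ δ((x₁-x₂)/x₀) = ∑_{s ∈ ℤ} ∑_{i ∈ ℕ} C(s,i) (-1)^i x₁^{s-i} x₂^i x₀^{-s-1}`,
`x₀⁻¹ δ((x₂-x₁)/(-x₀)) = ∑_{s ∈ ℤ} ∑_{i ∈ ℕ} (-1)^s C(s,i) (-1)^i x₂^{s-i} x₁^i x₀^{-s-1}`,
`x₂⁻¹ δ(ηʲ (x₁-x₀)^{1/k}/x₂^{1/k})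
  = ∑_{t ∈ ℤ} ∑_{i ∈ ℕ} η^{jt} C(t/k, i) (-1)^i x₁^{t/k - i} x₀^i x₂^{-t/k - 1}`. -/
theorem twisted_delta_identity (k : ℕ) (hk : 0 < k) (a b c : ℤ) :
    (∑ᶠ s : ℤ, ∑ᶠ i : ℕ,
        if a = -s - 1 ∧ b = k * (s - (i : ℤ)) ∧ c = k * (i : ℤ) then
          cchoose (s : ℂ) i * (-1 : ℂ) ^ (i : ℕ) else 0)
    - (∑ᶠ s : ℤ, ∑ᶠ i : ℕ,
        if a = -s - 1 ∧ b = k * (i : ℤ) ∧ c = k * (s - (i : ℤ)) then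
          (-1 : ℂ) ^ s * cchoose (s : ℂ) i * (-1 : ℂ) ^ (i : ℕ) else 0)
    = ((k : ℂ))⁻¹ * ∑ j ∈ Finset.range k, ∑ᶠ t : ℤ, ∑ᶠ i : ℕ,
        if a = (i : ℤ) ∧ b = t - k * (i : ℤ) ∧ c = -t - k then
          Complex.exp (2 * Real.pi * Complex.I * ((j : ℂ) * (t : ℂ)) / (k : ℂ))
            * cchoose ((t : ℂ) / (k : ℂ)) i * (-1 : ℂ) ^ (i : ℕ)
        else 0 := by
  have hk0 : (k : ℤ) ≠ 0 := by exact_mod_cast hk.ne'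
  have hkC : (k : ℂ) ≠ 0 := by exact_mod_cast hk.ne'
  have hrhs : ((k : ℂ))⁻¹ * ∑ j ∈ Finset.range k, (∑ᶠ t : ℤ, ∑ᶠ i : ℕ,
        if a = (i : ℤ) ∧ b = t - k * (i : ℤ) ∧ c = -t - k then
          Complex.exp (2 * Real.pi * Complex.I * ((j : ℂ) * (t : ℂ)) / (k : ℂ))
            * cchoose ((t : ℂ) / (k : ℂ)) i * (-1 : ℂ) ^ (i : ℕ)
        else 0) =
      if (0 ≤ a ∧ b + c = k * (-a - 1)) ∧ (k : ℤ) ∣ c then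
        cchoose (((-c - k : ℤ) : ℂ) / k) a.toNat * (-1) ^ a.toNat else 0 := by
    by_cases h : 0 ≤ a ∧ b + c = k * (-a - 1)
    · obtain ⟨ha, hbc⟩ := h
      lift a to ℕ using ha
      have hsum : ∀ j : ℕ, (∑ᶠ t : ℤ, ∑ᶠ i : ℕ,
          if (a : ℤ) = (i : ℤ) ∧ b = t - k * (i : ℤ) ∧ c = -t - k then
            Complex.exp (2 * Real.pi * Complex.I * ((j : ℂ) * (t : ℂ)) / (k : ℂ))
              * cchoose ((t : ℂ) / (k : ℂ)) i * (-1 : ℂ) ^ (i : ℕ)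
          else 0) = _ := fun j =>
        finsum_finsum_ite_eq
          (fun t (i : ℕ) => (a : ℤ) = (i : ℤ) ∧ b = t - k * (i : ℤ) ∧ c = -t - k)
          (fun t i => Complex.exp (2 * Real.pi * Complex.I * ((j : ℂ) * (t : ℂ)) / (k : ℂ))
              * cchoose ((t : ℂ) / (k : ℂ)) i * (-1 : ℂ) ^ (i : ℕ)) (-c - k) a
          ⟨rfl, by linear_combination hbc, by ring⟩
          (fun t i hti => ⟨by linarith [hti.2.2], by exact_mod_cast hti.1.symm⟩)
      have hdvd : (k : ℤ) ∣ -c - k ↔ (k : ℤ) ∣ c := by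
        rw [dvd_sub_self_right, dvd_neg]
      simp only [hsum, ← Finset.sum_mul, sum_exp_two_pi_I_mul_div k hk, hdvd, Int.toNat_natCast,
        Nat.cast_nonneg, hbc, and_self, true_and]
      split_ifs
      · field_simp
      · simp
    · rw [if_neg fun h' => h h'.1, Finset.sum_eq_zero, mul_zero]
      refine fun j _ => finsum_finsum_ite_eq_zero _ _ fun t i hti => h ⟨by omega, ?_⟩
      obtain ⟨rfl, rfl, rfl⟩ := hti
      ring
  rw [hrhs]
  by_cases h : b + c = k * (-a - 1) ∧ (k : ℤ) ∣ c
  · obtain ⟨hbc, n, rfl⟩ := h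
    obtain rfl : b = k * (-a - 1 - n) := by linear_combination hbc
    rw [finsum_sub_finsum_of_dvd k hk a _ n (by ring)]
    have harg : ((-(k * n) - k : ℤ) : ℂ) / k = -(n : ℂ) - 1 := by
      push_cast
      field_simp
    simp only [harg, hbc, and_true, dvd_mul_right]
  · rw [if_neg fun h' => h ⟨h'.1.2, h'.2⟩, finsum_finsum_ite_eq_zero, finsum_finsum_ite_eq_zero,
      sub_zero]
    · rintro s i ⟨rfl, rfl, rfl⟩
      exact h ⟨by ring, dvd_mul_right _ _⟩
    · rintro s i ⟨rfl, rfl, rfl⟩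
      exact h ⟨by ring, dvd_mul_right _ _⟩

end
end

section
/- Let (V, Y, 1, ω) be a vertex operator algebra, (W, Y_W) a weak V-module, and u, v ∈ V. Then [∫_0^{-x_1} Y_W^{≤-2}(u, y), Y_W(v, x_2)] = Y_W(∫_0^{-x_1-x_2} Y^{≤-2}(u, y) v, x_2) + log(1 + x_2/x_1) · Y_W(Y_0(u)v, x_2), where ∫_0^{-x_1-x_2} Y^{≤-2}(u, y) v = Σ_{k∈Z_+} ((-1)^k/(-k)) (x_1 + x_2)^{-k} Y_k(u) v is expanded as a series in nonnegative integral powers of x_2 and integral powers of x_1, and log(1 + x_2/x_1) = Σ_{l∈Z_+} ((-1)^{l+1}/l) x_1^{-l} x_2^{l}. -/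
open scoped BigOperators
open Complex

noncomputable section

/-- A vertex operator algebra `(V, Y, 𝟏, ω)` over `ℂ`, presented through the component
operators `Y u n = Y_n(u)` of the vertex operator map `Y(u, x) = ∑_{n ∈ ℤ} Y_n(u) x^{-n-1}`,
with conformal element `ω` (so `L(n) = Y_{n+1}(ω)`), vacuum `vac`, central charge `cc`,
and grading `V = ⊕_{n ∈ ℤ} V_(n)` by `L(0)`-eigenvalues (with projections `proj`).
The Jacobi identity is imposed in the standard component (Borcherds) form, obtained by
extracting the coefficient of `x₀^{-a-1} x₁^{-b-1} x₂^{-c-1}` in the formal Jacobi identity. -/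
structure VOA (V : Type*) [AddCommGroup V] [Module ℂ V] where
  Y : V →ₗ[ℂ] ℤ → Module.End ℂ V
  vac : V
  ω : V
  cc : ℂ
  grading : ℤ → Submodule ℂ V
  proj : ℤ → Module.End ℂ V
  proj_mem : ∀ (n : ℤ) (v : V), proj n v ∈ grading n
  proj_id : ∀ (n : ℤ), ∀ v ∈ grading n, proj n v = v
  proj_orth : ∀ (m n : ℤ), m ≠ n → ∀ v ∈ grading n, proj m v = 0
  proj_sum : ∀ v : V, ∑ᶠ n : ℤ, proj n v = v
  fin_dim : ∀ n : ℤ, FiniteDimensional ℂ (grading n)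
  lower_bdd : ∃ N : ℤ, ∀ n < N, grading n = ⊥
  vac_mem : vac ∈ grading 0
  omega_mem : ω ∈ grading 2
  vacuum_left : ∀ n : ℤ, Y vac n = if n = -1 then 1 else 0
  creation_zero : ∀ (u : V) (n : ℤ), 0 ≤ n → Y u n vac = 0
  creation_self : ∀ u : V, Y u (-1) vac = u
  trunc : ∀ u v : V, ∃ N : ℤ, ∀ n ≥ N, Y u n v = 0
  weight : ∀ (k n : ℤ), ∀ u ∈ grading k, ∀ (m : ℤ), ∀ v ∈ grading m,
      Y u n v ∈ grading (k + m - n - 1)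
  L0_grading : ∀ (n : ℤ), ∀ v ∈ grading n, Y ω 1 v = (n : ℂ) • v
  Lm1_deriv : ∀ (u : V) (n : ℤ), Y (Y ω 0 u) n = (-(n : ℂ)) • Y u (n - 1)
  virasoro : ∀ m n : ℤ,
      Y ω (m + 1) * Y ω (n + 1) - Y ω (n + 1) * Y ω (m + 1)
        = ((m : ℂ) - (n : ℂ)) • Y ω (m + n + 1)
          + (if m + n = 0 then ((m : ℂ) ^ 3 - (m : ℂ)) / 12 * cc else 0)
              • (1 : Module.End ℂ V)
  skew : ∀ (u v : V) (n : ℤ),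
      Y u n v = ∑ᶠ m : ℕ, ((-1 : ℂ) ^ (n + (m : ℤ) + 1) * ((Nat.factorial m : ℂ))⁻¹)
        • ((Y ω 0) ^ m) (Y v (n + (m : ℤ)) u)
  jacobi : ∀ (u v w : V) (a b c : ℤ),
      (∑ᶠ i : ℕ, (cchoose (a : ℂ) i * (-1 : ℂ) ^ (i : ℕ))
          • Y u (a + b - (i : ℤ)) (Y v (c + (i : ℤ)) w))
      - (∑ᶠ i : ℕ, (cchoose (a : ℂ) i * (-1 : ℂ) ^ (a + (i : ℤ)))
          • Y v (a + c - (i : ℤ)) (Y u (b + (i : ℤ)) w))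
      = ∑ᶠ i : ℕ, (cchoose ((i : ℂ) - (b : ℂ) - 1) i * (-1 : ℂ) ^ (i : ℕ))
          • Y (Y u (a + (i : ℤ)) v) (b + c - (i : ℤ)) w

/-- A weak `V`-module, presented through the component operators
`Yw u n = (Y_W)_n(u)` of `Y_W(u, x) = ∑_{n ∈ ℤ} (Y_W)_n(u) x^{-n-1}`, satisfying lower
truncation, the identity property, the component (Borcherds) form of the Jacobi identity,
and the `L(-1)`-derivative property. -/
structure WeakModule {V : Type*} [AddCommGroup V] [Module ℂ V] (A : VOA V)
    (W : Type*) [AddCommGroup W] [Module ℂ W] where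
  Yw : V →ₗ[ℂ] ℤ → Module.End ℂ W
  trunc : ∀ (u : V) (w : W), ∃ N : ℤ, ∀ n ≥ N, Yw u n w = 0
  vacuum : ∀ (n : ℤ) (w : W), Yw A.vac n w = if n = -1 then w else 0
  jacobi : ∀ (u v : V) (w : W) (a b c : ℤ),
      (∑ᶠ i : ℕ, (cchoose (a : ℂ) i * (-1 : ℂ) ^ (i : ℕ))
          • Yw u (a + b - (i : ℤ)) (Yw v (c + (i : ℤ)) w))
      - (∑ᶠ i : ℕ, (cchoose (a : ℂ) i * (-1 : ℂ) ^ (a + (i : ℤ)))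
          • Yw v (a + c - (i : ℤ)) (Yw u (b + (i : ℤ)) w))
      = ∑ᶠ i : ℕ, (cchoose ((i : ℂ) - (b : ℂ) - 1) i * (-1 : ℂ) ^ (i : ℕ))
          • Yw (A.Y u (a + (i : ℤ)) v) (b + c - (i : ℤ)) w
  Lm1_deriv : ∀ (u : V) (n : ℤ), Yw (A.Y A.ω 0 u) n = (-(n : ℂ)) • Yw u (n - 1)

/-- Upper negation: `(-1)^i C(i - r - 1, i) = C(r, i)`. -/
lemma cchoose_upper_negation (r : ℂ) (i : ℕ) :
    cchoose ((i : ℂ) - r - 1) i * (-1 : ℂ) ^ i = cchoose r i := by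
  unfold cchoose
  rw [div_mul_eq_mul_div]
  congr 1
  rw [← Finset.prod_range_reflect (fun j : ℕ => r - (j : ℂ)) i]
  have h : ((-1 : ℂ)) ^ i = ∏ _j ∈ Finset.range i, (-1 : ℂ) := by simp
  rw [h, ← Finset.prod_mul_distrib]
  refine Finset.prod_congr rfl fun j hj => ?_
  have hj' : j + 1 ≤ i := Finset.mem_range.mp hj
  rw [Nat.sub_sub, Nat.cast_sub (by omega)]
  push_cast
  ring

lemma cchoose_natCast_s5 (N i : ℕ) : cchoose (N : ℂ) i = (N.choose i : ℂ) := by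
  unfold cchoose
  rw [Nat.choose_eq_descFactorial_div_factorial,
    Nat.cast_div (Nat.factorial_dvd_descFactorial N i) (by exact_mod_cast i.factorial_ne_zero),
    ← descPochhammer_eval_eq_descFactorial ℂ, descPochhammer_eval_eq_prod_range]

lemma cchoose_zero_left (i : ℕ) : cchoose 0 i = if i = 0 then 1 else 0 := by
  have h := cchoose_natCast_s5 0 i
  rw [Nat.cast_zero] at h
  rw [h]
  cases i <;> simp

lemma cchoose_neg_natCast_succ (m l : ℕ) :
    cchoose (-((m + 1 : ℕ) : ℂ)) l = (-1 : ℂ) ^ l * ((m + l).choose l : ℂ) := by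
  rw [← cchoose_natCast_s5, ← cchoose_upper_negation ((m + l : ℕ) : ℂ) l]
  have h : (l : ℂ) - ((m + l : ℕ) : ℂ) - 1 = -((m + 1 : ℕ) : ℂ) := by push_cast; ring
  rw [h, mul_left_comm, ← mul_pow]
  simp

/-- The commutator formula for the nonnegative modes of `u`, a finite sum. -/
lemma WeakModule.commutator_natCast {V : Type*} [AddCommGroup V] [Module ℂ V] {A : VOA V}
    {W : Type*} [AddCommGroup W] [Module ℂ W] (M : WeakModule A W)
    (u v : V) (N : ℕ) (b : ℤ) (w : W) :
    M.Yw u N (M.Yw v b w) - M.Yw v b (M.Yw u N w)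
      = ∑ i ∈ Finset.range (N + 1),
          (N.choose i : ℂ) • M.Yw (A.Y u (i : ℤ) v) (N + b - i) w := by
  have h := M.jacobi u v w 0 N b
  simp only [Int.cast_zero, Int.cast_natCast, cchoose_zero_left, cchoose_upper_negation,
    cchoose_natCast_s5] at h
  rw [finsum_eq_single _ 0 (fun i hi => by simp [hi]),
    finsum_eq_single _ 0 (fun i hi => by simp [hi])] at h
  rw [finsum_eq_sum_of_support_subset (s := Finset.range (N + 1))] at h
  · simpa using h
  · intro i hi
    by_contra hlt
    have hlt' : N < i := by simpa using hlt
    exact hi (by simp [Nat.choose_eq_zero_of_lt hlt'])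

/-- The coefficient identity behind integrating `(1 + x)^N`. -/
lemma neg_one_pow_div_mul_choose (m l : ℕ) :
    (-1 : ℂ) ^ (m + 1 + l) / (-((m + 1 + l : ℕ) : ℂ)) * ((m + 1 + l).choose (m + 1) : ℂ)
      = (-1 : ℂ) ^ (m + 1) / (-((m + 1 : ℕ) : ℂ)) * cchoose (-((m + 1 : ℕ) : ℂ)) l := by
  have h1 : ((m + 1 + l : ℕ) : ℂ) ≠ 0 := by exact_mod_cast (by omega : m + 1 + l ≠ 0)
  have h2 : ((m + 1 : ℕ) : ℂ) ≠ 0 := by exact_mod_cast m.succ_ne_zero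
  have h3 : ((m + 1 + l : ℕ) : ℂ) * ((m + l).choose l : ℂ)
      = ((m + 1 + l).choose (m + 1) : ℂ) * ((m + 1 : ℕ) : ℂ) := by
    have := Nat.add_one_mul_choose_eq (m + l) m
    rw [Nat.choose_symm_add, show m + l + 1 = m + 1 + l by omega] at this
    exact_mod_cast this
  rw [cchoose_neg_natCast_succ, div_mul_eq_mul_div, div_mul_eq_mul_div,
    div_eq_div_iff (neg_ne_zero.mpr h1) (neg_ne_zero.mpr h2), pow_add]
  linear_combination (-1 : ℂ) ^ (m + 1) * (-1 : ℂ) ^ l * h3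

/-- For a vertex operator algebra `(V,Y,𝟏,ω)`, a weak module `(W,Y_W)`
and `u, v ∈ V`:
`[∫₀^{-x₁} Y_W^{≤-2}(u,y), Y_W(v,x₂)]
  = Y_W(∫₀^{-x₁-x₂} Y^{≤-2}(u,y) v, x₂) + log(1 + x₂/x₁) · Y_W(Y₀(u)v, x₂)`,
where `∫₀^{-x₁} Y_W^{≤-2}(u,y) = ∑_{n ≥ 1} ((-1)ⁿ/(-n)) (Y_W)_n(u) x₁^{-n}`,
`∫₀^{-x₁-x₂} Y^{≤-2}(u,y)v = ∑_{n ≥ 1} ((-1)ⁿ/(-n)) (x₁+x₂)^{-n} Y_n(u)v` is expanded in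
nonnegative integral powers of `x₂` (via `(x₁+x₂)^{-n} = ∑_{l ≥ 0} C(-n,l) x₁^{-n-l} x₂^l`),
and `log(1 + x₂/x₁) = ∑_{l ≥ 1} ((-1)^{l+1}/l) x₁^{-l} x₂^l`.
The identity is stated by extracting the coefficient of `x₁^{-a} x₂^{-b-1}`, applied to
`w ∈ W`. -/
theorem integral_commutator_formula {V : Type*} [AddCommGroup V] [Module ℂ V] (A : VOA V)
    {W : Type*} [AddCommGroup W] [Module ℂ W] (M : WeakModule A W) :
    ∀ (u v : V) (a b : ℤ) (w : W),
      (if 1 ≤ a then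
          ((-1 : ℂ) ^ a / (-(a : ℂ))) • (M.Yw u a (M.Yw v b w) - M.Yw v b (M.Yw u a w))
        else 0)
      = (∑ᶠ n : ℕ, ∑ᶠ l : ℕ,
          if 1 ≤ n ∧ a = (n : ℤ) + (l : ℤ) then
            (((-1 : ℂ) ^ (n : ℕ) / (-(n : ℂ))) * cchoose (-(n : ℂ)) l)
              • M.Yw (A.Y u (n : ℤ) v) (b + (l : ℤ)) w
          else 0)
        + (if 1 ≤ a then
            ((-1 : ℂ) ^ (a + 1) / (a : ℂ)) • M.Yw (A.Y u 0 v) (b + a) w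
          else 0) := by
  intro u v a b w
  by_cases ha : 1 ≤ a
  swap
  · have hz : ∀ n l : ℕ, ¬ (1 ≤ n ∧ a = (n : ℤ) + (l : ℤ)) := by omega
    simp [ha, hz]
  obtain ⟨N, rfl⟩ := Int.eq_ofNat_of_zero_le (by omega : 0 ≤ a)
  have hN : 1 ≤ N := by omega
  rw [if_pos ha, if_pos ha, M.commutator_natCast, Finset.sum_range_succ', smul_add]
  congr 1
  · have hinner : ∀ n : ℕ, (∑ᶠ l : ℕ, if 1 ≤ n ∧ (N : ℤ) = (n : ℤ) + (l : ℤ) then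
            (((-1 : ℂ) ^ (n : ℕ) / (-(n : ℂ))) * cchoose (-(n : ℂ)) l)
              • M.Yw (A.Y u (n : ℤ) v) (b + (l : ℤ)) w
          else 0) = if 1 ≤ n ∧ n ≤ N then
            (((-1 : ℂ) ^ (n : ℕ) / (-(n : ℂ))) * cchoose (-(n : ℂ)) (N - n))
              • M.Yw (A.Y u (n : ℤ) v) (b + ((N - n : ℕ) : ℤ)) w
          else 0 := by
      intro n
      rw [finsum_eq_single _ (N - n) (fun l hl => if_neg (by omega))]
      exact if_congr (by omega) rfl rfl
    rw [finsum_congr hinner, finsum_eq_sum_of_support_subset (s := Finset.range (N + 1))]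
    · rw [Finset.sum_range_succ', if_neg (by omega), add_zero, Finset.smul_sum]
      refine Finset.sum_congr rfl fun m hm => ?_
      obtain ⟨l, rfl⟩ := Nat.exists_eq_add_of_le (Nat.succ_le_of_lt (Finset.mem_range.mp hm))
      rw [if_pos (by omega), smul_smul, Nat.succ_eq_add_one, Nat.add_sub_cancel_left,
        ← neg_one_pow_div_mul_choose, zpow_natCast, Int.cast_natCast,
        show ((m + 1 + l : ℕ) : ℤ) + b - ((m + 1 : ℕ) : ℤ) = b + (l : ℤ) by push_cast; ring]
    · intro n hn
      by_contra hlt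
      have hlt' : N < n := by simpa using hlt
      exact hn (if_neg (by omega))
  · rw [zpow_add_one₀ (by norm_num), div_neg, mul_neg_one, neg_div]
    simp [add_comm]

end
end

section
/- Let (V, Y, 1, ω) be a vertex operator algebra, (W, Y_W) a weak V-module (with Virasoro operators L(n) acting on W), and u ∈ V. Then [L(-1), ∫_0^{-x} Y_W^{≤-2}(u, y)] = -(d/dx) ∫_0^{-x} Y_W^{≤-2}(u, y) - (Y_W)_0(u) x^{-1}. -/
open scoped BigOperators
open Complex

noncomputable section

lemma cchoose_zero_right (r : ℂ) : cchoose r 0 = 1 := by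
  simp [cchoose]

lemma cchoose_natCast_eq_zero {k i : ℕ} (h : k < i) : cchoose (k : ℂ) i = 0 := by
  have hprod : ∏ j ∈ Finset.range i, ((k : ℂ) - (j : ℂ)) = 0 :=
    Finset.prod_eq_zero (Finset.mem_range.mpr h) (sub_self _)
  simp [cchoose, hprod]

/-- The commutator formula for the zeroth mode: `[u₀, vₙ] = (u₀ v)ₙ`. -/
lemma WeakModule.zero_mode_commutator {V : Type*} [AddCommGroup V] [Module ℂ V] {A : VOA V}
    {W : Type*} [AddCommGroup W] [Module ℂ W] (M : WeakModule A W) (u v : V) (n : ℤ) (w : W) :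
    M.Yw u 0 (M.Yw v n w) - M.Yw v n (M.Yw u 0 w) = M.Yw (A.Y u 0 v) n w := by
  have hchoose : ∀ i : ℕ, i ≠ 0 → cchoose 0 i = 0 := fun i hi => by
    simpa using cchoose_natCast_eq_zero (Nat.pos_of_ne_zero hi)
  have hchoose' : ∀ i : ℕ, i ≠ 0 → cchoose ((i : ℂ) - 1) i = 0 := fun i hi => by
    have h := cchoose_natCast_eq_zero (Nat.sub_one_lt hi)
    rwa [Nat.cast_pred (Nat.pos_of_ne_zero hi)] at h
  have h := M.jacobi u v w 0 0 n
  rw [finsum_eq_single _ 0 fun i hi => by simp [hchoose i hi],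
    finsum_eq_single _ 0 fun i hi => by simp [hchoose i hi],
    finsum_eq_single _ 0 fun i hi => by simp [hchoose' i hi]] at h
  simpa [cchoose_zero_right] using h

/-- For a vertex operator algebra `(V,Y,𝟏,ω)`, a weak module `(W,Y_W)`
(with Virasoro operators `L(n)` acting on `W`, `L(-1) = (Y_W)₀(ω)`) and `u ∈ V`:
`[L(-1), ∫₀^{-x} Y_W^{≤-2}(u,y)] = -(d/dx) ∫₀^{-x} Y_W^{≤-2}(u,y) - (Y_W)₀(u) x⁻¹`,
where `∫₀^{-x} Y_W^{≤-2}(u,y) = ∑_{n ≥ 1} ((-1)ⁿ/(-n)) (Y_W)_n(u) x^{-n}`.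
The identity is stated by extracting the coefficient of `x^{-a}`, applied to `w ∈ W`:
the left-hand side contributes only for `a ≥ 1`, `-(d/dx)∫₀^{-x} Y_W^{≤-2}(u,y)
= ∑_{n ≥ 1} (-1)^{n+1} (Y_W)_n(u) x^{-n-1}` contributes `(-1)^a (Y_W)_{a-1}(u)` for
`a ≥ 2`, and `-(Y_W)₀(u) x⁻¹` contributes at `a = 1`. -/
theorem Lm1_integral_commutator {V : Type*} [AddCommGroup V] [Module ℂ V] (A : VOA V)
    {W : Type*} [AddCommGroup W] [Module ℂ W] (M : WeakModule A W) :
    ∀ (u : V) (a : ℤ) (w : W),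
      (if 1 ≤ a then
          ((-1 : ℂ) ^ a / (-(a : ℂ)))
            • (M.Yw A.ω 0 (M.Yw u a w) - M.Yw u a (M.Yw A.ω 0 w))
        else 0)
      = (if 2 ≤ a then (-1 : ℂ) ^ a • M.Yw u (a - 1) w else 0)
        - (if a = 1 then M.Yw u 0 w else 0) := by
  intro u a w
  rw [M.zero_mode_commutator, M.Lm1_deriv]
  rcases lt_trichotomy a 1 with ha | rfl | ha
  · simp [show ¬ 1 ≤ a by omega, show ¬ 2 ≤ a by omega, ha.ne]
  · simp
  · have ha0 : (a : ℂ) ≠ 0 := by exact_mod_cast (by omega : a ≠ 0)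
    rw [if_pos ha.le, if_pos (by omega), if_neg ha.ne', sub_zero, LinearMap.smul_apply, smul_smul,
      div_mul_cancel₀ _ (neg_ne_zero.mpr ha0)]

end
end

section
/- Let (V, Y, 1, ω) be a vertex operator algebra, (W, Y_W) a weak V-module, and u ∈ V. Define Δ~_W^{(u)}(x) = exp(∫_0^{-x} Y_W^{≤-2}(u, y) + (Y_W)_0(u) log x) ∈ End(W)[[x^{-1}]][[log x]]. Then for all v ∈ V: (1) Δ~_W^{(u)}(x) Y_W(v, x_2) = Y_W(Δ~_V^{(u)}(x + x_2) v, x_2) Δ~_W^{(u)}(x), where Δ~_V^{(u)}(x + x_2) v is obtained by the substitutions x ↦ x + x_2 expanded in nonnegative powers of x_2 and log x ↦ log x + log(1 + x_2/x) with log(1 + x_2/x) = Σ_{l≥1} ((-1)^{l+1}/l)(x_2/x)^l; and (2) [L(-1), Δ~_W^{(u)}(x)] = -(d/dx) Δ~_W^{(u)}(x). -/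
open scoped BigOperators
open Complex

noncomputable section

/-- Multiplication of formal series in `x⁻¹` and `log x` with (noncommutative)
coefficients: the coefficient of `x^{-a} (log x)^b` in a product. -/
def mulS2 {R : Type*} [Ring R] (F G : ℕ → ℕ → R) : ℕ → ℕ → R :=
  fun a b => ∑ p ∈ Finset.range (a + 1), ∑ q ∈ Finset.range (b + 1),
    F p q * G (a - p) (b - q)

/-- Powers of a formal series in `x⁻¹` and `log x`. -/
def powS2 {R : Type*} [Ring R] (F : ℕ → ℕ → R) : ℕ → ℕ → ℕ → R
  | 0 => fun a b => if a = 0 ∧ b = 0 then 1 else 0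
  | j + 1 => mulS2 F (powS2 F j)

/-- The exponential `exp F = ∑_j F^j / j!` of a formal series `F` in `x⁻¹` and `log x`
with zero constant term: since the coefficient of `x^0 (log x)^0` in `F` vanishes, the
coefficient of `x^{-a} (log x)^b` in `F^j` vanishes for `j > a + b`, so the sum below is
the full exponential series. -/
def expS2 {R : Type*} [Ring R] [Algebra ℂ R] (F : ℕ → ℕ → R) : ℕ → ℕ → R :=
  fun a b => ∑ j ∈ Finset.range (a + b + 1),
    ((Nat.factorial j : ℂ))⁻¹ • powS2 F j a b

/-- Coefficients of powers of `log(1 + x₂/x₁) = ∑_{m ≥ 1} ((-1)^{m+1}/m) (x₂/x₁)^m`: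
`lamc c m` is the coefficient of `x₁^{-m} x₂^m` in `(log(1 + x₂/x₁))^c`. -/
def lamc : ℕ → ℕ → ℂ
  | 0, m => if m = 0 then 1 else 0
  | c + 1, m => ∑ i ∈ Finset.range (m + 1),
      if 1 ≤ i then ((-1 : ℂ) ^ (i + 1) / (i : ℂ)) * lamc c (m - i) else 0

variable {V : Type*} [AddCommGroup V] [Module ℂ V] {W : Type*} [AddCommGroup W] [Module ℂ W]

/-- The exponent `∫₀^{-x} Y_W^{≤-2}(u,y) + (Y_W)₀(u) log x` of `Δ̃_W^{(u)}(x)`, as a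
formal series in `x⁻¹` and `log x`:  the coefficient of `x^{-a} (log x)^b`. -/
def expExponentW (A : VOA V) (M : WeakModule A W) (u : V) : ℕ → ℕ → Module.End ℂ W :=
  fun a b =>
    if b = 0 ∧ 1 ≤ a then ((-1 : ℂ) ^ (a : ℕ) / (-(a : ℂ))) • M.Yw u (a : ℤ)
    else if b = 1 ∧ a = 0 then M.Yw u 0
    else 0

/-- The analogous exponent on the algebra `V` itself (formed with the vertex operator
map `Y` of `V` acting on `V`). -/
def expExponentV (A : VOA V) (u : V) : ℕ → ℕ → Module.End ℂ V :=
  fun a b =>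
    if b = 0 ∧ 1 ≤ a then ((-1 : ℂ) ^ (a : ℕ) / (-(a : ℂ))) • A.Y u (a : ℤ)
    else if b = 1 ∧ a = 0 then A.Y u 0
    else 0

/-- `Δ̃_W^{(u)}(x) = exp(∫₀^{-x} Y_W^{≤-2}(u,y) + (Y_W)₀(u) log x)`:
the coefficient of `x^{-a} (log x)^b`. -/
def DeltaTildeW (A : VOA V) (M : WeakModule A W) (u : V) : ℕ → ℕ → Module.End ℂ W :=
  expS2 (expExponentW A M u)

/-- `Δ̃_V^{(u)}(x)`, the analogous exponential on `V`. -/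
def DeltaTildeV (A : VOA V) (u : V) : ℕ → ℕ → Module.End ℂ V :=
  expS2 (expExponentV A u)

namespace LogSeries

open PowerSeries Finset

section Basic

variable {R : Type*} [Ring R] [Algebra ℂ R]

/-- The coefficient of `x^{-a} (log x)^b`, for series in `x⁻¹` whose coefficients are
series in `log x`. -/
def cf (a b : ℕ) : PowerSeries (PowerSeries R) →ₗ[ℂ] R where
  toFun f := coeff b (coeff a f)
  map_add' _ _ := rfl
  map_smul' _ _ := rfl

theorem cf_apply (a b : ℕ) (f : PowerSeries (PowerSeries R)) :
    cf a b f = coeff b (coeff a f) := rfl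

/-- The formal series with prescribed coefficients. -/
def ofCoeffs (F : ℕ → ℕ → R) : PowerSeries (PowerSeries R) :=
  PowerSeries.mk fun a => PowerSeries.mk fun b => F a b

@[simp]
theorem cf_ofCoeffs (F : ℕ → ℕ → R) (a b : ℕ) : cf a b (ofCoeffs F) = F a b := by
  simp [cf_apply, ofCoeffs]

theorem ext_cf {f g : PowerSeries (PowerSeries R)} (h : ∀ a b, cf a b f = cf a b g) :
    f = g :=
  PowerSeries.ext fun a => PowerSeries.ext fun b => h a b

theorem cf_mul (f g : PowerSeries (PowerSeries R)) (a b : ℕ) :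
    cf a b (f * g) = ∑ p ∈ antidiagonal a, ∑ q ∈ antidiagonal b,
      cf p.1 q.1 f * cf p.2 q.2 g := by
  simp only [cf_apply, coeff_mul, map_sum]

theorem cf_one (a b : ℕ) :
    cf a b (1 : PowerSeries (PowerSeries R)) = if a = 0 ∧ b = 0 then 1 else 0 := by
  by_cases ha : a = 0 <;> by_cases hb : b = 0 <;> simp [cf_apply, coeff_one, ha, hb]

theorem cf_C_C (r : R) (a b : ℕ) :
    cf a b (C (C r) : PowerSeries (PowerSeries R)) = if a = 0 ∧ b = 0 then r else 0 := by
  by_cases ha : a = 0 <;> by_cases hb : b = 0 <;> simp [cf_apply, coeff_C, ha, hb]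

theorem cf_C_C_mul (r : R) (f : PowerSeries (PowerSeries R)) (a b : ℕ) :
    cf a b (C (C r) * f) = r * cf a b f := by
  simp [cf_apply, coeff_C_mul]

theorem cf_mul_C_C (r : R) (f : PowerSeries (PowerSeries R)) (a b : ℕ) :
    cf a b (f * C (C r)) = cf a b f * r := by
  simp [cf_apply, coeff_mul_C]

theorem ofCoeffs_mulS2 (F G : ℕ → ℕ → R) :
    ofCoeffs (mulS2 F G) = ofCoeffs F * ofCoeffs G := by
  refine ext_cf fun a b => ?_
  simp only [cf_mul, cf_ofCoeffs, mulS2]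
  rw [Nat.sum_antidiagonal_eq_sum_range_succ_mk]
  refine sum_congr rfl fun p _ => ?_
  rw [Nat.sum_antidiagonal_eq_sum_range_succ_mk]

theorem ofCoeffs_powS2 (F : ℕ → ℕ → R) (j : ℕ) :
    ofCoeffs (powS2 F j) = ofCoeffs F ^ j := by
  induction j with
  | zero =>
    refine ext_cf fun a b => ?_
    rw [pow_zero, cf_one, cf_ofCoeffs, powS2]
  | succ j ih => rw [powS2, ofCoeffs_mulS2, ih, pow_succ']

theorem powS2_eq_cf (F : ℕ → ℕ → R) (j a b : ℕ) :
    powS2 F j a b = cf a b (ofCoeffs F ^ j) := by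
  rw [← ofCoeffs_powS2, cf_ofCoeffs]

/-- All coefficients of total degree less than `d` vanish. -/
def VanishesBelow (d : ℕ) (f : PowerSeries (PowerSeries R)) : Prop :=
  ∀ a b, a + b < d → cf a b f = 0

theorem VanishesBelow.mul {d e : ℕ} {f g : PowerSeries (PowerSeries R)}
    (hf : VanishesBelow d f) (hg : VanishesBelow e g) : VanishesBelow (d + e) (f * g) := by
  intro a b h
  rw [cf_mul]
  refine sum_eq_zero fun p hp => sum_eq_zero fun q hq => ?_
  rw [HasAntidiagonal.mem_antidiagonal] at hp hq
  by_cases h1 : p.1 + q.1 < d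
  · rw [hf _ _ h1, zero_mul]
  · rw [hg _ _ (by omega), mul_zero]

theorem VanishesBelow.pow {f : PowerSeries (PowerSeries R)}
    (hf : VanishesBelow 1 f) (j : ℕ) : VanishesBelow j (f ^ j) := by
  induction j with
  | zero => exact fun a b h => absurd h (Nat.not_lt_zero _)
  | succ j ih => rw [pow_succ]; exact ih.mul hf

theorem VanishesBelow.smul {d : ℕ} {f : PowerSeries (PowerSeries R)}
    (hf : VanishesBelow d f) (r : ℂ) : VanishesBelow d (r • f) := fun a b h => by
  rw [map_smul, hf a b h, smul_zero]

/-- The partial sum of the exponential series. -/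
def expPartial (N : ℕ) (f : PowerSeries (PowerSeries R)) : PowerSeries (PowerSeries R) :=
  ∑ j ∈ range N, ((Nat.factorial j : ℂ))⁻¹ • f ^ j

theorem expS2_eq_cf_expPartial {F : ℕ → ℕ → R} (hF : F 0 0 = 0) {a b N : ℕ}
    (hN : a + b < N) : expS2 F a b = cf a b (expPartial N (ofCoeffs F)) := by
  have hv : VanishesBelow 1 (ofCoeffs F) := fun a b h => by
    obtain ⟨rfl, rfl⟩ : a = 0 ∧ b = 0 := by omega
    rw [cf_ofCoeffs, hF]
  rw [expS2, expPartial, map_sum]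
  simp only [map_smul, powS2_eq_cf]
  refine sum_subset (range_mono (by omega)) fun j _ hj => ?_
  rw [hv.pow j a b (by simpa using hj), smul_zero]

end Basic

section Derivative

variable {R : Type*} [Ring R] [Algebra ℂ R]

/-- The formal derivative `d/dx` of a series in `x⁻¹` and `log x`. -/
def ddx : PowerSeries (PowerSeries R) →ₗ[ℂ] PowerSeries (PowerSeries R) where
  toFun f := X * ofCoeffs fun a b => ((b : ℂ) + 1) • cf a (b + 1) f - (a : ℂ) • cf a b f
  map_add' f g := by
    rw [← mul_add]
    congr 1
    refine ext_cf fun a b => ?_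
    simp only [map_add, cf_ofCoeffs, smul_add]
    abel
  map_smul' r f := by
    rw [RingHom.id_apply, ← mul_smul_comm]
    congr 1
    refine ext_cf fun a b => ?_
    simp only [map_smul, cf_ofCoeffs, smul_sub, smul_comm r]

theorem cf_zero_ddx (b : ℕ) (f : PowerSeries (PowerSeries R)) : cf 0 b (ddx f) = 0 := by
  simp [ddx, cf_apply]

theorem cf_succ_ddx (a b : ℕ) (f : PowerSeries (PowerSeries R)) :
    cf (a + 1) b (ddx f) = ((b : ℂ) + 1) • cf a (b + 1) f - (a : ℂ) • cf a b f := by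
  rw [← cf_ofCoeffs (fun a b => ((b : ℂ) + 1) • cf a (b + 1) f - (a : ℂ) • cf a b f) a b]
  simp [ddx, cf_apply, coeff_succ_X_mul]

theorem smul_sum_antidiagonal_succ (b : ℕ) (g : ℕ → ℕ → R) :
    ((b : ℂ) + 1) • ∑ q ∈ antidiagonal (b + 1), g q.1 q.2
      = ∑ q ∈ antidiagonal b, (((q.1 : ℂ) + 1) • g (q.1 + 1) q.2
        + ((q.2 : ℂ) + 1) • g q.1 (q.2 + 1)) := by
  have h : ((b : ℂ) + 1) • ∑ q ∈ antidiagonal (b + 1), g q.1 q.2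
      = ∑ q ∈ antidiagonal (b + 1), (q.1 : ℂ) • g q.1 q.2
        + ∑ q ∈ antidiagonal (b + 1), (q.2 : ℂ) • g q.1 q.2 := by
    rw [smul_sum, ← sum_add_distrib]
    refine sum_congr rfl fun q hq => ?_
    rw [HasAntidiagonal.mem_antidiagonal] at hq
    rw [← add_smul]
    congr 1
    exact_mod_cast hq.symm
  rw [h, Nat.sum_antidiagonal_succ, Nat.sum_antidiagonal_succ', sum_add_distrib]
  simp

theorem ddx_mul (f g : PowerSeries (PowerSeries R)) :
    ddx (f * g) = ddx f * g + f * ddx g := by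
  have key : ∀ (f g : PowerSeries (PowerSeries R)),
      (ofCoeffs fun a b => ((b : ℂ) + 1) • cf a (b + 1) (f * g) - (a : ℂ) • cf a b (f * g))
      = (ofCoeffs fun a b => ((b : ℂ) + 1) • cf a (b + 1) f - (a : ℂ) • cf a b f) * g
        + f * ofCoeffs fun a b => ((b : ℂ) + 1) • cf a (b + 1) g - (a : ℂ) • cf a b g := by
    intro f g
    refine ext_cf fun a b => ?_
    simp only [map_add, cf_ofCoeffs, cf_mul]
    rw [smul_sum, smul_sum, ← sum_sub_distrib, ← sum_add_distrib]
    refine sum_congr rfl fun p hp => ?_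
    rw [HasAntidiagonal.mem_antidiagonal] at hp
    rw [smul_sum_antidiagonal_succ b (fun q q' => cf p.1 q f * cf p.2 q' g), smul_sum,
      ← sum_sub_distrib, ← sum_add_distrib]
    refine sum_congr rfl fun q _ => ?_
    have ha : (a : ℂ) = p.1 + p.2 := by exact_mod_cast hp.symm
    rw [ha]
    simp only [sub_mul, mul_sub, add_mul, mul_add, smul_mul_assoc, mul_smul_comm, add_smul,
      one_smul]
    abel
  change X * _ = X * _ * g + f * (X * _)
  rw [key, mul_add, mul_assoc, ← mul_assoc f X, ← X_mul (φ := f), mul_assoc]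

/-- The divided power `(d/dx)^n / n!`, the coefficient of `x₂^n` in the substitution
`x ↦ x + x₂`. -/
def taylor (n : ℕ) : PowerSeries (PowerSeries R) →ₗ[ℂ] PowerSeries (PowerSeries R) :=
  ((Nat.factorial n : ℂ))⁻¹ • ddx ^ n

@[simp]
theorem taylor_zero (f : PowerSeries (PowerSeries R)) : taylor 0 f = f := by
  simp [taylor]

theorem succ_smul_taylor_succ (n : ℕ) (f : PowerSeries (PowerSeries R)) :
    ((n : ℂ) + 1) • taylor (n + 1) f = ddx (taylor n f) := by
  have h : ((n : ℂ) + 1) ≠ 0 := by exact_mod_cast n.succ_ne_zero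
  simp only [taylor, LinearMap.smul_apply, map_smul, pow_succ', Module.End.mul_apply, smul_smul]
  congr 1
  rw [Nat.factorial_succ]
  push_cast
  field_simp

theorem eq_of_succ_smul {M : Type*} [AddCommGroup M] [Module ℂ M] {n : ℕ} {x y : M}
    (h : ((n : ℂ) + 1) • x = ((n : ℂ) + 1) • y) : x = y :=
  smul_right_injective M (by exact_mod_cast n.succ_ne_zero : ((n : ℂ) + 1) ≠ 0) h

theorem taylor_mul (n : ℕ) (f g : PowerSeries (PowerSeries R)) :
    taylor n (f * g) = ∑ p ∈ antidiagonal n, taylor p.1 f * taylor p.2 g := by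
  induction n with
  | zero => simp
  | succ n ih =>
    apply eq_of_succ_smul (n := n)
    rw [succ_smul_taylor_succ, ih, map_sum,
      smul_sum_antidiagonal_succ n (fun r s => taylor r f * taylor s g)]
    refine sum_congr rfl fun p _ => ?_
    rw [ddx_mul, ← succ_smul_taylor_succ, ← succ_smul_taylor_succ, smul_mul_assoc,
      mul_smul_comm]

theorem VanishesBelow.ddx {d : ℕ} {f : PowerSeries (PowerSeries R)}
    (hf : VanishesBelow d f) : VanishesBelow d (ddx f) := by
  rintro (_ | a) b h
  · exact cf_zero_ddx b f
  · rw [cf_succ_ddx, hf _ _ (by omega), hf _ _ (by omega), smul_zero, smul_zero, sub_zero]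

theorem VanishesBelow.taylor {d : ℕ} {f : PowerSeries (PowerSeries R)}
    (hf : VanishesBelow d f) (n : ℕ) : VanishesBelow d (taylor n f) := by
  induction n with
  | zero => rwa [taylor_zero]
  | succ n ih =>
    intro a b h
    apply eq_of_succ_smul (n := n)
    rw [← map_smul, succ_smul_taylor_succ, ih.ddx a b h, smul_zero]

theorem cf_taylor_of_lt {n a : ℕ} (h : a < n) (b : ℕ) (f : PowerSeries (PowerSeries R)) :
    cf a b (taylor n f) = 0 := by
  induction n generalizing a b with
  | zero => omega
  | succ n ih =>
    apply eq_of_succ_smul (n := n)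
    rw [← map_smul, succ_smul_taylor_succ, smul_zero]
    cases a with
    | zero => exact cf_zero_ddx b _
    | succ a =>
      rw [cf_succ_ddx, ih (by omega), ih (by omega), smul_zero, smul_zero, sub_zero]

end Derivative

section Substitution

theorem succ_mul_cchoose_succ (r : ℂ) (n : ℕ) :
    ((n : ℂ) + 1) * cchoose r (n + 1) = (r - n) * cchoose r n := by
  have h : ((n : ℂ) + 1) ≠ 0 := by exact_mod_cast n.succ_ne_zero
  rw [cchoose, cchoose, prod_range_succ, Nat.factorial_succ]
  push_cast
  field_simp

theorem cchoose_zero_right (r : ℂ) : cchoose r 0 = 1 := by simp [cchoose]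

/-- The binomial series `(1 + z)^r`. -/
def binomSeries (r : ℂ) : PowerSeries ℂ := PowerSeries.mk (cchoose r)

/-- The series `log (1 + z)`. -/
def logSeries : PowerSeries ℂ :=
  PowerSeries.mk fun i => if 1 ≤ i then (-1 : ℂ) ^ (i + 1) / i else 0

theorem lamc_eq_coeff (c m : ℕ) : lamc c m = coeff m (logSeries ^ c) := by
  induction c generalizing m with
  | zero => simp [lamc, coeff_one]
  | succ c ih =>
    rw [lamc, pow_succ', coeff_mul, Nat.sum_antidiagonal_eq_sum_range_succ_mk]
    refine sum_congr rfl fun i _ => ?_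
    rw [ih, logSeries, coeff_mk, ite_mul, zero_mul]

theorem lamc_of_lt {c m : ℕ} (h : m < c) : lamc c m = 0 := by
  rw [lamc_eq_coeff]
  refine coeff_of_lt_order _ (lt_of_lt_of_le (b := (c : ℕ∞)) (by exact_mod_cast h) ?_)
  refine le_order_pow_of_constantCoeff_eq_zero c ?_
  simp [logSeries]

theorem one_add_X_mul_derivative_binomSeries (r : ℂ) :
    (1 + X) * derivative ℂ (binomSeries r) = C r * binomSeries r := by
  ext n
  rw [add_mul, one_mul, map_add, coeff_derivative, coeff_C_mul, mul_comm,
    binomSeries, coeff_mk, succ_mul_cchoose_succ]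
  cases n with
  | zero => simp
  | succ n =>
    rw [coeff_succ_X_mul, coeff_derivative, coeff_mk]
    push_cast
    ring

theorem one_add_X_mul_derivative_logSeries :
    (1 + X) * derivative ℂ logSeries = 1 := by
  ext n
  rw [add_mul, one_mul, map_add, coeff_derivative, logSeries, coeff_mk, coeff_one]
  cases n with
  | zero => simp
  | succ n =>
    have h1 : ((n : ℂ) + 1) ≠ 0 := by exact_mod_cast n.succ_ne_zero
    have h2 : ((n : ℂ) + 1 + 1) ≠ 0 := by exact_mod_cast (n + 1).succ_ne_zero
    rw [coeff_succ_X_mul, coeff_derivative, coeff_mk]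
    simp only [le_add_iff_nonneg_left, zero_le, if_true, Nat.succ_ne_zero, if_false]
    push_cast
    field_simp
    ring

/-- The coefficient of `z^n` in `(1 + z)^{-a} (log (1 + z))^c`. -/
def substCoeff (a c n : ℕ) : ℂ := coeff n (binomSeries (-(a : ℂ)) * logSeries ^ c)

theorem substCoeff_eq_sum (a c n : ℕ) :
    substCoeff a c n = ∑ p ∈ antidiagonal n, cchoose (-(a : ℂ)) p.1 * lamc c p.2 := by
  rw [substCoeff, coeff_mul]
  exact sum_congr rfl fun p _ => by rw [binomSeries, coeff_mk, lamc_eq_coeff]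

theorem substCoeff_of_lt {a c n : ℕ} (h : n < c) : substCoeff a c n = 0 := by
  rw [substCoeff_eq_sum]
  refine sum_eq_zero fun p hp => ?_
  rw [HasAntidiagonal.mem_antidiagonal] at hp
  rw [lamc_of_lt (by omega), mul_zero]

theorem succ_mul_substCoeff_succ (a c n : ℕ) :
    ((n : ℂ) + 1) * substCoeff a c (n + 1)
      = -((a : ℂ) + n) * substCoeff a c n + c * substCoeff a (c - 1) n := by
  have h : (1 + X) * derivative ℂ (binomSeries (-(a : ℂ)) * logSeries ^ c)
      = C (-(a : ℂ)) * (binomSeries (-(a : ℂ)) * logSeries ^ c)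
        + C (c : ℂ) * (binomSeries (-(a : ℂ)) * logSeries ^ (c - 1)) := by
    rw [Derivation.leibniz, Derivation.leibniz_pow]
    simp only [smul_eq_mul, nsmul_eq_mul]
    have h1 := one_add_X_mul_derivative_binomSeries (-(a : ℂ))
    have h2 := one_add_X_mul_derivative_logSeries
    have h3 : (C (c : ℂ) : PowerSeries ℂ) = c := map_natCast _ _
    rw [h3]
    linear_combination logSeries ^ c * h1
      + binomSeries (-(a : ℂ)) * (c * logSeries ^ (c - 1)) * h2
  have h' := congrArg (coeff n) h
  rw [add_mul, one_mul, map_add, map_add, coeff_derivative, coeff_C_mul, coeff_C_mul] at h'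
  simp only [substCoeff]
  cases n with
  | zero =>
    rw [coeff_zero_X_mul] at h'
    linear_combination h'
  | succ n =>
    rw [coeff_succ_X_mul, coeff_derivative] at h'
    push_cast at h' ⊢
    linear_combination h'

variable {R : Type*} [Ring R] [Algebra ℂ R]

theorem cf_taylor (a b n : ℕ) (f : PowerSeries (PowerSeries R)) :
    cf (a + n) b (taylor n f)
      = ∑ c ∈ range (n + 1),
          (substCoeff a c n * ((b + c).choose c : ℕ)) • cf a (b + c) f := by
  induction n generalizing b with
  | zero => simp [substCoeff, binomSeries, cchoose_zero_right]
  | succ n ih =>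
    apply eq_of_succ_smul (n := n)
    rw [← map_smul, succ_smul_taylor_succ, ← add_assoc, cf_succ_ddx, ih, ih]
    have h1 : ∑ c ∈ range (n + 1),
          (substCoeff a c n * ((b + c).choose c : ℕ)) • cf a (b + c) f
        = ∑ c ∈ range (n + 1 + 1),
          (substCoeff a c n * ((b + c).choose c : ℕ)) • cf a (b + c) f := by
      rw [sum_range_succ _ (n + 1), substCoeff_of_lt (Nat.lt_succ_self n), zero_mul, zero_smul,
        add_zero]
    have h2 : ((b : ℂ) + 1) • ∑ c ∈ range (n + 1),
          (substCoeff a c n * ((b + 1 + c).choose c : ℕ)) • cf a (b + 1 + c) f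
        = ∑ c ∈ range (n + 1 + 1),
          (c * substCoeff a (c - 1) n * ((b + c).choose c : ℕ)) • cf a (b + c) f := by
      rw [sum_range_succ' _ (n + 1), smul_sum]
      simp only [Nat.cast_zero, zero_mul, zero_smul, add_zero]
      refine sum_congr rfl fun c _ => ?_
      have h : ((b : ℂ) + 1) * ((b + 1 + c).choose c : ℕ)
          = (c + 1) * ((b + (c + 1)).choose (c + 1) : ℕ) := by
        have h := Nat.choose_succ_right_eq (b + (c + 1)) c
        rw [show b + (c + 1) - c = b + 1 by omega] at h
        rw [show b + 1 + c = b + (c + 1) by ring]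
        have h' : (((b + (c + 1)).choose (c + 1) : ℕ) : ℂ) * (c + 1)
          = ((b + (c + 1)).choose c : ℕ) * (b + 1) := by exact_mod_cast h
        linear_combination -h'
      rw [smul_smul, show b + 1 + c = b + (c + 1) by ring, Nat.add_sub_cancel]
      rw [show b + 1 + c = b + (c + 1) by ring] at h
      congr 1
      push_cast
      linear_combination substCoeff a c n * h
    rw [h1, h2, smul_sum, smul_sum, ← sum_sub_distrib]
    refine sum_congr rfl fun c _ => ?_
    rw [smul_smul, smul_smul, ← sub_smul]
    congr 1
    have h := succ_mul_substCoeff_succ a c n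
    push_cast
    linear_combination -((b + c).choose c : ℂ) * h

end Substitution

section Commutator

theorem cchoose_natCast (p i : ℕ) : cchoose (p : ℂ) i = (p.choose i : ℕ) := by
  induction i with
  | zero => simp [cchoose_zero_right]
  | succ i ih =>
    have hi : ((i : ℂ) + 1) ≠ 0 := by exact_mod_cast i.succ_ne_zero
    apply mul_left_cancel₀ hi
    rw [succ_mul_cchoose_succ, ih]
    rcases le_or_gt i p with h | h
    · have h' := Nat.choose_succ_right_eq p i
      have h'' : ((p.choose (i + 1) : ℕ) : ℂ) * (i + 1) = (p.choose i : ℕ) * ((p : ℂ) - i) := by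
        rw [← Nat.cast_sub h]
        exact_mod_cast h'
      linear_combination -h''
    · rw [Nat.choose_eq_zero_of_lt h, Nat.choose_eq_zero_of_lt (by omega)]
      simp

theorem cchoose_neg (r : ℂ) (i : ℕ) :
    cchoose ((i : ℂ) - r - 1) i * (-1 : ℂ) ^ i = cchoose r i := by
  rw [cchoose, cchoose, div_mul_eq_mul_div, ← prod_range_reflect]
  congr 1
  rw [← card_range i, ← prod_const, card_range, ← prod_mul_distrib]
  refine prod_congr rfl fun j hj => ?_
  rw [mem_range] at hj
  rw [Nat.cast_sub (by omega), Nat.cast_sub (by omega)]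
  push_cast
  ring

theorem cchoose_zero_left {i : ℕ} (hi : i ≠ 0) : cchoose 0 i = 0 := by
  have h := cchoose_natCast 0 i
  rwa [Nat.cast_zero, Nat.choose_eq_zero_of_lt (Nat.pos_of_ne_zero hi), Nat.cast_zero] at h

variable {V : Type*} [AddCommGroup V] [Module ℂ V] {W : Type*} [AddCommGroup W] [Module ℂ W]
variable (A : VOA V) (M : WeakModule A W)

theorem Yw_commutator (u v : V) (p : ℕ) (e : ℤ) :
    M.Yw u p * M.Yw v e - M.Yw v e * M.Yw u p
      = ∑ i ∈ range (p + 1), ((p.choose i : ℕ) : ℂ) • M.Yw (A.Y u i v) ((p : ℤ) + e - i) := by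
  ext w
  have h := M.jacobi u v w 0 p e
  rw [finsum_eq_single _ 0 fun i hi => by
      rw [Int.cast_zero, cchoose_zero_left hi, zero_mul, zero_smul],
    finsum_eq_single _ 0 fun i hi => by
      rw [Int.cast_zero, cchoose_zero_left hi, zero_mul, zero_smul],
    finsum_eq_sum_of_support_subset (s := range (p + 1))] at h
  · simp only [cchoose_zero_right, Int.cast_natCast, cchoose_neg, cchoose_natCast, zero_add,
      CharP.cast_eq_zero, sub_zero, add_zero, pow_zero, zpow_zero, mul_one,
      one_smul] at h
    simpa using h
  · intro i hi
    rw [Function.mem_support] at hi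
    by_contra h'
    apply hi
    rw [Int.cast_natCast, cchoose_neg, cchoose_natCast,
      Nat.choose_eq_zero_of_lt (by simpa using h'), Nat.cast_zero, zero_smul]

theorem cf_taylor_expExponentV (u : V) (r p q : ℕ) :
    cf p q (taylor r (ofCoeffs (expExponentV A u)))
      = if q = 0 ∧ 1 ≤ p then
          ((-1 : ℂ) ^ p / (-(p : ℂ)) * (p.choose r : ℕ)) • A.Y u ((p - r : ℕ) : ℤ)
        else if q = 1 ∧ p = 0 ∧ r = 0 then A.Y u 0 else 0 := by
  induction r generalizing p q with
  | zero => simp [expExponentV]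
  | succ r ih =>
    apply eq_of_succ_smul (n := r)
    rw [← map_smul, succ_smul_taylor_succ]
    cases p with
    | zero => simp [cf_zero_ddx]
    | succ p =>
      rw [cf_succ_ddx, ih, ih]
      have h1 : ((p : ℂ) + 1) ≠ 0 := by exact_mod_cast p.succ_ne_zero
      rcases q with _ | q
      · rcases p with _ | p
        · rcases r with _ | r
          · simp
          · simp [Nat.choose_eq_zero_of_lt (show 1 < r + 1 + 1 by omega)]
        · have h2 : ((p : ℂ) + 1 + 1) ≠ 0 := by exact_mod_cast (p + 1).succ_ne_zero
          have h := Nat.add_one_mul_choose_eq (p + 1) r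
          have h' : ((p : ℂ) + 1 + 1) * ((p + 1).choose r : ℕ)
              = ((p + 1 + 1).choose (r + 1) : ℕ) * (r + 1) := by exact_mod_cast h
          simp only [Nat.succ_ne_zero, false_and, and_false, if_false, smul_zero, zero_sub,
            le_add_iff_nonneg_left, zero_le, and_self, if_true, smul_smul, ← neg_smul,
            Nat.add_sub_add_right]
          congr 1
          push_cast
          push_cast at h1
          field_simp
          linear_combination -(-1) ^ p * h'
      · simp +contextual

theorem expExponent_commutator (u w : V) (p q : ℕ) (e : ℤ) :
    expExponentW A M u p q * M.Yw w e - M.Yw w e * expExponentW A M u p q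
      = ∑ r ∈ range (p + 1),
          M.Yw (cf p q (taylor r (ofCoeffs (expExponentV A u))) w) ((r : ℤ) + e) := by
  simp only [cf_taylor_expExponentV, expExponentW]
  split_ifs with h1 h2
  · rw [smul_mul_assoc, mul_smul_comm, ← smul_sub, Yw_commutator, ← sum_range_reflect, smul_sum]
    refine sum_congr rfl fun r hr => ?_
    rw [mem_range] at hr
    have hr' : p + 1 - 1 - r = p - r := by omega
    rw [hr', Nat.choose_symm (by omega), smul_smul, LinearMap.smul_apply, map_smul,
      Pi.smul_apply]
    congr 2
    rw [Nat.cast_sub (by omega)]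
    ring_nf
  · obtain ⟨rfl, rfl⟩ := h2
    have h := Yw_commutator A M u w 0 e
    simpa using h
  · have h3 : ∀ r, ¬ (q = 1 ∧ p = 0 ∧ r = 0) := fun r hr => h2 ⟨hr.1, hr.2.1⟩
    simp [h3]

theorem sum_antidiagonal_of_bounded {G : Type*} [AddCommMonoid G] {a b : ℕ} (g : ℕ → ℕ → G)
    (h : ∀ r s, a < r ∨ b < s → g r s = 0) :
    ∑ n ∈ range (a + b + 1), ∑ p ∈ antidiagonal n, g p.1 p.2
      = ∑ r ∈ range (a + 1), ∑ s ∈ range (b + 1), g r s := by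
  rw [← sum_product', ← sum_fiberwise_of_maps_to (g := fun p : ℕ × ℕ => p.1 + p.2)
    (t := range (a + b + 1)) (fun p hp => by
      simp only [mem_product, mem_range] at hp ⊢
      omega)]
  refine sum_congr rfl fun n _ => (sum_subset (fun p hp => ?_) fun p hp hp' => ?_).symm
  · simpa using (mem_filter.mp hp).2
  · apply h
    rw [HasAntidiagonal.mem_antidiagonal] at hp
    simp only [mem_filter, mem_product, mem_range, hp, and_true] at hp'
    omega

/-- The coefficient of `x₂^{-e-1}` in `Y_W(f(x + x₂) v, x₂)`. -/
def substY (v : V) (e : ℤ) :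
    PowerSeries (PowerSeries (Module.End ℂ V)) →ₗ[ℂ]
      PowerSeries (PowerSeries (Module.End ℂ W)) where
  toFun f := ofCoeffs fun a b =>
    ∑ n ∈ range (a + 1), M.Yw (cf a b (taylor n f) v) ((n : ℤ) + e)
  map_add' f g := by
    refine ext_cf fun a b => ?_
    simp [sum_add_distrib]
  map_smul' r f := by
    refine ext_cf fun a b => ?_
    simp [smul_sum]

theorem cf_substY (v : V) (e : ℤ) (f : PowerSeries (PowerSeries (Module.End ℂ V)))
    (a b : ℕ) :
    cf a b (substY A M v e f)
      = ∑ n ∈ range (a + 1), M.Yw (cf a b (taylor n f) v) ((n : ℤ) + e) := by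
  simp [substY]

theorem substY_one (v : V) (e : ℤ) : substY A M v e 1 = C (C (M.Yw v e)) := by
  refine ext_cf fun a b => ?_
  rw [cf_substY, cf_C_C, sum_eq_single_of_mem 0 (by simp)]
  · rw [taylor_zero, cf_one]
    split_ifs <;> simp
  · intro n _ hn
    obtain ⟨n, rfl⟩ := Nat.exists_eq_succ_of_ne_zero hn
    have h : ddx (1 : PowerSeries (PowerSeries (Module.End ℂ V))) = 0 := by
      have h := ddx_mul (1 : PowerSeries (PowerSeries (Module.End ℂ V))) 1
      simpa using h
    have h' : taylor (n + 1) (1 : PowerSeries (PowerSeries (Module.End ℂ V))) = 0 := by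
      simp [taylor, pow_succ, h]
    simp [h']

theorem VanishesBelow.substY {d : ℕ} {f : PowerSeries (PowerSeries (Module.End ℂ V))}
    (hf : VanishesBelow d f) (v : V) (e : ℤ) : VanishesBelow d (substY A M v e f) := by
  intro a b h
  rw [cf_substY]
  refine sum_eq_zero fun n _ => ?_
  rw [hf.taylor n a b h]
  simp

theorem expExponent_mul_substY (u v : V) (e : ℤ)
    (f : PowerSeries (PowerSeries (Module.End ℂ V))) :
    ofCoeffs (expExponentW A M u) * substY A M v e f
        - substY A M v e f * ofCoeffs (expExponentW A M u)
      = substY A M v e (ofCoeffs (expExponentV A u) * f) := by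
  refine ext_cf fun a b => ?_
  set F := ofCoeffs (expExponentV A u) with hF
  have hr : cf a b (substY A M v e (F * f))
      = ∑ p ∈ antidiagonal a, ∑ q ∈ antidiagonal b,
          ∑ r ∈ range (p.1 + 1), ∑ s ∈ range (p.2 + 1),
            M.Yw (cf p.1 q.1 (taylor r F) (cf p.2 q.2 (taylor s f) v))
              ((r : ℤ) + ((s : ℤ) + e)) := by
    have h1 : cf a b (substY A M v e (F * f))
        = ∑ n ∈ range (a + 1), ∑ t ∈ antidiagonal n, ∑ p ∈ antidiagonal a,
            ∑ q ∈ antidiagonal b,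
              M.Yw (cf p.1 q.1 (taylor t.1 F) (cf p.2 q.2 (taylor t.2 f) v))
                ((t.1 : ℤ) + ((t.2 : ℤ) + e)) := by
      rw [cf_substY]
      refine sum_congr rfl fun n _ => ?_
      rw [taylor_mul]
      simp only [map_sum, cf_mul, LinearMap.sum_apply, Finset.sum_apply, Module.End.mul_apply]
      refine sum_congr rfl fun t ht => ?_
      rw [HasAntidiagonal.mem_antidiagonal] at ht
      rw [← ht]
      push_cast
      simp only [add_assoc]
    have h2 : ∀ n, ∑ t ∈ antidiagonal n, ∑ p ∈ antidiagonal a, ∑ q ∈ antidiagonal b,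
          M.Yw (cf p.1 q.1 (taylor t.1 F) (cf p.2 q.2 (taylor t.2 f) v))
            ((t.1 : ℤ) + ((t.2 : ℤ) + e))
        = ∑ p ∈ antidiagonal a, ∑ q ∈ antidiagonal b, ∑ t ∈ antidiagonal n,
          M.Yw (cf p.1 q.1 (taylor t.1 F) (cf p.2 q.2 (taylor t.2 f) v))
            ((t.1 : ℤ) + ((t.2 : ℤ) + e)) := fun n => by
      rw [sum_comm]
      exact sum_congr rfl fun p _ => sum_comm
    rw [h1]
    simp only [h2]
    rw [sum_comm]
    refine sum_congr rfl fun p hp => ?_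
    rw [sum_comm]
    refine sum_congr rfl fun q _ => ?_
    rw [HasAntidiagonal.mem_antidiagonal] at hp
    rw [← hp]
    refine sum_antidiagonal_of_bounded (fun r s =>
      M.Yw (cf p.1 q.1 (taylor r F) (cf p.2 q.2 (taylor s f) v)) ((r : ℤ) + ((s : ℤ) + e))) ?_
    rintro r s (h | h)
    · simp [cf_taylor_of_lt h]
    · simp [cf_taylor_of_lt h]
  have hswap : cf a b (substY A M v e f * ofCoeffs (expExponentW A M u))
      = ∑ p ∈ antidiagonal a, ∑ q ∈ antidiagonal b,
          cf p.2 q.2 (substY A M v e f) * cf p.1 q.1 (ofCoeffs (expExponentW A M u)) := by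
    rw [cf_mul, ← Nat.sum_antidiagonal_swap]
    refine sum_congr rfl fun p _ => ?_
    rw [← Nat.sum_antidiagonal_swap]
    rfl
  rw [hr, map_sub, hswap, cf_mul, ← sum_sub_distrib]
  refine sum_congr rfl fun p _ => ?_
  rw [← sum_sub_distrib]
  refine sum_congr rfl fun q _ => ?_
  rw [cf_substY, mul_sum, sum_mul, ← sum_sub_distrib, sum_comm]
  refine sum_congr rfl fun s _ => ?_
  rw [cf_ofCoeffs, expExponent_commutator]

end Commutator

section Conjugation

variable {V : Type*} [AddCommGroup V] [Module ℂ V] {W : Type*} [AddCommGroup W] [Module ℂ W]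
variable (A : VOA V) (M : WeakModule A W)

theorem expExponent_pow_mul_C (u v : V) (e : ℤ) (j : ℕ) :
    ofCoeffs (expExponentW A M u) ^ j * C (C (M.Yw v e))
      = ∑ k ∈ antidiagonal j, j.choose k.1 •
          (substY A M v e (ofCoeffs (expExponentV A u) ^ k.1)
            * ofCoeffs (expExponentW A M u) ^ k.2) := by
  set F := ofCoeffs (expExponentW A M u) with hF
  set G := ofCoeffs (expExponentV A u)
  set l := LinearMap.mulLeft ℂ F
  set r := LinearMap.mulRight ℂ F
  have hlr : Commute l r := LinearMap.commute_mulLeft_right F F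
  have had : ∀ k, ((l - r) ^ k) (substY A M v e 1) = substY A M v e (G ^ k) := by
    intro k
    induction k with
    | zero => simp
    | succ k ih =>
      rw [pow_succ', Module.End.mul_apply, ih, pow_succ']
      exact expExponent_mul_substY A M u v e (G ^ k)
  have hcomm : Commute (l - r) r := hlr.sub_left (Commute.refl r)
  calc F ^ j * C (C (M.Yw v e))
      = (l ^ j) (substY A M v e 1) := by
        rw [LinearMap.pow_mulLeft, substY_one, LinearMap.mulLeft_apply]
    _ = ((l - r + r) ^ j) (substY A M v e 1) := by rw [sub_add_cancel]
    _ = _ := by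
        rw [hcomm.add_pow', LinearMap.sum_apply]
        refine sum_congr rfl fun k _ => ?_
        rw [LinearMap.smul_apply, (hcomm.pow_pow _ _).eq, Module.End.mul_apply, had,
          LinearMap.pow_mulRight, LinearMap.mulRight_apply]

theorem sum_range_antidiagonal {G : Type*} [AddCommMonoid G] {N : ℕ} (g : ℕ → ℕ → G)
    (h : ∀ k i, N ≤ k + i → g k i = 0) :
    ∑ n ∈ range N, ∑ p ∈ antidiagonal n, g p.1 p.2
      = ∑ k ∈ range N, ∑ i ∈ range N, g k i := by
  simp only [Nat.sum_antidiagonal_eq_sum_range_succ_mk]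
  rw [sum_range_diag_flip N g]
  refine sum_congr rfl fun k _ => sum_subset (range_mono (Nat.sub_le N k)) fun i _ hi => ?_
  rw [mem_range] at hi
  exact h k i (by omega)

theorem vanishesBelow_one_expExponentW (u : V) :
    VanishesBelow 1 (ofCoeffs (expExponentW A M u)) := fun a b h => by
  obtain ⟨rfl, rfl⟩ : a = 0 ∧ b = 0 := by omega
  simp [expExponentW]

theorem vanishesBelow_one_expExponentV (u : V) :
    VanishesBelow 1 (ofCoeffs (expExponentV A u)) := fun a b h => by
  obtain ⟨rfl, rfl⟩ : a = 0 ∧ b = 0 := by omega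
  simp [expExponentV]

theorem vanishesBelow_expPartial_mul_C_sub (u v : V) (e : ℤ) (N : ℕ) :
    VanishesBelow N (expPartial N (ofCoeffs (expExponentW A M u)) * C (C (M.Yw v e))
      - substY A M v e (expPartial N (ofCoeffs (expExponentV A u)))
        * expPartial N (ofCoeffs (expExponentW A M u))) := by
  set F := ofCoeffs (expExponentW A M u) with hF
  set G := ofCoeffs (expExponentV A u) with hG
  intro a b hab
  let g : ℕ → ℕ → PowerSeries (PowerSeries (Module.End ℂ W)) := fun k i =>
    substY A M v e (((Nat.factorial k : ℂ))⁻¹ • G ^ k) * (((Nat.factorial i : ℂ))⁻¹ • F ^ i)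
  have h1 : expPartial N F * C (C (M.Yw v e))
      = ∑ n ∈ range N, ∑ p ∈ antidiagonal n, g p.1 p.2 := by
    rw [expPartial, sum_mul]
    refine sum_congr rfl fun j _ => ?_
    rw [smul_mul_assoc, expExponent_pow_mul_C, smul_sum]
    refine sum_congr rfl fun k hk => ?_
    rw [HasAntidiagonal.mem_antidiagonal] at hk
    simp only [g]
    rw [map_smul, smul_mul_smul_comm, ← Nat.cast_smul_eq_nsmul ℂ, smul_smul]
    congr 1
    subst hk
    have h2 : ((k.1.factorial : ℕ) : ℂ) ≠ 0 := by exact_mod_cast k.1.factorial_ne_zero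
    have h3 : ((k.2.factorial : ℕ) : ℂ) ≠ 0 := by exact_mod_cast k.2.factorial_ne_zero
    have h4 : (((k.1 + k.2).factorial : ℕ) : ℂ) ≠ 0 := by
      exact_mod_cast (k.1 + k.2).factorial_ne_zero
    have h5 : (((k.1 + k.2).choose k.1 : ℕ) : ℂ) * (k.1.factorial : ℕ) * (k.2.factorial : ℕ)
        = ((k.1 + k.2).factorial : ℕ) := by
      have h := Nat.add_choose_mul_factorial_mul_factorial k.1 k.2
      rw [← Nat.choose_symm_add] at h
      exact_mod_cast h
    field_simp
    linear_combination h5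
  have h2 : substY A M v e (expPartial N G) * expPartial N F
      = ∑ k ∈ range N, ∑ i ∈ range N, g k i := by
    rw [expPartial, expPartial, map_sum, sum_mul_sum]
  rw [h1, h2, map_sub, map_sum, map_sum, sub_eq_zero]
  simp only [map_sum]
  refine sum_range_antidiagonal (fun k i => cf a b (g k i)) fun k i hki => ?_
  refine (((((vanishesBelow_one_expExponentV A u).pow k).smul _).substY A M v e).mul
    (((vanishesBelow_one_expExponentW A M u).pow i).smul _)) a b ?_
  omega

theorem VanishesBelow.mul_left_factor {d : ℕ} {f g : PowerSeries (PowerSeries (Module.End ℂ W))}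
    (hf : VanishesBelow d f) : VanishesBelow d (f * g) := by
  simpa using hf.mul (e := 0) (g := g) fun a b h => absurd h (Nat.not_lt_zero _)

theorem VanishesBelow.mul_right_factor {d : ℕ} {f g : PowerSeries (PowerSeries (Module.End ℂ W))}
    (hg : VanishesBelow d g) : VanishesBelow d (f * g) := by
  simpa using VanishesBelow.mul (d := 0) (f := f)
    (fun a b h => absurd h (Nat.not_lt_zero _)) hg

theorem DeltaTildeW_mul_C (u v : V) (e : ℤ) :
    ofCoeffs (DeltaTildeW A M u) * C (C (M.Yw v e))
      = substY A M v e (ofCoeffs (DeltaTildeV A u)) * ofCoeffs (DeltaTildeW A M u) := by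
  refine ext_cf fun a b => ?_
  set N := a + b + 1
  set P := expPartial N (ofCoeffs (expExponentW A M u))
  set Q := expPartial N (ofCoeffs (expExponentV A u))
  have hP : VanishesBelow N (ofCoeffs (DeltaTildeW A M u) - P) := fun a b h => by
    rw [map_sub, cf_ofCoeffs, DeltaTildeW,
      expS2_eq_cf_expPartial (by simp [expExponentW]) h, sub_self]
  have hQ : VanishesBelow N (ofCoeffs (DeltaTildeV A u) - Q) := fun a b h => by
    rw [map_sub, cf_ofCoeffs, DeltaTildeV,
      expS2_eq_cf_expPartial (by simp [expExponentV]) h, sub_self]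
  have h1 := hP.mul_left_factor (g := C (C (M.Yw v e))) a b (Nat.lt_succ_self _)
  have h2 := vanishesBelow_expPartial_mul_C_sub A M u v e N a b (Nat.lt_succ_self _)
  have h3 := hP.mul_right_factor (f := substY A M v e Q) a b (Nat.lt_succ_self _)
  have h4 := (hQ.substY A M v e).mul_left_factor (g := ofCoeffs (DeltaTildeW A M u)) a b
    (Nat.lt_succ_self _)
  rw [sub_mul, map_sub, sub_eq_zero] at h1
  rw [map_sub, sub_eq_zero] at h2
  rw [mul_sub, map_sub, sub_eq_zero] at h3
  rw [map_sub, sub_mul, map_sub, sub_eq_zero] at h4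
  rw [h1, h2, ← h3, ← h4]

theorem finsum_eq_sum_range {G : Type*} [AddCommMonoid G] {N : ℕ} (g : ℕ → G)
    (h : ∀ n, N ≤ n → g n = 0) : ∑ᶠ n, g n = ∑ n ∈ range N, g n := by
  refine finsum_eq_sum_of_support_subset g fun n hn => ?_
  rw [Function.mem_support] at hn
  by_contra h'
  exact hn (h n (by simpa using h'))

theorem finsum_seven_eq_sum_range {G : Type*} [AddCommMonoid G] {N : ℕ}
    (t : ℕ → ℕ → ℕ → ℕ → ℕ → ℕ → ℕ → G)
    (h : ∀ a b l c m a' b', N ≤ a ∨ N ≤ b ∨ N ≤ l ∨ N ≤ c ∨ N ≤ m ∨ N ≤ a' ∨ N ≤ b' →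
      t a b l c m a' b' = 0) :
    ∑ᶠ (a : ℕ) (b : ℕ) (l : ℕ) (c : ℕ) (m : ℕ) (a' : ℕ) (b' : ℕ), t a b l c m a' b'
      = ∑ a ∈ range N, ∑ b ∈ range N, ∑ l ∈ range N, ∑ c ∈ range N, ∑ m ∈ range N,
          ∑ a' ∈ range N, ∑ b' ∈ range N, t a b l c m a' b' := by
  rw [finsum_eq_sum_range (N := N) _ fun n hn => by simp [h, hn]]
  refine sum_congr rfl fun a _ => ?_
  rw [finsum_eq_sum_range (N := N) _ fun n hn => by simp [h, hn]]
  refine sum_congr rfl fun b _ => ?_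
  rw [finsum_eq_sum_range (N := N) _ fun n hn => by simp [h, hn]]
  refine sum_congr rfl fun l _ => ?_
  rw [finsum_eq_sum_range (N := N) _ fun n hn => by simp [h, hn]]
  refine sum_congr rfl fun c _ => ?_
  rw [finsum_eq_sum_range (N := N) _ fun n hn => by simp [h, hn]]
  refine sum_congr rfl fun m _ => ?_
  rw [finsum_eq_sum_range (N := N) _ fun n hn => by simp [h, hn]]
  refine sum_congr rfl fun a' _ => ?_
  rw [finsum_eq_sum_range (N := N) _ fun n hn => by simp [h, hn]]

theorem sum_seven_reindex {G : Type*} [AddCommMonoid G] {a₀ b₀ N : ℕ} (hN : a₀ + b₀ < N)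
    (t : ℕ → ℕ → ℕ → ℕ → ℕ → ℕ → ℕ → G) :
    ∑ p ∈ antidiagonal a₀, ∑ q ∈ antidiagonal b₀, ∑ n ∈ range (p.1 + 1), ∑ c ∈ range N,
        ∑ s ∈ antidiagonal n, t (p.1 - n) q.1 s.1 c s.2 p.2 q.2
      = ∑ a ∈ range N, ∑ b ∈ range N, ∑ l ∈ range N, ∑ c ∈ range N, ∑ m ∈ range N,
          ∑ a' ∈ range N, ∑ b' ∈ range N,
            if a + l + m + a' = a₀ ∧ b + b' = b₀ then t a b l c m a' b' else 0 := by
  simp only [sum_sigma']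
  rw [← sum_filter]
  refine sum_nbij'
    (fun x => ⟨x.1.1 - x.2.2.1, x.2.1.1, x.2.2.2.2.1, x.2.2.2.1, x.2.2.2.2.2, x.1.2, x.2.1.2⟩)
    (fun y => ⟨(y.1 + y.2.2.1 + y.2.2.2.2.1, y.2.2.2.2.2.1), (y.2.1, y.2.2.2.2.2.2),
      y.2.2.1 + y.2.2.2.2.1, y.2.2.2.1, (y.2.2.1, y.2.2.2.2.1)⟩) ?_ ?_ ?_ ?_ ?_
  · rintro ⟨⟨p, p'⟩, ⟨q, q'⟩, n, c, ⟨s, s'⟩⟩ h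
    simp only [mem_sigma, mem_filter, mem_range, HasAntidiagonal.mem_antidiagonal] at h ⊢
    omega
  · rintro ⟨a, b, l, c, m, a', b'⟩ h
    simp only [mem_sigma, mem_filter, mem_range, HasAntidiagonal.mem_antidiagonal, and_true] at h ⊢
    omega
  · rintro ⟨⟨p, p'⟩, ⟨q, q'⟩, n, c, ⟨s, s'⟩⟩ h
    simp only [mem_sigma, mem_range, HasAntidiagonal.mem_antidiagonal] at h
    obtain ⟨h1, h2, h3, h4, rfl⟩ := h
    simp only [Sigma.mk.injEq, Prod.mk.injEq, heq_eq_eq, and_true]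
    omega
  · rintro ⟨a, b, l, c, m, a', b'⟩ h
    simp only [Sigma.mk.injEq, heq_eq_eq, and_true]
    omega
  · rintro ⟨⟨p, p'⟩, ⟨q, q'⟩, n, c, ⟨s, s'⟩⟩ h
    rfl

theorem cf_substY_ofCoeffs (v : V) (e : ℤ) (F : ℕ → ℕ → Module.End ℂ V) {a b N : ℕ}
    (hN : a < N) :
    cf a b (substY A M v e (ofCoeffs F))
      = ∑ n ∈ range (a + 1), ∑ c ∈ range N, ∑ s ∈ antidiagonal n,
          (cchoose (-((a - n : ℕ) : ℂ)) s.1 * ((b + c).choose c : ℕ) * lamc c s.2)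
            • M.Yw (F (a - n) (b + c) v) ((s.1 : ℤ) + (s.2 : ℤ) + e) := by
  rw [cf_substY]
  refine sum_congr rfl fun n hn => ?_
  rw [mem_range] at hn
  obtain ⟨d, rfl⟩ : ∃ d, a = d + n := ⟨a - n, by omega⟩
  rw [cf_taylor, Nat.add_sub_cancel, LinearMap.sum_apply, map_sum, Finset.sum_apply]
  rw [sum_subset (range_mono (show n + 1 ≤ N by omega)) fun c _ hc => by
    rw [mem_range] at hc
    rw [substCoeff_of_lt (by omega)]
    simp]
  refine sum_congr rfl fun c _ => ?_
  rw [LinearMap.smul_apply, map_smul, Pi.smul_apply, cf_ofCoeffs, substCoeff_eq_sum, sum_mul,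
    sum_smul]
  refine sum_congr rfl fun s hs => ?_
  rw [HasAntidiagonal.mem_antidiagonal] at hs
  rw [← Nat.cast_add, hs, mul_right_comm]

theorem DeltaTildeW_mul_Yw (u v : V) (a₀ b₀ : ℕ) (e : ℤ) :
    DeltaTildeW A M u a₀ b₀ * M.Yw v e
      = ∑ᶠ (a : ℕ), ∑ᶠ (b0 : ℕ), ∑ᶠ (l : ℕ), ∑ᶠ (c : ℕ), ∑ᶠ (m : ℕ),
          ∑ᶠ (a' : ℕ), ∑ᶠ (b' : ℕ),
          if a + l + m + a' = a₀ ∧ b0 + b' = b₀ then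
            (cchoose (-(a : ℂ)) l * ((Nat.choose (b0 + c) c : ℕ) : ℂ) * lamc c m)
              • (M.Yw (DeltaTildeV A u a (b0 + c) v) ((l : ℤ) + (m : ℤ) + e)
                  * DeltaTildeW A M u a' b')
          else 0 := by
  set N := a₀ + b₀ + 1 with hN
  rw [finsum_seven_eq_sum_range (N := N), ← sum_seven_reindex (Nat.lt_succ_self (a₀ + b₀))]
  · have h := congrArg (cf a₀ b₀) (DeltaTildeW_mul_C A M u v e)
    rw [cf_mul_C_C, cf_ofCoeffs, cf_mul] at h
    rw [h]
    refine sum_congr rfl fun p hp => sum_congr rfl fun q _ => ?_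
    rw [HasAntidiagonal.mem_antidiagonal] at hp
    rw [cf_substY_ofCoeffs A M v e _ (show p.1 < N by omega), cf_ofCoeffs]
    simp only [sum_mul, smul_mul_assoc]
    rfl
  · intro a b l c m a' b' h
    split_ifs with h'
    · rw [lamc_of_lt (by omega), mul_zero, zero_smul]
    · rfl

end Conjugation

section Translation

variable {V : Type*} [AddCommGroup V] [Module ℂ V] {W : Type*} [AddCommGroup W] [Module ℂ W]
variable (A : VOA V) (M : WeakModule A W)

theorem Yw_omega_commutator (u : V) (n : ℤ) :
    M.Yw A.ω 0 * M.Yw u n - M.Yw u n * M.Yw A.ω 0 = (-(n : ℂ)) • M.Yw u (n - 1) := by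
  have h := Yw_commutator A M A.ω u 0 n
  simpa [M.Lm1_deriv] using h

theorem C_omega_commutator_expExponentW (u : V) :
    C (C (M.Yw A.ω 0)) * ofCoeffs (expExponentW A M u)
        - ofCoeffs (expExponentW A M u) * C (C (M.Yw A.ω 0))
      = -ddx (ofCoeffs (expExponentW A M u)) := by
  refine ext_cf fun a b => ?_
  rw [map_sub, cf_C_C_mul, cf_mul_C_C, map_neg, cf_ofCoeffs]
  have h0 := Yw_omega_commutator A M u 0
  rw [Int.cast_zero, neg_zero, zero_smul] at h0
  rcases a with _ | a
  · rw [cf_zero_ddx, neg_zero]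
    by_cases hb : b = 1
    · simpa [expExponentW, hb] using h0
    · simp [expExponentW, hb]
  · rw [cf_succ_ddx, cf_ofCoeffs, cf_ofCoeffs]
    by_cases hb : b = 0
    · subst hb
      have ha : ((a : ℂ) + 1) ≠ 0 := by exact_mod_cast a.succ_ne_zero
      have h := Yw_omega_commutator A M u ((a + 1 : ℕ) : ℤ)
      have hW : expExponentW A M u (a + 1) 0
          = ((-1 : ℂ) ^ (a + 1) / (-((a + 1 : ℕ) : ℂ))) • M.Yw u ((a + 1 : ℕ) : ℤ) := by
        simp [expExponentW]
      rw [hW, mul_smul_comm, smul_mul_assoc, ← smul_sub, h, smul_smul]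
      rcases a with _ | a
      · simp [expExponentW]
      · have ha' : ((a : ℂ) + 1) ≠ 0 := by exact_mod_cast a.succ_ne_zero
        have hW' : expExponentW A M u (a + 1) 0
            = ((-1 : ℂ) ^ (a + 1) / (-((a + 1 : ℕ) : ℂ))) • M.Yw u ((a + 1 : ℕ) : ℤ) := by
          simp [expExponentW]
        have hW'' : expExponentW A M u (a + 1) (0 + 1) = 0 := by simp [expExponentW]
        rw [hW', hW'', smul_zero, zero_sub, neg_neg, smul_smul]
        rw [show ((a + 1 + 1 : ℕ) : ℤ) - 1 = ((a + 1 : ℕ) : ℤ) by push_cast; ring]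
        congr 1
        push_cast at ha ⊢
        field_simp
        ring
    · by_cases ha : a = 0 <;> simp [expExponentW, hb, ha]

theorem C_omega_commutator_pow (u : V) (j : ℕ) :
    C (C (M.Yw A.ω 0)) * ofCoeffs (expExponentW A M u) ^ j
        - ofCoeffs (expExponentW A M u) ^ j * C (C (M.Yw A.ω 0))
      = -ddx (ofCoeffs (expExponentW A M u) ^ j) := by
  induction j with
  | zero =>
    have h := ddx_mul (1 : PowerSeries (PowerSeries (Module.End ℂ W))) 1
    have h' : ddx (1 : PowerSeries (PowerSeries (Module.End ℂ W))) = 0 := by simpa using h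
    simp [h']
  | succ j ih =>
    rw [pow_succ, ddx_mul, neg_add, ← neg_mul, ← mul_neg, ← ih,
      ← C_omega_commutator_expExponentW]
    noncomm_ring

theorem C_omega_commutator_expPartial (u : V) (N : ℕ) :
    C (C (M.Yw A.ω 0)) * expPartial N (ofCoeffs (expExponentW A M u))
        - expPartial N (ofCoeffs (expExponentW A M u)) * C (C (M.Yw A.ω 0))
      = -ddx (expPartial N (ofCoeffs (expExponentW A M u))) := by
  rw [expPartial, mul_sum, sum_mul, ← sum_sub_distrib, map_sum, ← sum_neg_distrib]
  refine sum_congr rfl fun j _ => ?_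
  rw [mul_smul_comm, smul_mul_assoc, ← smul_sub, C_omega_commutator_pow, map_smul, smul_neg]

theorem C_omega_commutator_DeltaTildeW (u : V) :
    C (C (M.Yw A.ω 0)) * ofCoeffs (DeltaTildeW A M u)
        - ofCoeffs (DeltaTildeW A M u) * C (C (M.Yw A.ω 0))
      = -ddx (ofCoeffs (DeltaTildeW A M u)) := by
  refine ext_cf fun a b => ?_
  set N := a + b + 1
  set P := expPartial N (ofCoeffs (expExponentW A M u)) with hP_def
  have hP : VanishesBelow N (ofCoeffs (DeltaTildeW A M u) - P) := fun a b h => by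
    rw [map_sub, cf_ofCoeffs, DeltaTildeW,
      expS2_eq_cf_expPartial (by simp [expExponentW]) h, sub_self]
  have h1 := hP.mul_right_factor (f := C (C (M.Yw A.ω 0))) a b (Nat.lt_succ_self _)
  have h2 := hP.mul_left_factor (g := C (C (M.Yw A.ω 0))) a b (Nat.lt_succ_self _)
  have h3 := hP.ddx a b (Nat.lt_succ_self _)
  rw [mul_sub, map_sub, sub_eq_zero] at h1
  rw [sub_mul, map_sub, sub_eq_zero] at h2
  rw [map_sub, map_sub, sub_eq_zero] at h3
  rw [map_sub, map_neg, h1, h2, h3, ← map_sub, ← map_neg, hP_def,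
    C_omega_commutator_expPartial]

end Translation

end LogSeries

/-- Let `(V,Y,𝟏,ω)` be a vertex operator algebra, `(W,Y_W)` a weak
`V`-module, `u ∈ V`, and `Δ̃_W^{(u)}(x) = exp(∫₀^{-x} Y_W^{≤-2}(u,y) + (Y_W)₀(u) log x)`.
Then for all `v ∈ V`:

(1) `Δ̃_W^{(u)}(x) Y_W(v, x₂) = Y_W(Δ̃_V^{(u)}(x + x₂) v, x₂) Δ̃_W^{(u)}(x)`, where
`Δ̃_V^{(u)}(x+x₂)v` is obtained by substituting `x ↦ x + x₂` (expanded in nonnegative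
powers of `x₂` via `(x+x₂)^{-a} = ∑_{l ≥ 0} C(-a,l) x^{-a-l} x₂^l`) and
`log x ↦ log x + log(1 + x₂/x)` (with `(log(1+x₂/x))^c = ∑_m lamc c m x^{-m} x₂^m`).
The identity is stated by comparing the coefficients of `x^{-A} (log x)^B x₂^{-e-1}`.

(2) `[L(-1), Δ̃_W^{(u)}(x)] = -(d/dx) Δ̃_W^{(u)}(x)`, stated by comparing the
coefficients of `x^{-A} (log x)^B` (with `L(-1) = (Y_W)₀(ω)`). -/
theorem DeltaTilde_conjugation_and_derivative (A : VOA V) (M : WeakModule A W) (u : V) :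
    (∀ (v : V) (Ai Bi : ℕ) (e : ℤ),
      DeltaTildeW A M u Ai Bi * M.Yw v e
        = ∑ᶠ (a : ℕ), ∑ᶠ (b0 : ℕ), ∑ᶠ (l : ℕ), ∑ᶠ (c : ℕ), ∑ᶠ (m : ℕ),
            ∑ᶠ (a' : ℕ), ∑ᶠ (b' : ℕ),
            if a + l + m + a' = Ai ∧ b0 + b' = Bi then
              (cchoose (-(a : ℂ)) l * ((Nat.choose (b0 + c) c : ℕ) : ℂ) * lamc c m)
                • (M.Yw (DeltaTildeV A u a (b0 + c) v) ((l : ℤ) + (m : ℤ) + e)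
                    * DeltaTildeW A M u a' b')
            else 0) ∧
    (∀ (Ai Bi : ℕ),
      M.Yw A.ω 0 * DeltaTildeW A M u (Ai + 1) Bi
          - DeltaTildeW A M u (Ai + 1) Bi * M.Yw A.ω 0
        = (Ai : ℂ) • DeltaTildeW A M u Ai Bi
            - ((Bi : ℂ) + 1) • DeltaTildeW A M u Ai (Bi + 1)) ∧
    (∀ Bi : ℕ,
      M.Yw A.ω 0 * DeltaTildeW A M u 0 Bi - DeltaTildeW A M u 0 Bi * M.Yw A.ω 0 = 0) := by
  refine ⟨fun v Ai Bi e => LogSeries.DeltaTildeW_mul_Yw A M u v Ai Bi e, fun Ai Bi => ?_,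
    fun Bi => ?_⟩
  · have h := congrArg (LogSeries.cf (Ai + 1) Bi)
      (LogSeries.C_omega_commutator_DeltaTildeW A M u)
    simpa only [map_sub, map_neg, LogSeries.cf_C_C_mul, LogSeries.cf_mul_C_C,
      LogSeries.cf_ofCoeffs, LogSeries.cf_succ_ddx, neg_sub] using h
  · have h := congrArg (LogSeries.cf 0 Bi) (LogSeries.C_omega_commutator_DeltaTildeW A M u)
    simpa only [map_sub, map_neg, LogSeries.cf_C_C_mul, LogSeries.cf_mul_C_C,
      LogSeries.cf_ofCoeffs, LogSeries.cf_zero_ddx, neg_zero] using h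

end
end

section
/- Let U, V, W be C-vector spaces with endomorphisms A, B, C respectively, such that U, V, W are each spanned by generalized eigenvectors of A, B, C respectively, and let A_ss, B_ss, C_ss denote the semisimple parts (the operator acting as multiplication by λ on the generalized λ-eigenspace). If a bilinear map f : U × V → W satisfies C(f(u, v)) = f(Au, v) + f(u, Bv) for all u, v, then also C_ss(f(u, v)) = f(A_ss u, v) + f(u, B_ss v) and (C - C_ss)(f(u, v)) = f((A - A_ss)u, v) + f(u, (B - B_ss)v) for all u ∈ U, v ∈ V. -/
noncomputable section

/-- `S` is the semisimple part of the endomorphism `T`: it acts as multiplication by `λ`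
on the generalized `λ`-eigenspace of `T`, for every `λ`. -/
def IsSemisimplePart {X : Type*} [AddCommGroup X] [Module ℂ X]
    (T S : Module.End ℂ X) : Prop :=
  ∀ (lam : ℂ), ∀ x ∈ Module.End.maxGenEigenspace T lam, S x = lam • x

/-- A bilinear map intertwining `A ⊗ 1 + 1 ⊗ B` with `C` also intertwines the operators
shifted by scalars, so it sends vectors killed by powers of `A - a` and `B - b` to a vector
killed by a power of `C - (a + b)`. -/
lemma pow_sub_smul_apply_eq_zero_of_derivation {R U V W : Type*} [CommRing R]
    [AddCommGroup U] [Module R U] [AddCommGroup V] [Module R V] [AddCommGroup W] [Module R W]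
    {A : Module.End R U} {B : Module.End R V} {C : Module.End R W} {f : U →ₗ[R] V →ₗ[R] W}
    (hder : ∀ u v, C (f u v) = f (A u) v + f u (B v)) (a b : R) (m n : ℕ) (u : U) (v : V)
    (hu : ((A - a • 1) ^ m) u = 0) (hv : ((B - b • 1) ^ n) v = 0) :
    ((C - (a + b) • 1) ^ (m + n)) (f u v) = 0 := by
  induction hk : m + n generalizing m n u v with
  | zero =>
    obtain rfl : m = 0 := by lia
    have hu0 : u = 0 := by simpa using hu
    simp [hu0]
  | succ k ih =>
    rcases m with _ | m
    · have hu0 : u = 0 := by simpa using hu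
      simp [hu0]
    rcases n with _ | n
    · have hv0 : v = 0 := by simpa using hv
      simp [hv0]
    have hshift : (C - (a + b) • 1) (f u v) =
        f ((A - a • 1) u) v + f u ((B - b • 1) v) := by
      simp only [LinearMap.sub_apply, LinearMap.add_apply, LinearMap.smul_apply,
        Module.End.one_apply, hder, map_sub, map_smul, add_smul]
      abel
    rw [pow_succ, Module.End.mul_apply] at hu hv
    rw [pow_succ, Module.End.mul_apply, hshift, map_add,
      ih m (n + 1) _ v hu (by rwa [pow_succ, Module.End.mul_apply]) (by lia),
      ih (m + 1) n u _ (by rwa [pow_succ, Module.End.mul_apply]) hv (by lia), add_zero]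

lemma apply_mem_maxGenEigenspace_add_of_derivation {R U V W : Type*} [CommRing R]
    [AddCommGroup U] [Module R U] [AddCommGroup V] [Module R V] [AddCommGroup W] [Module R W]
    {A : Module.End R U} {B : Module.End R V} {C : Module.End R W} {f : U →ₗ[R] V →ₗ[R] W}
    (hder : ∀ u v, C (f u v) = f (A u) v + f u (B v)) {a b : R} {u : U} {v : V}
    (hu : u ∈ A.maxGenEigenspace a) (hv : v ∈ B.maxGenEigenspace b) :
    f u v ∈ C.maxGenEigenspace (a + b) := by
  rw [Module.End.mem_maxGenEigenspace] at hu hv ⊢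
  obtain ⟨m, hm⟩ := hu
  obtain ⟨n, hn⟩ := hv
  exact ⟨m + n, pow_sub_smul_apply_eq_zero_of_derivation hder a b m n u v hm hn⟩

/-- Let `U, V, W` be `ℂ`-vector spaces with endomorphisms `A, B, C`,
each spanned by generalized eigenvectors of the respective endomorphism, and let
`SA, SB, SC` be the semisimple parts of `A, B, C`.  If a bilinear map `f` satisfies
`C (f u v) = f (A u) v + f u (B v)` for all `u, v`, then also
`SC (f u v) = f (SA u) v + f u (SB v)` and
`(C - SC) (f u v) = f ((A - SA) u) v + f u ((B - SB) v)` for all `u, v`. -/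
theorem semisimple_part_derivation
    (U V W : Type*) [AddCommGroup U] [Module ℂ U] [AddCommGroup V] [Module ℂ V]
    [AddCommGroup W] [Module ℂ W]
    (A : Module.End ℂ U) (B : Module.End ℂ V) (C : Module.End ℂ W)
    (hU : (⨆ lam : ℂ, Module.End.maxGenEigenspace A lam) = ⊤)
    (hV : (⨆ lam : ℂ, Module.End.maxGenEigenspace B lam) = ⊤)
    (hW : (⨆ lam : ℂ, Module.End.maxGenEigenspace C lam) = ⊤)
    (SA : Module.End ℂ U) (SB : Module.End ℂ V) (SC : Module.End ℂ W)
    (hSA : IsSemisimplePart A SA) (hSB : IsSemisimplePart B SB)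
    (hSC : IsSemisimplePart C SC)
    (f : U →ₗ[ℂ] V →ₗ[ℂ] W)
    (hder : ∀ (u : U) (v : V), C (f u v) = f (A u) v + f u (B v)) :
    ∀ (u : U) (v : V),
      SC (f u v) = f (SA u) v + f u (SB v) ∧
      (C - SC) (f u v) = f ((A - SA) u) v + f u ((B - SB) v) := by
  have hss : ∀ u v, SC (f u v) = f (SA u) v + f u (SB v) := by
    intro u v
    have hu : u ∈ ⨆ lam : ℂ, Module.End.maxGenEigenspace A lam := hU ▸ Submodule.mem_top
    have hv : v ∈ ⨆ lam : ℂ, Module.End.maxGenEigenspace B lam := hV ▸ Submodule.mem_top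
    induction hu using Submodule.iSup_induction' with
    | zero => simp
    | add x y _ _ hx hy =>
      simp only [map_add, LinearMap.add_apply, hx, hy]
      abel
    | mem a u hu =>
      induction hv using Submodule.iSup_induction' with
      | zero => simp
      | add x y _ _ hx hy =>
        simp only [map_add, hx, hy]
        abel
      | mem b v hv =>
        rw [hSC _ _ (apply_mem_maxGenEigenspace_add_of_derivation hder hu hv), hSA a u hu,
          hSB b v hv, map_smul, map_smul, LinearMap.smul_apply, add_smul]
  intro u v
  refine ⟨hss u v, ?_⟩
  simp only [LinearMap.sub_apply, map_sub, hder, hss]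
  abel

end
end

section
/- Let (V, Y, 1, ω) be a vertex operator algebra with V_(0) = C·1 and V_(n) = 0 for n < 0, and let u ∈ V_(1) satisfy L(1)u = 0. Define Δ_V^{(u)}(x) = x^{Y_0(u)} e^{∫_0^{-x} Y^{≤-2}(u, y)}, where x^{Y_0(u)} = x^{(Y_0(u))_ss} e^{(Y_0(u) - (Y_0(u))_ss) log x}. Then: (1) for every v ∈ V there exist finitely many complex numbers m_1, ..., m_l such that Δ_V^{(u)}(x) v ∈ x^{m_1} V[x^{-1}][log x] + ... + x^{m_l} V[x^{-1}][log x]; (2) Δ_V^{(u)}(x) Y(v, x_2) = Y(Δ_V^{(u)}(x + x_2) v, x_2) Δ_V^{(u)}(x) for all v ∈ V; and (3) [L(-1), Δ_V^{(u)}(x)] = -(d/dx) Δ_V^{(u)}(x). -/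
open scoped BigOperators
open Complex

noncomputable section

/-- Multiplication of formal series in `x⁻¹` with (noncommutative) coefficients. -/
def mulS1 {R : Type*} [Ring R] (F G : ℕ → R) : ℕ → R :=
  fun a => ∑ p ∈ Finset.range (a + 1), F p * G (a - p)

/-- Powers of a formal series in `x⁻¹`. -/
def powS1 {R : Type*} [Ring R] (F : ℕ → R) : ℕ → ℕ → R
  | 0 => fun a => if a = 0 then 1 else 0
  | j + 1 => mulS1 F (powS1 F j)

/-- The exponential of a formal series in `x⁻¹` with zero constant term. -/
def expS1 {R : Type*} [Ring R] [Algebra ℂ R] (F : ℕ → R) : ℕ → R :=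
  fun a => ∑ j ∈ Finset.range (a + 1), ((Nat.factorial j : ℂ))⁻¹ • powS1 F j a

variable {V : Type*} [AddCommGroup V] [Module ℂ V]

/-- The integral `∫₀^{-x} Y^{≤-2}(u,y) = ∑_{a ≥ 1} ((-1)^a/(-a)) Y_a(u) x^{-a}`:
coefficient of `x^{-a}`. -/
def intExponentV (A : VOA V) (u : V) : ℕ → Module.End ℂ V :=
  fun a => if 1 ≤ a then ((-1 : ℂ) ^ (a : ℕ) / (-(a : ℂ))) • A.Y u (a : ℤ) else 0

/-- `e^{∫₀^{-x} Y^{≤-2}(u,y)}`: coefficient of `x^{-a}`. -/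
def expIntV (A : VOA V) (u : V) : ℕ → Module.End ℂ V :=
  expS1 (intExponentV A u)

/-- `Δc` is the family of coefficients of `Δ_V^{(u)}(x) = x^{Y₀(u)} e^{∫₀^{-x} Y^{≤-2}(u,y)}`,
where `x^{Y₀(u)} = x^{(Y₀(u))_{ss}} e^{(Y₀(u) - (Y₀(u))_{ss}) log x}` and `S = (Y₀(u))_{ss}`
is the semisimple part of `Y₀(u)`:  `Δc v α b` is the coefficient of `x^α (log x)^b` in
`Δ_V^{(u)}(x) v`.  On a generalized eigenvector `v` of `Y₀(u)` with eigenvalue `λ`, the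
coefficient of `x^{λ-a} (log x)^b` is `(1/b!) (Y₀(u) - S)^b` applied to the `x^{-a}`
coefficient of `e^{∫₀^{-x} Y^{≤-2}(u,y)} v`, and all coefficients at exponents outside
`λ - ℕ` vanish. -/
def IsDeltaCoeff (A : VOA V) (u : V) (S : Module.End ℂ V)
    (Dc : V →ₗ[ℂ] ℂ → ℕ → V) : Prop :=
  ∀ (lam : ℂ) (v : V), v ∈ Module.End.maxGenEigenspace (A.Y u 0) lam →
    (∀ (a b : ℕ),
        Dc v (lam - (a : ℂ)) b
          = ((Nat.factorial b : ℂ))⁻¹ • ((A.Y u 0 - S) ^ b) (expIntV A u a v)) ∧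
    (∀ (α : ℂ) (b : ℕ), (∀ a : ℕ, α ≠ lam - (a : ℂ)) → Dc v α b = 0)

namespace Module.End

/-- Endomorphisms of a complex vector space form a binomial ring. -/
instance instBinomialRing {V : Type*} [AddCommGroup V] [Module ℂ V] :
    BinomialRing (Module.End ℂ V) :=
  letI : Module ℚ≥0 (Module.End ℂ V) := Module.compHom _ (algebraMap ℚ≥0 ℂ)
  inferInstance

end Module.End

open Finset.HasAntidiagonal (antidiagonal)

section RingChoose

variable {R : Type*} [Ring R] [BinomialRing R]

theorem Ring.succ_nsmul_choose_succ (r : R) (m : ℕ) :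
    (m + 1) • Ring.choose r (m + 1) = Ring.choose r m * (r - m) := by
  have h := Ring.choose_smul_choose r (Nat.le_succ m)
  simpa using h

theorem Ring.succ_nsmul_choose_succ' (r : R) (m : ℕ) :
    (m + 1) • Ring.choose r (m + 1) = r * Ring.choose (r - 1) m := by
  have h := Ring.choose_smul_choose r (Nat.succ_le_succ (Nat.zero_le m))
  simpa using h

theorem Ring.mul_choose_sub_one (r : R) (m : ℕ) :
    r * Ring.choose (r - 1) m = Ring.choose r m * (r - m) := by
  rw [← Ring.succ_nsmul_choose_succ', Ring.succ_nsmul_choose_succ]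

theorem Commute.ring_choose_right {r s : R} (h : Commute r s) (m : ℕ) :
    Commute r (Ring.choose s m) := by
  haveI : IsAddTorsionFree R := BinomialRing.toIsAddTorsionFree
  induction m with
  | zero => simp
  | succ m ih =>
    rw [commute_iff_eq]
    apply (nsmul_right_inj (Nat.succ_ne_zero m)).mp
    rw [← mul_smul_comm, ← smul_mul_assoc, Ring.succ_nsmul_choose_succ]
    exact ih.mul_right (h.sub_right (Nat.cast_commute m r).symm)

theorem Ring.sum_neg_one_pow_mul_choose (r : R) (i q : ℕ) :
    ∑ p ∈ antidiagonal q,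
      (((-1 : ℤ) ^ p.1 * ((i + p.1).choose i : ℤ) : ℤ) : R) * Ring.choose (r + i) p.2
      = Ring.choose (r - 1) q := by
  have h : Commute (-((i + 1 : ℕ) : R)) (r + i) := (Nat.cast_commute _ _).neg_left
  have := Ring.add_choose_eq q h
  rw [show r - 1 = -((i + 1 : ℕ) : R) + (r + i) by push_cast; noncomm_ring, this]
  refine Finset.sum_congr rfl fun p _ => ?_
  congr 1
  rw [Ring.choose_neg, show (((i + 1 : ℕ) : R) + (p.1 : R) - 1) = ((i + p.1 : ℕ) : R) by
    push_cast; abel, Ring.choose_natCast, Nat.choose_symm_add, Units.smul_def, zsmul_eq_mul]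
  simp [Int.negOnePow_def]

end RingChoose

theorem cchoose_eq_choose (r : ℂ) (i : ℕ) : cchoose r i = Ring.choose r i := by
  induction i with
  | zero => simp [cchoose]
  | succ i ih =>
    have h := Ring.succ_nsmul_choose_succ r i
    rw [← ih, cchoose, nsmul_eq_mul] at h
    have h1 : ((i + 1 : ℕ) : ℂ) ≠ 0 := Nat.cast_ne_zero.mpr i.succ_ne_zero
    apply mul_left_cancel₀ h1
    rw [h, cchoose, Finset.prod_range_succ, Nat.factorial_succ]
    have : (i.factorial : ℂ) ≠ 0 := Nat.cast_ne_zero.mpr i.factorial_ne_zero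
    push_cast at h1 ⊢
    field_simp

/-- The coefficients on the right-hand side of the component Jacobi identity are ordinary
binomial coefficients. -/
theorem cchoose_mul_neg_one_pow (b i : ℕ) :
    cchoose ((i : ℂ) - ((b : ℤ) : ℂ) - 1) i * (-1 : ℂ) ^ i = (b.choose i : ℂ) := by
  rw [cchoose_eq_choose, show ((i : ℂ) - ((b : ℤ) : ℂ) - 1) = -((b : ℂ) + 1 - i) by
    push_cast; ring, Ring.choose_neg, show ((b : ℂ) + 1 - i + i - 1) = (b : ℕ) by ring,
    Ring.choose_natCast, Units.smul_def, zsmul_eq_mul, Int.negOnePow_def]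
  have : (-1 : ℂ) ^ i * (-1 : ℂ) ^ i = 1 := by rw [← mul_pow]; simp
  simp only [zpow_natCast, Units.val_pow_eq_pow_val, Units.val_neg, Units.val_one,
    Int.cast_pow, Int.cast_neg, Int.cast_one]
  linear_combination (b.choose i : ℂ) * this

namespace VOA

variable {V : Type*} [AddCommGroup V] [Module ℂ V] (A : VOA V)

theorem commutator_formula (u v w : V) (p : ℕ) (n : ℤ) :
    A.Y u p (A.Y v n w) - A.Y v n (A.Y u p w)
      = ∑ ik ∈ antidiagonal p, (p.choose ik.1 : ℂ) • A.Y (A.Y u ik.1 v) (n + ik.2) w := by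
  have h := A.jacobi u v w 0 p n
  have h0 : ∀ i : ℕ, cchoose ((0 : ℤ) : ℂ) i = if i = 0 then 1 else 0 := by
    intro i
    rw [cchoose_eq_choose]
    simp [Ring.choose_zero_ite]
  rw [finsum_eq_single _ 0 (by intro i hi; simp only [h0, hi, if_false, zero_mul, zero_smul]),
    finsum_eq_single _ 0 (by intro i hi; simp only [h0, hi, if_false, zero_mul, zero_smul]),
    finsum_eq_sum_of_support_subset (s := Finset.range (p + 1))] at h
  · simp only [cchoose_mul_neg_one_pow, h0] at h
    rw [Finset.Nat.sum_antidiagonal_eq_sum_range_succ_mk]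
    convert h using 1
    · simp
    · refine Finset.sum_congr rfl fun i hi => ?_
      have : i ≤ p := by simpa [Nat.lt_succ_iff] using hi
      simp only [zero_add, Nat.cast_sub this]
      rw [show (n + ((p : ℤ) - (i : ℤ))) = p + n - i by ring]
  · intro i hi
    by_contra hn
    apply hi
    simp only [cchoose_mul_neg_one_pow]
    rw [Nat.choose_eq_zero_of_lt (by simpa using hn)]
    simp

theorem Y_zero_derivation (u v w : V) (n : ℤ) :
    A.Y u 0 (A.Y v n w) = A.Y (A.Y u 0 v) n w + A.Y v n (A.Y u 0 w) := by
  have h := A.commutator_formula u v w 0 n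
  simp only [Finset.Nat.antidiagonal_zero, Finset.sum_singleton, Nat.choose_self, Nat.cast_one,
    one_smul, Nat.cast_zero, add_zero] at h
  exact sub_eq_iff_eq_add.mp h

end VOA

namespace PowerSeries

section Euler

variable {R : Type*} [Ring R]

/-- The Euler operator `X d/dX`. -/
def euler (f : PowerSeries R) : PowerSeries R := mk fun n => n • coeff n f

@[simp]
theorem coeff_euler (f : PowerSeries R) (n : ℕ) : coeff n (euler f) = n • coeff n f :=
  coeff_mk _ _

theorem euler_mul (f g : PowerSeries R) : euler (f * g) = euler f * g + f * euler g := by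
  ext n
  simp only [coeff_euler, coeff_mul, map_add, Finset.smul_sum, ← Finset.sum_add_distrib]
  refine Finset.sum_congr rfl fun p hp => ?_
  rw [← Finset.HasAntidiagonal.mem_antidiagonal.mp hp, add_smul, smul_mul_assoc, mul_smul_comm]

theorem euler_one : euler (1 : PowerSeries R) = 0 := by
  ext n
  by_cases h : n = 0 <;> simp [coeff_one, h]

theorem euler_C (r : R) : euler (C r) = 0 := by
  ext n
  by_cases h : n = 0 <;> simp [coeff_C, h]

theorem euler_sub (f g : PowerSeries R) : euler (f - g) = euler f - euler g := by
  ext n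
  simp only [coeff_euler, map_sub, smul_sub]

theorem euler_neg (f : PowerSeries R) : euler (-f) = -euler f := by
  ext n
  simp only [coeff_euler, map_neg, smul_neg]

theorem commute_mk {F G : ℕ → R} (h : ∀ i j, Commute (F i) (G j)) : Commute (mk F) (mk G) := by
  ext n
  simp only [coeff_mul, coeff_mk]
  rw [← Finset.Nat.sum_antidiagonal_swap]
  exact Finset.sum_congr rfl fun p _ => h _ _

theorem euler_pow_succ {f : PowerSeries R} (h : Commute f (euler f)) (j : ℕ) :
    euler (f ^ (j + 1)) = (j + 1) • (euler f * f ^ j) := by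
  induction j with
  | zero => simp
  | succ j ih =>
    rw [pow_succ', euler_mul, ih, mul_smul_comm, ← mul_assoc f, h.eq, mul_assoc, ← pow_succ',
      add_comm, ← succ_nsmul]

end Euler

end PowerSeries

section ExpS1

open PowerSeries

variable {R : Type*} [Ring R]

theorem powS1_eq_coeff (F : ℕ → R) (j a : ℕ) : powS1 F j a = coeff a (mk F ^ j) := by
  induction j generalizing a with
  | zero => simp [powS1, coeff_one]
  | succ j ih =>
    rw [pow_succ', coeff_mul, Finset.Nat.sum_antidiagonal_eq_sum_range_succ_mk]
    simp [powS1, mulS1, ih]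

theorem powS1_eq_zero_of_lt {F : ℕ → R} (h0 : F 0 = 0) {j a : ℕ} (h : a < j) :
    powS1 F j a = 0 := by
  rw [powS1_eq_coeff]
  refine coeff_of_lt_order _ (lt_of_lt_of_le ?_ (le_order_pow_of_constantCoeff_eq_zero j ?_))
  · exact_mod_cast h
  · simp [h0]

variable [Algebra ℂ R]

theorem expS1_eq_sum_range {F : ℕ → R} (h0 : F 0 = 0) {a N : ℕ} (h : a < N) :
    expS1 F a = ∑ j ∈ Finset.range N, ((Nat.factorial j : ℂ))⁻¹ • powS1 F j a := by
  refine Finset.sum_subset (Finset.range_subset_range.mpr h) fun j _ hj => ?_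
  rw [powS1_eq_zero_of_lt h0 (by simpa using hj), smul_zero]

theorem euler_expS1 {F : ℕ → R} (h0 : F 0 = 0) (hF : ∀ i j, Commute (F i) (F j)) :
    euler (mk (expS1 F)) = euler (mk F) * mk (expS1 F) := by
  have hc : Commute (mk F) (euler (mk F)) :=
    commute_mk fun i j => by simpa using (hF i j).smul_right j
  ext a
  have hf : ∀ j : ℕ, (((j + 1).factorial : ℂ))⁻¹ * ((j + 1 : ℕ) : ℂ) = ((j.factorial : ℂ))⁻¹ := by
    intro j
    have h1 : ((j + 1 : ℕ) : ℂ) ≠ 0 := Nat.cast_ne_zero.mpr j.succ_ne_zero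
    rw [Nat.factorial_succ, Nat.cast_mul, mul_inv, mul_comm, ← mul_assoc, mul_inv_cancel₀ h1,
      one_mul]
  have hterm : ∀ j : ℕ, a • (((j.factorial : ℂ))⁻¹ • powS1 F j a)
      = ((j.factorial : ℂ))⁻¹ • coeff a (euler (mk F ^ j)) := by
    intro j
    rw [coeff_euler, powS1_eq_coeff, smul_comm]
  rw [coeff_euler, coeff_mk, expS1_eq_sum_range h0 (show a < a + 2 by omega), Finset.smul_sum,
    Finset.sum_congr rfl fun j _ => hterm j, Finset.sum_range_succ', pow_zero, euler_one, map_zero,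
    smul_zero, add_zero, coeff_mul]
  have hR : ∀ p ∈ antidiagonal a, coeff p.1 (euler (mk F)) * coeff p.2 (mk (expS1 F))
      = ∑ j ∈ Finset.range (a + 1), ((j.factorial : ℂ))⁻¹ •
        (coeff p.1 (euler (mk F)) * coeff p.2 (mk F ^ j)) := by
    intro p hp
    have := Finset.HasAntidiagonal.mem_antidiagonal.mp hp
    rw [coeff_mk, expS1_eq_sum_range h0 (show p.2 < a + 1 by omega), Finset.mul_sum]
    simp only [powS1_eq_coeff, mul_smul_comm]
  rw [Finset.sum_congr rfl hR, Finset.sum_comm]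
  refine Finset.sum_congr rfl fun j _ => ?_
  rw [euler_pow_succ hc, map_nsmul, ← Nat.cast_smul_eq_nsmul ℂ, ← Finset.smul_sum, ← coeff_mul,
    ← hf j, mul_smul]

end ExpS1

namespace VOA

open PowerSeries (euler)

variable {V : Type*} [AddCommGroup V] [Module ℂ V] (A : VOA V) {u : V}

theorem Lm1_eq_zero_of_mem_zero (h0 : A.grading 0 = Submodule.span ℂ {A.vac}) {v : V}
    (hv : v ∈ A.grading 0) : A.Y A.ω 0 v = 0 := by
  rw [h0] at hv
  obtain ⟨c, rfl⟩ := Submodule.mem_span_singleton.mp hv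
  rw [map_smul, A.creation_zero _ _ le_rfl, smul_zero]

theorem Y_self_mem (hu : u ∈ A.grading 1) (n : ℤ) : A.Y u n u ∈ A.grading (1 - n) := by
  have h := A.weight 1 n u hu 1 u hu
  rwa [show (1 + 1 - n - 1 : ℤ) = 1 - n by ring] at h

theorem Y_self_eq_zero (hneg : ∀ n : ℤ, n < 0 → A.grading n = ⊥) (hu : u ∈ A.grading 1) {n : ℤ}
    (hn : 2 ≤ n) : A.Y u n u = 0 := by
  have h := A.Y_self_mem hu n
  rwa [hneg _ (by omega), Submodule.mem_bot] at h

theorem Y_zero_self (h0 : A.grading 0 = Submodule.span ℂ {A.vac})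
    (hneg : ∀ n : ℤ, n < 0 → A.grading n = ⊥) (hu : u ∈ A.grading 1) : A.Y u 0 u = 0 := by
  have h := A.skew u u 0
  rw [finsum_eq_single _ 0] at h
  · simp only [Nat.cast_zero, add_zero, zero_add, zpow_one, Nat.factorial_zero, Nat.cast_one,
      inv_one, mul_one, pow_zero, Module.End.one_apply, neg_smul, one_smul] at h
    have h2 : (2 : ℂ) • A.Y u 0 u = 0 := by rw [two_smul, ← sub_neg_eq_add, ← h, sub_self]
    exact (smul_eq_zero.mp h2).resolve_left two_ne_zero
  · intro m hm
    have hz : ((A.Y A.ω 0) ^ m) (A.Y u (0 + (m : ℤ)) u) = 0 := by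
      rw [zero_add]
      obtain rfl | hm2 : m = 1 ∨ 2 ≤ m := by omega
      · rw [pow_one]
        exact A.Lm1_eq_zero_of_mem_zero h0 (by simpa using A.Y_self_mem hu 1)
      · rw [A.Y_self_eq_zero hneg hu (by exact_mod_cast hm2), map_zero]
    rw [hz, smul_zero]

theorem commute_Y_self (h0 : A.grading 0 = Submodule.span ℂ {A.vac})
    (hneg : ∀ n : ℤ, n < 0 → A.grading n = ⊥) (hu : u ∈ A.grading 1) (p q : ℕ) :
    Commute (A.Y u p) (A.Y u q) := by
  refine LinearMap.ext fun w => ?_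
  rw [Module.End.mul_apply, Module.End.mul_apply, ← sub_eq_zero, A.commutator_formula]
  refine Finset.sum_eq_zero fun ik _ => ?_
  obtain ⟨i, k⟩ := ik
  suffices h : A.Y (A.Y u i u) (q + k) = 0 by simp [h]
  obtain rfl | rfl | hi : i = 0 ∨ i = 1 ∨ 2 ≤ i := by omega
  · rw [Nat.cast_zero, A.Y_zero_self h0 hneg hu, map_zero, Pi.zero_apply]
  · have h := A.Y_self_mem hu 1
    rw [sub_self, h0] at h
    obtain ⟨c, hc⟩ := Submodule.mem_span_singleton.mp h
    rw [Nat.cast_one, ← hc, map_smul, Pi.smul_apply, A.vacuum_left, if_neg (by omega), smul_zero]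
  · rw [A.Y_self_eq_zero hneg hu (by exact_mod_cast hi), map_zero, Pi.zero_apply]

/-- The singular part `∑_{p ≥ 0} (-1)^p Y_p(u) x^{-p}`, so that `Δ_V^{(u)}(x)` satisfies
`x (d/dx) Δ_V^{(u)}(x) = singularSeries Δ_V^{(u)}(x)`. -/
def singularSeries (u : V) : PowerSeries (Module.End ℂ V) :=
  PowerSeries.mk fun p => (-1 : ℂ) ^ p • A.Y u p

theorem euler_intExponentV (u : V) :
    euler (PowerSeries.mk (intExponentV A u))
      = PowerSeries.C (A.Y u 0) - A.singularSeries u := by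
  ext1 a
  rw [PowerSeries.coeff_euler, PowerSeries.coeff_mk, map_sub, singularSeries, PowerSeries.coeff_mk,
    PowerSeries.coeff_C, intExponentV]
  rcases Nat.eq_zero_or_pos a with rfl | ha
  · simp
  · have h1 : (a : ℂ) ≠ 0 := Nat.cast_ne_zero.mpr ha.ne'
    rw [if_pos (Nat.one_le_iff_ne_zero.mpr ha.ne'), if_neg ha.ne', zero_sub,
      ← Nat.cast_smul_eq_nsmul ℂ, smul_smul, ← neg_smul]
    congr 1
    field_simp

theorem singularSeries_mul_expIntV (h0 : A.grading 0 = Submodule.span ℂ {A.vac})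
    (hneg : ∀ n : ℤ, n < 0 → A.grading n = ⊥) (hu : u ∈ A.grading 1) :
    A.singularSeries u * PowerSeries.mk (expIntV A u)
      = PowerSeries.C (A.Y u 0) * PowerSeries.mk (expIntV A u)
        - euler (PowerSeries.mk (expIntV A u)) := by
  have h := euler_expS1 (F := intExponentV A u) (by simp [intExponentV]) (fun i j => by
    unfold intExponentV
    split_ifs
    · exact ((A.commute_Y_self h0 hneg hu i j).smul_left _).smul_right _
    all_goals simp)
  rw [expIntV, h, euler_intExponentV]
  noncomm_ring

theorem sum_singular_mul_expIntV (h0 : A.grading 0 = Submodule.span ℂ {A.vac})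
    (hneg : ∀ n : ℤ, n < 0 → A.grading n = ⊥) (hu : u ∈ A.grading 1) (a : ℕ) :
    ∑ p ∈ antidiagonal a, ((-1 : ℂ) ^ p.1 • A.Y u p.1) * expIntV A u p.2
      = A.Y u 0 * expIntV A u a - a • expIntV A u a := by
  have h := congrArg (PowerSeries.coeff a) (A.singularSeries_mul_expIntV h0 hneg hu)
  rw [PowerSeries.coeff_mul, map_sub, PowerSeries.coeff_euler, PowerSeries.coeff_C_mul] at h
  simpa only [singularSeries, PowerSeries.coeff_mk] using h

@[simp]
theorem expIntV_zero (u : V) : expIntV A u 0 = 1 := by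
  simp [expIntV, expS1, powS1]

/-- Uniqueness of solutions of the differential equation satisfied by `Δ_V^{(u)}(x)`. -/
theorem singularSeries_ode_unique (u : V) {f g : PowerSeries (Module.End ℂ V)}
    (hf : A.singularSeries u * f = PowerSeries.C (A.Y u 0) * f - euler f)
    (hg : A.singularSeries u * g = PowerSeries.C (A.Y u 0) * g - euler g)
    (h : PowerSeries.coeff 0 f = PowerSeries.coeff 0 g) : f = g := by
  suffices H : ∀ d : PowerSeries (Module.End ℂ V),
      A.singularSeries u * d = PowerSeries.C (A.Y u 0) * d - euler d →
      PowerSeries.coeff 0 d = 0 → d = 0 by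
    refine sub_eq_zero.mp (H (f - g) ?_ (by rw [map_sub, h, sub_self]))
    rw [mul_sub, hf, hg, PowerSeries.euler_sub]
    noncomm_ring
  intro d hd hd0
  ext1 n
  rw [map_zero]
  induction n using Nat.strong_induction_on with
  | _ n ih =>
    rcases Nat.eq_zero_or_pos n with rfl | hn
    · exact hd0
    have h1 := congrArg (PowerSeries.coeff n) hd
    rw [PowerSeries.coeff_mul, map_sub, PowerSeries.coeff_C_mul, PowerSeries.coeff_euler,
      Finset.sum_eq_single (0, n)] at h1
    · simp only [singularSeries, PowerSeries.coeff_mk, pow_zero, one_smul, Nat.cast_zero] at h1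
      have h2 : n • PowerSeries.coeff n d = 0 := by
        rw [eq_comm, sub_eq_self] at h1
        exact h1
      rw [← Nat.cast_smul_eq_nsmul ℂ] at h2
      exact (smul_eq_zero.mp h2).resolve_left (Nat.cast_ne_zero.mpr hn.ne')
    · rintro ⟨i, j⟩ hij hne
      have hij := Finset.HasAntidiagonal.mem_antidiagonal.mp hij
      have hj : j < n := by
        rcases Nat.eq_zero_or_pos i with rfl | hi
        · exact absurd (by simpa using hij) (by simpa using hne)
        · simp only at hij; omega
      rw [ih j hj, mul_zero]
    · intro hn
      exact absurd (Finset.HasAntidiagonal.mem_antidiagonal.mpr (zero_add n)) hn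

end VOA

theorem Finset.sum_antidiagonal_interchange {M : Type*} [AddCommMonoid M]
    (f : ℕ → ℕ → ℕ → ℕ → M) (s : ℕ) :
    ∑ p ∈ antidiagonal s, ∑ x ∈ antidiagonal p.1, ∑ y ∈ antidiagonal p.2, f x.1 x.2 y.1 y.2
      = ∑ p ∈ antidiagonal s, ∑ x ∈ antidiagonal p.1, ∑ y ∈ antidiagonal p.2,
          f x.1 y.1 x.2 y.2 := by
  simp only [Finset.sum_sigma']
  refine Finset.sum_nbij'
    (fun z => ⟨(z.2.1.1 + z.2.2.1, z.2.1.2 + z.2.2.2),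
      ⟨(z.2.1.1, z.2.2.1), (z.2.1.2, z.2.2.2)⟩⟩)
    (fun z => ⟨(z.2.1.1 + z.2.2.1, z.2.1.2 + z.2.2.2),
      ⟨(z.2.1.1, z.2.2.1), (z.2.1.2, z.2.2.2)⟩⟩)
    ?_ ?_ ?_ ?_ ?_
  all_goals
    rintro ⟨⟨p, b⟩, ⟨i, k⟩, ⟨a, r⟩⟩ h
    simp only [Finset.mem_sigma, Finset.HasAntidiagonal.mem_antidiagonal] at h ⊢
  · exact ⟨by omega, trivial, trivial⟩
  · exact ⟨by omega, trivial, trivial⟩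
  · obtain ⟨h1, rfl, rfl⟩ := h
    rfl
  · obtain ⟨h1, rfl, rfl⟩ := h
    rfl

theorem Commute.expS1_right {R : Type*} [Ring R] [Algebra ℂ R] {x : R} {F : ℕ → R}
    (h : ∀ i, Commute x (F i)) (a : ℕ) : Commute x (expS1 F a) := by
  have hp : ∀ j a, Commute x (powS1 F j a) := by
    intro j
    induction j with
    | zero =>
      intro a
      unfold powS1
      split_ifs
      exacts [Commute.one_right x, Commute.zero_right x]
    | succ j ih =>
      intro a
      unfold powS1 mulS1
      exact Commute.sum_right _ _ _ fun p _ => (h p).mul_right (ih _)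
  unfold expS1
  exact Commute.sum_right _ _ _ fun j _ => (hp j a).smul_right _

namespace VOA

open PowerSeries (euler)

variable {V : Type*} [AddCommGroup V] [Module ℂ V] (A : VOA V) {u : V}

theorem commute_expIntV (h0 : A.grading 0 = Submodule.span ℂ {A.vac})
    (hneg : ∀ n : ℤ, n < 0 → A.grading n = ⊥) (hu : u ∈ A.grading 1) (i a : ℕ) :
    Commute (A.Y u i) (expIntV A u a) := by
  refine Commute.expS1_right (fun p => ?_) a
  unfold intExponentV
  split_ifs
  exacts [(A.commute_Y_self h0 hneg hu i p).smul_right _, Commute.zero_right _]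

/-- The coefficient of `x^{-s} x₂^{s-e-1}` in
`Y((1 + x₂/x)^{Y₀(u)} e^{∫₀^{-(x+x₂)} Y^{≤-2}(u,y)} v, x₂)`. -/
def conjCoeff (u v : V) (e : ℤ) (s : ℕ) : Module.End ℂ V :=
  ∑ aq ∈ antidiagonal s,
    A.Y (Ring.choose (A.Y u 0 - (aq.1 : Module.End ℂ V)) aq.2 (expIntV A u aq.1 v)) (aq.2 + e)

theorem sum_singular_choose (h0 : A.grading 0 = Submodule.span ℂ {A.vac})
    (hneg : ∀ n : ℤ, n < 0 → A.grading n = ⊥) (hu : u ∈ A.grading 1) (a q : ℕ) :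
    ∑ x ∈ antidiagonal a, ∑ y ∈ antidiagonal q,
      ((-1 : ℂ) ^ (x.1 + y.1) * ((x.1 + y.1).choose x.1 : ℂ)) •
        (A.Y u x.1 * (Ring.choose (A.Y u 0 - (x.2 : Module.End ℂ V)) y.2 * expIntV A u x.2))
      = (A.Y u 0 - ((a + q : ℕ) : Module.End ℂ V)) *
        (Ring.choose (A.Y u 0 - (a : Module.End ℂ V)) q * expIntV A u a) := by
  have hT : ∀ i a : ℕ, Commute (A.Y u i) (A.Y u 0 - (a : Module.End ℂ V)) := fun i a => by
    exact_mod_cast (A.commute_Y_self h0 hneg hu i 0).sub_right (Nat.cast_commute a _).symm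
  have h1 : ∀ x ∈ antidiagonal a, ∑ y ∈ antidiagonal q,
      ((-1 : ℂ) ^ (x.1 + y.1) * ((x.1 + y.1).choose x.1 : ℂ)) •
        (A.Y u x.1 * (Ring.choose (A.Y u 0 - (x.2 : Module.End ℂ V)) y.2 * expIntV A u x.2))
      = Ring.choose (A.Y u 0 - (a : Module.End ℂ V) - 1) q
        * (((-1 : ℂ) ^ x.1 • A.Y u x.1) * expIntV A u x.2) := by
    intro x hx
    have hx := Finset.HasAntidiagonal.mem_antidiagonal.mp hx
    have hsub : A.Y u 0 - (a : Module.End ℂ V) + (x.1 : ℕ)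
        = A.Y u 0 - (x.2 : Module.End ℂ V) := by
      rw [← hx]; push_cast; abel
    rw [← Ring.sum_neg_one_pow_mul_choose _ x.1, Finset.sum_mul]
    refine Finset.sum_congr rfl fun y _ => ?_
    rw [hsub, ← mul_assoc, ((hT x.1 x.2).ring_choose_right y.2).eq, smul_mul_assoc, pow_add,
      mul_smul_comm, ← zsmul_eq_mul, ← Int.cast_smul_eq_zsmul ℂ, mul_assoc, smul_mul_assoc,
      smul_smul]
    congr 1
    push_cast
    ring
  rw [Finset.sum_congr rfl h1, ← Finset.mul_sum, A.sum_singular_mul_expIntV h0 hneg hu,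
    nsmul_eq_mul, ← sub_mul, ← mul_assoc, ← mul_assoc]
  congr 1
  have hc : Commute (A.Y u 0 - (a : Module.End ℂ V))
      (Ring.choose (A.Y u 0 - (a : Module.End ℂ V) - 1) q) :=
    ((Commute.refl _).sub_right (Commute.one_right _)).ring_choose_right q
  have hc2 : Commute (A.Y u 0 - (a : Module.End ℂ V) - (q : Module.End ℂ V))
      (Ring.choose (A.Y u 0 - (a : Module.End ℂ V)) q) :=
    ((Commute.refl _).sub_left (Nat.cast_commute q _)).ring_choose_right q
  rw [← hc.eq, Ring.mul_choose_sub_one, ← hc2.eq, Nat.cast_add, sub_sub]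

theorem sum_singular_commutator_conjCoeff (h0 : A.grading 0 = Submodule.span ℂ {A.vac})
    (hneg : ∀ n : ℤ, n < 0 → A.grading n = ⊥) (hu : u ∈ A.grading 1) (v : V) (e : ℤ) (s : ℕ) :
    ∑ p ∈ antidiagonal s, (-1 : ℂ) ^ p.1 •
        (A.Y u p.1 * conjCoeff A u v e p.2 - conjCoeff A u v e p.2 * A.Y u p.1)
      = A.Y u 0 * conjCoeff A u v e s - conjCoeff A u v e s * A.Y u 0 - s • conjCoeff A u v e s := by
  refine LinearMap.ext fun w => ?_
  let f : ℕ → ℕ → ℕ → ℕ → V := fun i k a r =>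
    A.Y (((-1 : ℂ) ^ (i + k) * ((i + k).choose i : ℂ)) • (A.Y u i *
      (Ring.choose (A.Y u 0 - (a : Module.End ℂ V)) r * expIntV A u a)) v) ((k + r : ℕ) + e) w
  have hL : ∀ p ∈ antidiagonal s, ((-1 : ℂ) ^ p.1 •
        (A.Y u p.1 * conjCoeff A u v e p.2 - conjCoeff A u v e p.2 * A.Y u p.1)) w
      = ∑ x ∈ antidiagonal p.1, ∑ y ∈ antidiagonal p.2, f x.1 x.2 y.1 y.2 := by
    intro p _
    rw [Finset.sum_comm, conjCoeff, Finset.mul_sum, Finset.sum_mul, ← Finset.sum_sub_distrib,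
      Finset.smul_sum, LinearMap.sum_apply]
    refine Finset.sum_congr rfl fun y _ => ?_
    rw [LinearMap.smul_apply, LinearMap.sub_apply, Module.End.mul_apply, Module.End.mul_apply,
      A.commutator_formula, Finset.smul_sum]
    refine Finset.sum_congr rfl fun x hx => ?_
    have hx := Finset.HasAntidiagonal.mem_antidiagonal.mp hx
    simp only [f, hx, map_smul, LinearMap.smul_apply, Pi.smul_apply, smul_smul]
    rw [Nat.cast_add, show ((x.2 : ℤ) + y.2 + e) = y.2 + e + x.2 by ring]
    rfl
  have hR : ∀ p ∈ antidiagonal s,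
      ∑ x ∈ antidiagonal p.1, ∑ y ∈ antidiagonal p.2, f x.1 y.1 x.2 y.2
      = A.Y ((A.Y u 0 - ((s : ℕ) : Module.End ℂ V))
        (Ring.choose (A.Y u 0 - (p.1 : Module.End ℂ V)) p.2 (expIntV A u p.1 v))) (p.2 + e) w := by
    intro p hp
    have hp := Finset.HasAntidiagonal.mem_antidiagonal.mp hp
    have h := congrArg (fun g : Module.End ℂ V => A.Y (g v) (p.2 + e) w)
      (A.sum_singular_choose h0 hneg hu p.1 p.2)
    simp only [hp, Module.End.mul_apply] at h
    rw [← h]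
    simp only [LinearMap.sum_apply, map_sum, Finset.sum_apply]
    refine Finset.sum_congr rfl fun x _ => Finset.sum_congr rfl fun y hy => ?_
    rw [← Finset.HasAntidiagonal.mem_antidiagonal.mp hy]
    rfl
  rw [LinearMap.sum_apply, Finset.sum_congr rfl hL, Finset.sum_antidiagonal_interchange,
    Finset.sum_congr rfl hR]
  simp only [LinearMap.sub_apply, Module.End.mul_apply, LinearMap.smul_apply, conjCoeff,
    LinearMap.sum_apply, map_sum, Finset.smul_sum, ← Finset.sum_sub_distrib]
  refine Finset.sum_congr rfl fun p _ => ?_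
  rw [map_sub, Pi.sub_apply, LinearMap.sub_apply, A.Y_zero_derivation, add_sub_cancel_right,
    Module.End.natCast_apply, map_nsmul]
  rfl

/-- The conjugation formula for `e^{∫₀^{-x} Y^{≤-2}(u,y)}`, coefficientwise. -/
theorem expIntV_mul_Y (h0 : A.grading 0 = Submodule.span ℂ {A.vac})
    (hneg : ∀ n : ℤ, n < 0 → A.grading n = ⊥) (hu : u ∈ A.grading 1) (v : V) (e : ℤ) (t : ℕ) :
    expIntV A u t * A.Y v e
      = ∑ p ∈ antidiagonal t, conjCoeff A u v e p.1 * expIntV A u p.2 := by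
  have hE := A.singularSeries_mul_expIntV h0 hneg hu
  have hQ : A.singularSeries u * PowerSeries.mk (conjCoeff A u v e)
        - PowerSeries.mk (conjCoeff A u v e) * A.singularSeries u
      = PowerSeries.C (A.Y u 0) * PowerSeries.mk (conjCoeff A u v e)
        - PowerSeries.mk (conjCoeff A u v e) * PowerSeries.C (A.Y u 0)
        - euler (PowerSeries.mk (conjCoeff A u v e)) := by
    ext1 s
    simp only [map_sub, PowerSeries.coeff_euler, PowerSeries.coeff_C_mul, PowerSeries.coeff_mul_C,
      PowerSeries.coeff_mk]
    rw [← A.sum_singular_commutator_conjCoeff h0 hneg hu v e s, PowerSeries.coeff_mul,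
      PowerSeries.coeff_mul, ← Finset.Nat.sum_antidiagonal_swap (n := s)
        (f := fun p => PowerSeries.coeff p.1 (PowerSeries.mk (conjCoeff A u v e)) * _),
      ← Finset.sum_sub_distrib]
    refine Finset.sum_congr rfl fun p _ => ?_
    simp only [singularSeries, PowerSeries.coeff_mk, Prod.fst_swap, Prod.snd_swap, smul_mul_assoc,
      mul_smul_comm, smul_sub]
  have h := A.singularSeries_ode_unique u
    (f := PowerSeries.mk (expIntV A u) * PowerSeries.C (A.Y v e))
    (g := PowerSeries.mk (conjCoeff A u v e) * PowerSeries.mk (expIntV A u)) ?_ ?_ ?_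
  · have ht := congrArg (PowerSeries.coeff t) h
    rw [PowerSeries.coeff_mul_C, PowerSeries.coeff_mul] at ht
    simpa only [PowerSeries.coeff_mk] using ht
  · rw [PowerSeries.euler_mul, PowerSeries.euler_C, ← mul_assoc, hE]
    noncomm_ring
  · rw [PowerSeries.euler_mul, ← mul_assoc, sub_eq_iff_eq_add.mp hQ, add_mul, mul_assoc _ _
      (PowerSeries.mk (expIntV A u)), hE]
    noncomm_ring
  · simp [PowerSeries.coeff_mul, conjCoeff]

end VOA

section Lamc

open PowerSeries (euler)

/-- The formal power series `log(1 + X)`. -/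
def logOneAdd : PowerSeries ℂ :=
  PowerSeries.mk fun i => if 1 ≤ i then (-1 : ℂ) ^ (i + 1) / (i : ℂ) else 0

theorem lamc_eq_coeff (c m : ℕ) : lamc c m = PowerSeries.coeff m (logOneAdd ^ c) := by
  induction c generalizing m with
  | zero => simp [lamc, PowerSeries.coeff_one]
  | succ c ih =>
    rw [pow_succ', PowerSeries.coeff_mul, Finset.Nat.sum_antidiagonal_eq_sum_range_succ_mk]
    simp [lamc, logOneAdd, ih]

theorem lamc_eq_zero_of_lt {c m : ℕ} (h : m < c) : lamc c m = 0 := by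
  rw [lamc_eq_coeff]
  refine PowerSeries.coeff_of_lt_order _ (lt_of_lt_of_le ?_
    (PowerSeries.le_order_pow_of_constantCoeff_eq_zero c ?_))
  · exact_mod_cast h
  · simp [logOneAdd]

theorem one_add_X_mul_euler_logOneAdd :
    (1 + PowerSeries.X) * euler logOneAdd = PowerSeries.X := by
  have h : ∀ n : ℕ, PowerSeries.coeff n (euler logOneAdd)
      = if n = 0 then 0 else (-1 : ℂ) ^ (n + 1) := by
    intro n
    rcases Nat.eq_zero_or_pos n with rfl | hn
    · simp
    · have h1 : (n : ℂ) ≠ 0 := Nat.cast_ne_zero.mpr hn.ne'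
      rw [PowerSeries.coeff_euler, logOneAdd, PowerSeries.coeff_mk,
        if_pos (Nat.one_le_iff_ne_zero.mpr hn.ne'), if_neg hn.ne', nsmul_eq_mul]
      field_simp
  ext n
  rw [add_mul, one_mul, map_add]
  cases n with
  | zero => simp [h]
  | succ n =>
    rw [PowerSeries.coeff_succ_X_mul, h, h, PowerSeries.coeff_X]
    rcases Nat.eq_zero_or_pos n with rfl | hn
    · simp
    · rw [if_neg n.succ_ne_zero, if_neg hn.ne', if_neg (by omega)]
      ring

theorem lamc_rec (c m : ℕ) :
    ((m : ℂ) + 1) * lamc (c + 1) (m + 1) + (m : ℂ) * lamc (c + 1) m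
      = ((c : ℂ) + 1) * lamc c m := by
  have h : (1 + PowerSeries.X) * euler (logOneAdd ^ (c + 1))
      = (c + 1) • (PowerSeries.X * logOneAdd ^ c) := by
    rw [PowerSeries.euler_pow_succ (Commute.all _ _), mul_smul_comm, ← mul_assoc,
      one_add_X_mul_euler_logOneAdd]
  have h1 := congrArg (PowerSeries.coeff (m + 1)) h
  rw [add_mul, one_mul, map_add, map_nsmul, PowerSeries.coeff_succ_X_mul,
    PowerSeries.coeff_succ_X_mul, PowerSeries.coeff_euler, PowerSeries.coeff_euler,
    ← lamc_eq_coeff, ← lamc_eq_coeff, ← lamc_eq_coeff] at h1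
  simpa [nsmul_eq_mul] using h1

/-- `(1 + X)^N = e^{N log(1 + X)}`, coefficientwise. -/
theorem sum_lamc_smul_pow {R : Type*} [Ring R] [BinomialRing R] [Algebra ℂ R] (N : R) {m n : ℕ}
    (h : m < n) :
    ∑ c ∈ Finset.range n, (lamc c m * ((c.factorial : ℂ))⁻¹) • N ^ c = Ring.choose N m := by
  induction m generalizing n with
  | zero =>
    rw [Finset.sum_eq_single_of_mem 0 (Finset.mem_range.mpr h)]
    · simp [lamc]
    · intro c _ hc
      rw [lamc_eq_zero_of_lt (Nat.pos_of_ne_zero hc), zero_mul, zero_smul]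
  | succ m ih =>
    have h1 : ((m : ℂ) + 1) ≠ 0 := Nat.cast_add_one_ne_zero m
    obtain ⟨n, rfl⟩ : ∃ k, n = k + 1 := ⟨n - 1, by omega⟩
    apply smul_right_injective R h1
    simp only
    have h2 : ((m : ℂ) + 1) • Ring.choose N (m + 1) = Ring.choose N m * (N - m) := by
      rw [← Ring.succ_nsmul_choose_succ, ← Nat.cast_smul_eq_nsmul ℂ]
      push_cast
      rfl
    have h3 : (m : ℂ) • Ring.choose N m = ∑ c ∈ Finset.range n,
        ((m : ℂ) * lamc (c + 1) m * (((c + 1).factorial : ℂ))⁻¹) • N ^ (c + 1) := by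
      rw [← ih (show m < n + 1 by omega), Finset.smul_sum, Finset.sum_range_succ']
      have : (m : ℂ) * lamc 0 m = 0 := by
        rcases Nat.eq_zero_or_pos m with rfl | hm
        · simp
        · simp [lamc, hm.ne']
      simp only [smul_smul, ← mul_assoc, this, zero_mul, zero_smul, add_zero]
    have h4 : Ring.choose N m * N = ∑ c ∈ Finset.range n,
        (((c : ℂ) + 1) * lamc c m * (((c + 1).factorial : ℂ))⁻¹) • N ^ (c + 1) := by
      rw [← ih (show m < n by omega), Finset.sum_mul]
      refine Finset.sum_congr rfl fun c _ => ?_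
      rw [smul_mul_assoc, ← pow_succ, Nat.factorial_succ]
      congr 1
      have h5 : ((c : ℂ) + 1) ≠ 0 := Nat.cast_add_one_ne_zero c
      push_cast
      field_simp
    rw [h2, mul_sub, h4, ← (Nat.cast_commute m _).eq, ← nsmul_eq_mul, ← Nat.cast_smul_eq_nsmul ℂ,
      h3, ← Finset.sum_sub_distrib, Finset.sum_range_succ', smul_add, Finset.smul_sum]
    have h0 : lamc 0 (m + 1) = 0 := by simp [lamc]
    rw [h0, zero_mul, zero_smul, smul_zero, add_zero]
    refine Finset.sum_congr rfl fun c _ => ?_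
    rw [smul_smul, ← sub_smul, ← lamc_rec]
    congr 1
    ring

end Lamc

namespace VOA

open PowerSeries (euler)

variable {V : Type*} [AddCommGroup V] [Module ℂ V] (A : VOA V) {u : V}

theorem Lm1_commutator (u : V) (n : ℤ) :
    A.Y A.ω 0 * A.Y u n - A.Y u n * A.Y A.ω 0 = (-(n : ℂ)) • A.Y u (n - 1) := by
  refine LinearMap.ext fun w => ?_
  rw [LinearMap.sub_apply, Module.End.mul_apply, Module.End.mul_apply, A.Y_zero_derivation,
    add_sub_cancel_right, A.Lm1_deriv]

theorem Lm1_commutator_expIntV_series (h0 : A.grading 0 = Submodule.span ℂ {A.vac})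
    (hneg : ∀ n : ℤ, n < 0 → A.grading n = ⊥) (hu : u ∈ A.grading 1) :
    PowerSeries.C (A.Y A.ω 0) * PowerSeries.mk (expIntV A u)
        - PowerSeries.mk (expIntV A u) * PowerSeries.C (A.Y A.ω 0)
      = -(PowerSeries.X * (A.singularSeries u * PowerSeries.mk (expIntV A u))) := by
  have hE := A.singularSeries_mul_expIntV h0 hneg hu
  have hLT : PowerSeries.C (A.Y A.ω 0) * PowerSeries.C (A.Y u 0)
      = PowerSeries.C (A.Y u 0) * PowerSeries.C (A.Y A.ω 0) := by
    rw [← map_mul, ← map_mul, sub_eq_zero.mp ((A.Lm1_commutator u 0).trans (by simp))]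
  have hTS : PowerSeries.C (A.Y u 0) * A.singularSeries u
      = A.singularSeries u * PowerSeries.C (A.Y u 0) := by
    ext1 n
    rw [PowerSeries.coeff_C_mul, PowerSeries.coeff_mul_C, singularSeries, PowerSeries.coeff_mk]
    exact (Commute.smul_right (by exact_mod_cast A.commute_Y_self h0 hneg hu 0 n)
      ((-1 : ℂ) ^ n)).eq
  have hLS : PowerSeries.C (A.Y A.ω 0) * A.singularSeries u
      = A.singularSeries u * PowerSeries.C (A.Y A.ω 0)
        + euler (PowerSeries.X * A.singularSeries u) := by
    rw [← sub_eq_iff_eq_add']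
    ext1 n
    rw [map_sub, PowerSeries.coeff_C_mul, PowerSeries.coeff_mul_C, PowerSeries.coeff_euler]
    cases n with
    | zero =>
      simp only [singularSeries, PowerSeries.coeff_mk, pow_zero, one_smul, zero_smul, Nat.cast_zero]
      rw [A.Lm1_commutator]
      simp
    | succ n =>
      rw [PowerSeries.coeff_succ_X_mul]
      simp only [singularSeries, PowerSeries.coeff_mk]
      rw [mul_smul_comm, smul_mul_assoc, ← smul_sub, A.Lm1_commutator, smul_smul,
        ← Nat.cast_smul_eq_nsmul ℂ, smul_smul]
      push_cast
      rw [add_sub_cancel_right]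
      congr 1
      ring
  set E := PowerSeries.mk (expIntV A u)
  set L := PowerSeries.C (A.Y A.ω 0)
  set T := PowerSeries.C (A.Y u 0)
  set S := A.singularSeries u
  have hX : ∀ f : PowerSeries (Module.End ℂ V), PowerSeries.X * f = f * PowerSeries.X :=
    fun f => (PowerSeries.commute_X f).eq.symm
  refine sub_eq_zero.mp (A.singularSeries_ode_unique u (g := 0) ?_ ?_ ?_)
  · have hθE : euler E = T * E - S * E := by rw [hE, sub_sub_cancel]
    rw [PowerSeries.euler_sub, PowerSeries.euler_sub, PowerSeries.euler_neg, PowerSeries.euler_mul,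
      PowerSeries.euler_mul, ← mul_assoc PowerSeries.X, PowerSeries.euler_mul (_ * S) E,
      PowerSeries.euler_C, hθE]
    linear_combination (norm := noncomm_ring) -(hLS * E) + hLT * E - hX S * (S * E)
      + hX T * (S * E) - PowerSeries.X * (hTS * E)
  · have h := PowerSeries.euler_C (0 : Module.End ℂ V)
    rw [map_zero] at h
    rw [mul_zero, mul_zero, h, sub_zero]
  · simp [L, E]

end VOA

section GenEigen

variable {X : Type*} [AddCommGroup X] [Module ℂ X] {T S : Module.End ℂ X}

theorem IsSemisimplePart.sub_pow_apply (hS : IsSemisimplePart T S) {lam : ℂ} {x : X}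
    (hx : x ∈ T.maxGenEigenspace lam) (b : ℕ) :
    ((T - S) ^ b) x = ((T - lam • (1 : Module.End ℂ X)) ^ b) x := by
  induction b generalizing x with
  | zero => simp
  | succ b ih =>
    have h1 : (T - S) x = (T - lam • (1 : Module.End ℂ X)) x := by simp [hS lam x hx]
    have h2 : (T - lam • (1 : Module.End ℂ X)) x ∈ T.maxGenEigenspace lam :=
      Module.End.mapsTo_maxGenEigenspace_of_comm
        ((Commute.refl T).sub_right ((Commute.one_right T).smul_right lam)) lam hx
    rw [pow_succ, pow_succ, Module.End.mul_apply, Module.End.mul_apply, h1, ih h2]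

theorem Module.End.exists_pow_apply_eq_zero {lam : ℂ} {x : X} (hx : x ∈ T.maxGenEigenspace lam) :
    ∃ N : ℕ, ∀ b ≥ N, ((T - lam • (1 : Module.End ℂ X)) ^ b) x = 0 := by
  obtain ⟨N, hN⟩ := (Module.End.mem_maxGenEigenspace T lam x).mp hx
  refine ⟨N, fun b hb => ?_⟩
  rw [← Nat.sub_add_cancel hb, pow_add, Module.End.mul_apply, hN, map_zero]

/-- A locally finite endomorphism of a complex vector space has enough generalized
eigenvectors. -/
theorem Module.End.le_iSup_maxGenEigenspace {p : Submodule ℂ X} [FiniteDimensional ℂ p]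
    (hp : ∀ x ∈ p, T x ∈ p) : p ≤ ⨆ lam, T.maxGenEigenspace lam := by
  have h := congrArg (Submodule.map p.subtype)
    (Module.End.iSup_maxGenEigenspace_eq_top (T.restrict hp))
  rw [Submodule.map_iSup, Submodule.map_top, Submodule.range_subtype] at h
  rw [← h]
  refine iSup_mono fun lam => ?_
  rw [Module.End.maxGenEigenspace, Module.End.genEigenspace_restrict]
  exact Submodule.map_comap_le _ _

end GenEigen

namespace VOA

variable {V : Type*} [AddCommGroup V] [Module ℂ V] (A : VOA V) {u : V}

theorem iSup_grading : ⨆ n, A.grading n = ⊤ := by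
  refine eq_top_iff.mpr fun v _ => ?_
  rw [← A.proj_sum v]
  refine finsum_induction (· ∈ ⨆ n, A.grading n) (zero_mem _) (fun _ _ => add_mem) fun n => ?_
  exact Submodule.mem_iSup_of_mem n (A.proj_mem n v)

theorem iSup_maxGenEigenspace_Y_zero (hu : u ∈ A.grading 1) :
    ⨆ lam, (A.Y u 0).maxGenEigenspace lam = ⊤ := by
  rw [eq_top_iff, ← A.iSup_grading]
  refine iSup_le fun n => ?_
  have := A.fin_dim n
  refine Module.End.le_iSup_maxGenEigenspace fun x hx => ?_
  have h := A.weight 1 0 u hu n x hx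
  rwa [show (1 + n - 0 - 1 : ℤ) = n by ring] at h

/-- To prove a linear property of vectors it suffices to treat generalized eigenvectors
of `Y₀(u)`. -/
theorem genEigen_induction (hu : u ∈ A.grading 1) {P : V → Prop} (v : V)
    (mem : ∀ lam, ∀ x ∈ (A.Y u 0).maxGenEigenspace lam, P x) (zero : P 0)
    (add : ∀ x y, P x → P y → P (x + y)) : P v :=
  Submodule.iSup_induction (fun lam => (A.Y u 0).maxGenEigenspace lam) (motive := P)
    (by rw [A.iSup_maxGenEigenspace_Y_zero hu]; trivial) mem zero add

theorem powS1_mem_grading {F : ℕ → Module.End ℂ V}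
    (hF : ∀ (i : ℕ) (n : ℤ), ∀ v ∈ A.grading n, F i v ∈ A.grading (n - i)) (j a : ℕ) {n : ℤ} {v : V}
    (hv : v ∈ A.grading n) : powS1 F j a v ∈ A.grading (n - a) := by
  induction j generalizing a n v with
  | zero =>
    simp only [powS1]
    split_ifs with h
    · simpa [h] using hv
    · simp
  | succ j ih =>
    simp only [powS1, mulS1, LinearMap.sum_apply, Module.End.mul_apply]
    refine Submodule.sum_mem _ fun p hp => ?_
    have h := hF p _ _ (ih (a - p) hv)
    have hp' : p ≤ a := Nat.lt_succ_iff.mp (Finset.mem_range.mp hp)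
    rwa [show (n - ((a - p : ℕ) : ℤ) - p : ℤ) = n - a by omega] at h

theorem expIntV_mem_grading (hu : u ∈ A.grading 1) (a : ℕ) {n : ℤ} {v : V}
    (hv : v ∈ A.grading n) : expIntV A u a v ∈ A.grading (n - a) := by
  simp only [expIntV, expS1, LinearMap.sum_apply, LinearMap.smul_apply]
  refine Submodule.sum_mem _ fun j _ => Submodule.smul_mem _ _ ?_
  refine A.powS1_mem_grading (fun i m x hx => ?_) j a hv
  unfold intExponentV
  split_ifs
  · have h := A.weight 1 i u hu m x hx
    rw [show (1 + m - i - 1 : ℤ) = m - i by ring] at h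
    exact Submodule.smul_mem _ _ h
  · simp

theorem exists_expIntV_eq_zero (hneg : ∀ n : ℤ, n < 0 → A.grading n = ⊥) (hu : u ∈ A.grading 1)
    (v : V) : ∃ N : ℕ, ∀ a ≥ N, expIntV A u a v = 0 := by
  have hv : v ∈ ⨆ n, A.grading n := by rw [A.iSup_grading]; trivial
  induction hv using Submodule.iSup_induction' with
  | mem n x hx =>
    refine ⟨n.toNat + 1, fun a ha => ?_⟩
    have h := A.expIntV_mem_grading hu a hx
    rwa [hneg _ (by omega), Submodule.mem_bot] at h
  | zero => exact ⟨0, fun a _ => map_zero _⟩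
  | add x y _ _ hx hy =>
    obtain ⟨M, hM⟩ := hx
    obtain ⟨N, hN⟩ := hy
    refine ⟨max M N, fun a ha => ?_⟩
    rw [map_add, hM a (le_of_max_le_left ha), hN a (le_of_max_le_right ha), add_zero]

theorem expIntV_mem_maxGenEigenspace (h0 : A.grading 0 = Submodule.span ℂ {A.vac})
    (hneg : ∀ n : ℤ, n < 0 → A.grading n = ⊥) (hu : u ∈ A.grading 1) {lam : ℂ} {v : V}
    (hv : v ∈ (A.Y u 0).maxGenEigenspace lam) (a : ℕ) :
    expIntV A u a v ∈ (A.Y u 0).maxGenEigenspace lam :=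
  Module.End.mapsTo_maxGenEigenspace_of_comm
    (by exact_mod_cast A.commute_expIntV h0 hneg hu 0 a) lam hv

variable {S : Module.End ℂ V} {Dc : V →ₗ[ℂ] ℂ → ℕ → V}

theorem delta_apply (h0 : A.grading 0 = Submodule.span ℂ {A.vac})
    (hneg : ∀ n : ℤ, n < 0 → A.grading n = ⊥) (hu : u ∈ A.grading 1)
    (hS : IsSemisimplePart (A.Y u 0) S) (hD : IsDeltaCoeff A u S Dc) {lam : ℂ} {v : V}
    (hv : v ∈ (A.Y u 0).maxGenEigenspace lam) (a b : ℕ) :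
    Dc v (lam - a) b = ((b.factorial : ℂ))⁻¹ •
      ((A.Y u 0 - lam • (1 : Module.End ℂ V)) ^ b) (expIntV A u a v) := by
  rw [(hD lam v hv).1, hS.sub_pow_apply (A.expIntV_mem_maxGenEigenspace h0 hneg hu hv a)]

theorem finite_delta_support (h0 : A.grading 0 = Submodule.span ℂ {A.vac})
    (hneg : ∀ n : ℤ, n < 0 → A.grading n = ⊥) (hu : u ∈ A.grading 1)
    (hS : IsSemisimplePart (A.Y u 0) S) (hD : IsDeltaCoeff A u S Dc) (v : V) :
    {p : ℂ × ℕ | Dc v p.1 p.2 ≠ 0}.Finite := by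
  induction v using A.genEigen_induction hu with
  | mem lam x hx =>
    obtain ⟨N, hN⟩ := A.exists_expIntV_eq_zero hneg hu x
    obtain ⟨M, hM⟩ := Module.End.exists_pow_apply_eq_zero hx
    refine ((Finset.range N ×ˢ Finset.range M).image
      fun ab : ℕ × ℕ => (lam - (ab.1 : ℂ), ab.2)).finite_toSet.subset ?_
    rintro ⟨α, b⟩ h
    simp only [Set.mem_ofPred_eq] at h
    obtain ⟨a, rfl⟩ : ∃ a : ℕ, α = lam - a := by
      by_contra! hα
      exact h ((hD lam x hx).2 α b hα)
    rw [A.delta_apply h0 hneg hu hS hD hx] at h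
    have hc : Commute (A.Y u 0) (expIntV A u a) := by
      exact_mod_cast A.commute_expIntV h0 hneg hu 0 a
    have hc' : Commute ((A.Y u 0 - lam • (1 : Module.End ℂ V)) ^ b) (expIntV A u a) :=
      (hc.sub_left ((Commute.one_left _).smul_left lam)).pow_left b
    refine Finset.mem_coe.mpr (Finset.mem_image.mpr ⟨(a, b), ?_, rfl⟩)
    refine Finset.mem_product.mpr ⟨Finset.mem_range.mpr ?_, Finset.mem_range.mpr ?_⟩
    · by_contra! ha
      exact h (by rw [hN a ha, map_zero, smul_zero])
    · by_contra! hb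
      exact h (by rw [← Module.End.mul_apply, hc'.eq, Module.End.mul_apply, hM b hb, map_zero,
        smul_zero])
  | zero => simp
  | add x y hx hy =>
    refine (hx.union hy).subset fun p hp => ?_
    by_contra! h
    simp only [Set.mem_union, Set.mem_ofPred_eq, not_or, not_not] at h hp
    exact hp (by simp [h.1, h.2])

theorem Lm1_commutator_expIntV_zero (u v : V) :
    A.Y A.ω 0 (expIntV A u 0 v) = expIntV A u 0 (A.Y A.ω 0 v) := by
  simp [expIntV_zero]

theorem Lm1_commutator_expIntV_succ (h0 : A.grading 0 = Submodule.span ℂ {A.vac})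
    (hneg : ∀ n : ℤ, n < 0 → A.grading n = ⊥) (hu : u ∈ A.grading 1) (a : ℕ) (v : V) :
    A.Y A.ω 0 (expIntV A u (a + 1) v) - expIntV A u (a + 1) (A.Y A.ω 0 v)
      = (a : ℂ) • expIntV A u a v - A.Y u 0 (expIntV A u a v) := by
  have h := congrArg (PowerSeries.coeff (a + 1)) (A.Lm1_commutator_expIntV_series h0 hneg hu)
  rw [map_sub, PowerSeries.coeff_C_mul, PowerSeries.coeff_mul_C, PowerSeries.coeff_mk, map_neg,
    PowerSeries.coeff_succ_X_mul, A.singularSeries_mul_expIntV h0 hneg hu, map_sub,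
    PowerSeries.coeff_C_mul, PowerSeries.coeff_euler, PowerSeries.coeff_mk, neg_sub] at h
  simpa [← Nat.cast_smul_eq_nsmul ℂ] using LinearMap.congr_fun h v

theorem Lm1_commutator_delta (h0 : A.grading 0 = Submodule.span ℂ {A.vac})
    (hneg : ∀ n : ℤ, n < 0 → A.grading n = ⊥) (hu : u ∈ A.grading 1)
    (hS : IsSemisimplePart (A.Y u 0) S) (hD : IsDeltaCoeff A u S Dc) (v : V) (α : ℂ) (B : ℕ) :
    A.Y A.ω 0 (Dc v α B) - Dc (A.Y A.ω 0 v) α B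
      = -((α + 1) • Dc v (α + 1) B) - ((B : ℂ) + 1) • Dc v (α + 1) (B + 1) := by
  induction v using A.genEigen_induction hu with
  | mem lam v hv =>
    have hTL : Commute (A.Y u 0) (A.Y A.ω 0) :=
      (sub_eq_zero.mp ((A.Lm1_commutator u 0).trans (by simp))).symm
    have hLv := Module.End.mapsTo_maxGenEigenspace_of_comm hTL lam hv
    have hNL : Commute ((A.Y u 0 - lam • (1 : Module.End ℂ V)) ^ B) (A.Y A.ω 0) :=
      (hTL.sub_left ((Commute.one_left _).smul_left lam)).pow_left B
    by_cases hα : ∃ a : ℕ, α = lam - a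
    · obtain ⟨a, rfl⟩ := hα
      rw [A.delta_apply h0 hneg hu hS hD hv, A.delta_apply h0 hneg hu hS hD hLv, map_smul,
        ← Module.End.mul_apply (A.Y A.ω 0), ← hNL.eq, Module.End.mul_apply, ← smul_sub, ← map_sub]
      cases a with
      | zero =>
        have h : ∀ b, Dc v (lam - (0 : ℕ) + 1) b = 0 := fun b =>
          (hD lam v hv).2 _ b fun a h => by
            have h' : ((a + 1 : ℕ) : ℂ) = 0 := by push_cast at h ⊢; linear_combination h
            exact absurd (Nat.cast_eq_zero.mp h') a.succ_ne_zero
        rw [h, h, A.Lm1_commutator_expIntV_zero]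
        simp
      | succ a =>
        have hB : ((B : ℂ) + 1) ≠ 0 := Nat.cast_add_one_ne_zero B
        have hfac : ((B : ℂ) + 1) * (((B + 1).factorial : ℂ))⁻¹ = ((B.factorial : ℂ))⁻¹ := by
          rw [Nat.factorial_succ]
          push_cast
          field_simp
        rw [show lam - ((a + 1 : ℕ) : ℂ) + 1 = lam - a by push_cast; ring,
          A.delta_apply h0 hneg hu hS hD hv, A.delta_apply h0 hneg hu hS hD hv,
          A.Lm1_commutator_expIntV_succ h0 hneg hu, smul_smul ((B : ℂ) + 1), hfac,
          smul_comm (lam - (a : ℂ)), ← smul_neg, ← smul_sub, pow_succ, Module.End.mul_apply]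
        congr 1
        rw [← map_smul ((A.Y u 0 - lam • (1 : Module.End ℂ V)) ^ B), ← map_neg, ← map_sub]
        congr 1
        simp only [LinearMap.sub_apply, LinearMap.smul_apply, Module.End.one_apply]
        module
    · push Not at hα
      have h : ∀ b, Dc v (α + 1) b = 0 := fun b =>
        (hD lam v hv).2 _ b fun a h => hα (a + 1) (by push_cast; linear_combination h)
      rw [h, h, (hD lam v hv).2 _ B hα, (hD lam _ hLv).2 _ B hα]
      simp
  | zero => simp
  | add x y hx hy =>
    simp only [map_add, Pi.add_apply, smul_add]
    rw [add_sub_add_comm, hx, hy]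
    module

end VOA

theorem Ring.choose_sub_natCast {R : Type*} [Ring R] [BinomialRing R] [Algebra ℂ R] (T : R)
    (lam : ℂ) (a q : ℕ) :
    Ring.choose (T - (a : R)) q
      = ∑ lm ∈ antidiagonal q, cchoose (lam - a) lm.1 • Ring.choose (T - lam • (1 : R)) lm.2 := by
  have h : T - (a : R) = algebraMap ℂ R (lam - a) + (T - lam • (1 : R)) := by
    rw [map_sub, map_natCast, Algebra.algebraMap_eq_smul_one]
    abel
  rw [h, Ring.add_choose_eq _ (Algebra.commutes _ _)]
  refine Finset.sum_congr rfl fun lm _ => ?_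
  rw [← Ring.map_choose, ← Algebra.smul_def, cchoose_eq_choose]

theorem inv_factorial_mul_choose (b₀ b₂ c : ℕ) :
    (((b₀ + b₂).factorial : ℂ))⁻¹ * ((c.factorial : ℂ))⁻¹ * ((b₀ + b₂).choose b₀ : ℂ)
      = ((b₀ + c).choose c : ℂ) * (((b₀ + c).factorial : ℂ))⁻¹ * ((b₂.factorial : ℂ))⁻¹ := by
  have h1 : (((b₀ + b₂).choose b₀ : ℕ) : ℂ) * b₀.factorial * b₂.factorial
      = (b₀ + b₂).factorial := by
    rw [Nat.choose_symm_add]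
    exact_mod_cast Nat.add_choose_mul_factorial_mul_factorial b₀ b₂
  have h2 : (((b₀ + c).choose c : ℕ) : ℂ) * b₀.factorial * c.factorial = (b₀ + c).factorial := by
    exact_mod_cast Nat.add_choose_mul_factorial_mul_factorial b₀ c
  have hf : ∀ n : ℕ, (n.factorial : ℂ) ≠ 0 := fun n => Nat.cast_ne_zero.mpr n.factorial_ne_zero
  have hc := hf c
  have hb := hf b₂
  have hbc := hf (b₀ + c)
  have hbb := hf (b₀ + b₂)
  apply mul_right_cancel₀ (hf b₀)
  field_simp
  linear_combination (b₀ + c).factorial * h1 - (b₀ + b₂).factorial * h2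

theorem Function.HasFiniteSupport.prodMk {α β M : Type*} [Zero M] {f : α × β → M}
    (hf : f.HasFiniteSupport) (a : α) : (fun b => f (a, b)).HasFiniteSupport :=
  Set.Finite.preimage (Prod.mk_right_injective a).injOn hf

namespace VOA

variable {V : Type*} [AddCommGroup V] [Module ℂ V] (A : VOA V) {u : V}

/-- The Leibniz rule for the derivation `Y₀(u)`, shifted by scalars. -/
theorem sub_smul_one_pow_Y (lam mu : ℂ) (e : ℤ) (B : ℕ) (v w : V) :
    ((A.Y u 0 - (lam + mu) • (1 : Module.End ℂ V)) ^ B) (A.Y v e w)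
      = ∑ b ∈ antidiagonal B, B.choose b.1 •
          A.Y (((A.Y u 0 - lam • (1 : Module.End ℂ V)) ^ b.1) v) e
            (((A.Y u 0 - mu • (1 : Module.End ℂ V)) ^ b.2) w) := by
  induction B generalizing v w with
  | zero => simp
  | succ B ih =>
    have h : (A.Y u 0 - (lam + mu) • (1 : Module.End ℂ V)) (A.Y v e w)
        = A.Y v e ((A.Y u 0 - mu • (1 : Module.End ℂ V)) w)
          + A.Y ((A.Y u 0 - lam • (1 : Module.End ℂ V)) v) e w := by
      simp only [LinearMap.sub_apply, LinearMap.smul_apply, Module.End.one_apply, map_sub, map_smul,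
        Pi.sub_apply, Pi.smul_apply, A.Y_zero_derivation]
      module
    rw [pow_succ, Module.End.mul_apply, h, map_add, ih, ih,
      Finset.sum_antidiagonal_choose_succ_nsmul
        (fun i j => A.Y (((A.Y u 0 - lam • (1 : Module.End ℂ V)) ^ i) v) e
          (((A.Y u 0 - mu • (1 : Module.End ℂ V)) ^ j) w))]
    congr 1
    refine Finset.sum_congr rfl fun b hb => ?_
    rw [Nat.choose_symm_of_eq_add (Finset.HasAntidiagonal.mem_antidiagonal.mp hb).symm, pow_succ,
      Module.End.mul_apply]

theorem Y_mem_maxGenEigenspace {lam mu : ℂ} {v w : V}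
    (hv : v ∈ (A.Y u 0).maxGenEigenspace lam) (hw : w ∈ (A.Y u 0).maxGenEigenspace mu) (e : ℤ) :
    A.Y v e w ∈ (A.Y u 0).maxGenEigenspace (lam + mu) := by
  obtain ⟨M, hM⟩ := Module.End.exists_pow_apply_eq_zero hv
  obtain ⟨N, hN⟩ := Module.End.exists_pow_apply_eq_zero hw
  refine (Module.End.mem_maxGenEigenspace _ _ _).mpr ⟨M + N, ?_⟩
  rw [A.sub_smul_one_pow_Y]
  refine Finset.sum_eq_zero fun b hb => ?_
  have h := Finset.HasAntidiagonal.mem_antidiagonal.mp hb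
  rcases le_or_gt M b.1 with h1 | h1
  · rw [hM _ h1]
    simp
  · rw [hN _ (by omega)]
    simp

variable {S : Module.End ℂ V} {Dc : V →ₗ[ℂ] ℂ → ℕ → V}

theorem delta_Y_apply (h0 : A.grading 0 = Submodule.span ℂ {A.vac})
    (hneg : ∀ n : ℤ, n < 0 → A.grading n = ⊥) (hu : u ∈ A.grading 1)
    (hS : IsSemisimplePart (A.Y u 0) S) (hD : IsDeltaCoeff A u S Dc) {lam mu : ℂ} {v w : V}
    (hv : v ∈ (A.Y u 0).maxGenEigenspace lam) (hw : w ∈ (A.Y u 0).maxGenEigenspace mu)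
    (e : ℤ) (t B : ℕ) :
    Dc (A.Y v e w) (lam + mu - t) B
      = ∑ r ∈ antidiagonal t, ∑ s ∈ antidiagonal r.1, ∑ q ∈ antidiagonal s.2,
          ∑ c ∈ Finset.range (t + 1), ∑ b ∈ antidiagonal B,
            (cchoose (lam - s.1) q.1 * (((b.1 + c).choose c : ℕ) : ℂ) * lamc c q.2) •
              A.Y (Dc v (lam - s.1) (b.1 + c)) ((q.1 : ℤ) + (q.2 : ℤ) + e)
                (Dc w (mu - r.2) b.2) := by
  rw [A.delta_apply h0 hneg hu hS hD (A.Y_mem_maxGenEigenspace hv hw e), ← Module.End.mul_apply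
    (expIntV A u t), A.expIntV_mul_Y h0 hneg hu, LinearMap.sum_apply, map_sum, Finset.smul_sum]
  refine Finset.sum_congr rfl fun r hr => ?_
  have hr' := Finset.HasAntidiagonal.mem_antidiagonal.mp hr
  rw [Module.End.mul_apply, conjCoeff, LinearMap.sum_apply, map_sum, Finset.smul_sum]
  refine Finset.sum_congr rfl fun s hs => ?_
  have hs' := Finset.HasAntidiagonal.mem_antidiagonal.mp hs
  rw [Ring.choose_sub_natCast _ lam, LinearMap.sum_apply, map_sum, Finset.sum_apply,
    LinearMap.sum_apply, map_sum, Finset.smul_sum]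
  refine Finset.sum_congr rfl fun q hq => ?_
  have hq' := Finset.HasAntidiagonal.mem_antidiagonal.mp hq
  rw [← sum_lamc_smul_pow _ (show q.2 < t + 1 by omega), Finset.smul_sum, LinearMap.sum_apply,
    map_sum, Finset.sum_apply, LinearMap.sum_apply, map_sum, Finset.smul_sum]
  refine Finset.sum_congr rfl fun c _ => ?_
  simp only [LinearMap.smul_apply, map_smul, Pi.smul_apply]
  rw [A.sub_smul_one_pow_Y, Finset.smul_sum, Finset.smul_sum, Finset.smul_sum]
  refine Finset.sum_congr rfl fun b hb => ?_
  have hb' := Finset.HasAntidiagonal.mem_antidiagonal.mp hb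
  rw [A.delta_apply h0 hneg hu hS hD hv, A.delta_apply h0 hneg hu hS hD hw, ← Module.End.mul_apply
    (_ ^ b.1), ← pow_add, ← Nat.cast_smul_eq_nsmul ℂ, ← hb', ← hq']
  simp only [LinearMap.smul_apply, map_smul, Pi.smul_apply, smul_smul, Nat.cast_add]
  congr 1
  linear_combination cchoose (lam - s.1) q.1 * lamc c q.2 * inv_factorial_mul_choose b.1 b.2 c

/-- The summands of the coefficient of `x^α (log x)^B x₂^{-e-1}` in
`Y(Δ_V^{(u)}(x + x₂) v, x₂) Δ_V^{(u)}(x) w`. -/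
def deltaYTerm (Dc : V →ₗ[ℂ] ℂ → ℕ → V) (α : ℂ) (B : ℕ) (e : ℤ) (v w : V) :
    ℂ × ℂ × ℕ × ℕ × ℕ × ℕ × ℕ → V :=
  fun (α₁, α₂, b0, c, l, m, b₂) =>
    if α₁ - (l : ℂ) - (m : ℂ) + α₂ = α ∧ b0 + b₂ = B then
      (cchoose α₁ l * ((Nat.choose (b0 + c) c : ℕ) : ℂ) * lamc c m)
        • A.Y (Dc v α₁ (b0 + c)) ((l : ℤ) + (m : ℤ) + e) (Dc w α₂ b₂)
    else 0

theorem deltaYTerm_add_left (α : ℂ) (B : ℕ) (e : ℤ) (v v' w : V) :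
    A.deltaYTerm Dc α B e (v + v') w
      = A.deltaYTerm Dc α B e v w + A.deltaYTerm Dc α B e v' w := by
  funext ⟨α₁, α₂, b0, c, l, m, b₂⟩
  simp only [deltaYTerm, Pi.add_apply]
  split_ifs
  · simp only [map_add, Pi.add_apply, LinearMap.add_apply, smul_add]
  · rw [add_zero]

theorem deltaYTerm_add_right (α : ℂ) (B : ℕ) (e : ℤ) (v w w' : V) :
    A.deltaYTerm Dc α B e v (w + w')
      = A.deltaYTerm Dc α B e v w + A.deltaYTerm Dc α B e v w' := by
  funext ⟨α₁, α₂, b0, c, l, m, b₂⟩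
  simp only [deltaYTerm, Pi.add_apply]
  split_ifs
  · simp only [map_add, Pi.add_apply, smul_add]
  · rw [add_zero]

theorem deltaYTerm_zero_left (α : ℂ) (B : ℕ) (e : ℤ) (w : V) :
    A.deltaYTerm Dc α B e 0 w = 0 := by
  funext ⟨α₁, α₂, b0, c, l, m, b₂⟩
  simp [deltaYTerm]

theorem deltaYTerm_zero_right (α : ℂ) (B : ℕ) (e : ℤ) (v : V) :
    A.deltaYTerm Dc α B e v 0 = 0 := by
  funext ⟨α₁, α₂, b0, c, l, m, b₂⟩
  simp [deltaYTerm]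

theorem delta_Y_eq_finsum_of_mem (h0 : A.grading 0 = Submodule.span ℂ {A.vac})
    (hneg : ∀ n : ℤ, n < 0 → A.grading n = ⊥) (hu : u ∈ A.grading 1)
    (hS : IsSemisimplePart (A.Y u 0) S) (hD : IsDeltaCoeff A u S Dc) {lam mu : ℂ} {v w : V}
    (hv : v ∈ (A.Y u 0).maxGenEigenspace lam) (hw : w ∈ (A.Y u 0).maxGenEigenspace mu)
    (α : ℂ) (B : ℕ) (e : ℤ) :
    (A.deltaYTerm Dc α B e v w).HasFiniteSupport ∧
      Dc (A.Y v e w) α B = ∑ᶠ i, A.deltaYTerm Dc α B e v w i := by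
  classical
  have hsupp : ∀ i, A.deltaYTerm Dc α B e v w i ≠ 0 → ∃ a a₂ : ℕ,
      i.1 = lam - a ∧ i.2.1 = mu - a₂ ∧
        α = lam + mu - ((a + i.2.2.2.2.1 + i.2.2.2.2.2.1 + a₂ : ℕ) : ℂ) ∧
        i.2.2.1 + i.2.2.2.2.2.2 = B ∧ i.2.2.2.1 ≤ i.2.2.2.2.2.1 := by
    rintro ⟨α₁, α₂, b0, c, l, m, b₂⟩ h
    simp only [deltaYTerm] at h ⊢
    obtain ⟨⟨hα, hB⟩, h⟩ := ite_ne_right_iff.mp h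
    obtain ⟨a, rfl⟩ : ∃ a : ℕ, α₁ = lam - a := by
      by_contra! h'
      exact h (by rw [(hD lam v hv).2 _ _ h']; simp)
    obtain ⟨a₂, rfl⟩ : ∃ a : ℕ, α₂ = mu - a := by
      by_contra! h'
      exact h (by rw [(hD mu w hw).2 _ _ h']; simp)
    refine ⟨a, a₂, rfl, rfl, ?_, hB, ?_⟩
    · rw [← hα]
      push_cast
      ring
    · by_contra! h'
      exact h (by rw [lamc_eq_zero_of_lt h']; simp)
  by_cases hα : ∃ t : ℕ, α = lam + mu - t
  · obtain ⟨t, rfl⟩ := hα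
    let J : Finset ((_ : ℕ × ℕ) × (_ : ℕ × ℕ) × (_ : ℕ × ℕ) × ℕ × ℕ × ℕ) :=
      (antidiagonal t).sigma fun r => (antidiagonal r.1).sigma fun s =>
        (antidiagonal s.2).sigma fun _ => Finset.range (t + 1) ×ˢ antidiagonal B
    let φ : ((_ : ℕ × ℕ) × (_ : ℕ × ℕ) × (_ : ℕ × ℕ) × ℕ × ℕ × ℕ) → ℂ × ℂ × ℕ × ℕ × ℕ × ℕ × ℕ :=
      fun j => (lam - j.2.1.1, mu - j.1.2, j.2.2.2.2.1, j.2.2.2.1, j.2.2.1.1, j.2.2.1.2,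
        j.2.2.2.2.2)
    have hJ : ∀ r s q c b, (⟨r, s, q, c, b⟩ :
        (_ : ℕ × ℕ) × (_ : ℕ × ℕ) × (_ : ℕ × ℕ) × ℕ × ℕ × ℕ) ∈ J ↔
          r.1 + r.2 = t ∧ s.1 + s.2 = r.1 ∧ q.1 + q.2 = s.2 ∧ c < t + 1 ∧ b.1 + b.2 = B := by
      intro r s q c b
      simp [J]
    have hφ : Set.InjOn φ J := by
      rintro ⟨r, s, q, c, b⟩ hj ⟨r', s', q', c', b'⟩ hj' h
      have h1 := (hJ _ _ _ _ _).mp hj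
      have h2 := (hJ _ _ _ _ _).mp hj'
      simp only [φ, Prod.mk.injEq, sub_right_inj, Nat.cast_inj] at h
      have hr : r = r' := Prod.ext (by omega) h.2.1
      have hs : s = s' := Prod.ext h.1 (by omega)
      have hq : q = q' := Prod.ext h.2.2.2.2.1 h.2.2.2.2.2.1
      have hb : b = b' := Prod.ext h.2.2.1 h.2.2.2.2.2.2
      have hc : c = c' := h.2.2.2.1
      subst hr hs hq hb hc
      rfl
    have hsub : Function.support (A.deltaYTerm Dc (lam + mu - t) B e v w) ⊆ J.image φ := by
      rintro ⟨α₁, α₂, b0, c, l, m, b₂⟩ hi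
      obtain ⟨a, a₂, rfl, rfl, ht, hB, hc⟩ := hsupp _ hi
      have ht' : t = a + l + m + a₂ := by exact_mod_cast sub_right_injective ht
      refine Finset.mem_coe.mpr (Finset.mem_image.mpr
        ⟨⟨(a + (l + m), a₂), (a, l + m), (l, m), c, b0, b₂⟩, ?_, rfl⟩)
      rw [hJ]
      simp only at hc
      exact ⟨by omega, rfl, rfl, by omega, hB⟩
    refine ⟨(Finset.finite_toSet _).subset hsub, ?_⟩
    rw [finsum_eq_sum_of_support_subset _ hsub, Finset.sum_image hφ,
      A.delta_Y_apply h0 hneg hu hS hD hv hw]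
    simp only [J, Finset.sum_sigma, Finset.sum_product]
    refine Finset.sum_congr rfl fun r hr => Finset.sum_congr rfl fun s hs =>
      Finset.sum_congr rfl fun q hq => Finset.sum_congr rfl fun c _ =>
      Finset.sum_congr rfl fun b hb => ?_
    have hr' := Finset.HasAntidiagonal.mem_antidiagonal.mp hr
    have hs' := Finset.HasAntidiagonal.mem_antidiagonal.mp hs
    have hq' := Finset.HasAntidiagonal.mem_antidiagonal.mp hq
    have ht : lam - (s.1 : ℂ) - (q.1 : ℂ) - (q.2 : ℂ) + (mu - (r.2 : ℂ)) = lam + mu - (t : ℂ) := by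
      rw [← hr', ← hs', ← hq']
      push_cast
      ring
    simp only [φ, deltaYTerm]
    rw [if_pos ⟨ht, Finset.HasAntidiagonal.mem_antidiagonal.mp hb⟩]
  · push Not at hα
    have hz : A.deltaYTerm Dc α B e v w = 0 := by
      funext i
      by_contra h
      obtain ⟨a, a₂, -, -, h, -⟩ := hsupp i h
      exact hα _ h
    rw [hz, (hD _ _ (A.Y_mem_maxGenEigenspace hv hw e)).2 _ _ hα]
    refine ⟨by simp [Function.HasFiniteSupport], by simp⟩

theorem delta_Y_eq_finsum (h0 : A.grading 0 = Submodule.span ℂ {A.vac})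
    (hneg : ∀ n : ℤ, n < 0 → A.grading n = ⊥) (hu : u ∈ A.grading 1)
    (hS : IsSemisimplePart (A.Y u 0) S) (hD : IsDeltaCoeff A u S Dc) (v w : V)
    (α : ℂ) (B : ℕ) (e : ℤ) :
    (A.deltaYTerm Dc α B e v w).HasFiniteSupport ∧
      Dc (A.Y v e w) α B = ∑ᶠ i, A.deltaYTerm Dc α B e v w i := by
  induction v using A.genEigen_induction hu with
  | mem lam v hv =>
    induction w using A.genEigen_induction hu with
    | mem mu w hw => exact A.delta_Y_eq_finsum_of_mem h0 hneg hu hS hD hv hw α B e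
    | zero =>
      rw [deltaYTerm_zero_right]
      exact ⟨by simp [Function.HasFiniteSupport], by simp⟩
    | add x y hx hy =>
      rw [deltaYTerm_add_right]
      refine ⟨hx.1.add hy.1, ?_⟩
      rw [map_add, map_add, Pi.add_apply, Pi.add_apply, hx.2, hy.2]
      exact (finsum_add_distrib hx.1 hy.1).symm
  | zero =>
    rw [deltaYTerm_zero_left]
    exact ⟨by simp [Function.HasFiniteSupport], by simp⟩
  | add x y hx hy =>
    rw [deltaYTerm_add_left]
    refine ⟨hx.1.add hy.1, ?_⟩
    rw [map_add, Pi.add_apply, LinearMap.add_apply, map_add, Pi.add_apply, Pi.add_apply, hx.2, hy.2]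
    exact (finsum_add_distrib hx.1 hy.1).symm

theorem delta_Y (h0 : A.grading 0 = Submodule.span ℂ {A.vac})
    (hneg : ∀ n : ℤ, n < 0 → A.grading n = ⊥) (hu : u ∈ A.grading 1)
    (hS : IsSemisimplePart (A.Y u 0) S) (hD : IsDeltaCoeff A u S Dc) (v w : V)
    (α : ℂ) (B : ℕ) (e : ℤ) :
    Dc (A.Y v e w) α B
      = ∑ᶠ (α₁ : ℂ), ∑ᶠ (α₂ : ℂ), ∑ᶠ (b0 : ℕ), ∑ᶠ (c : ℕ), ∑ᶠ (l : ℕ), ∑ᶠ (m : ℕ),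
          ∑ᶠ (b₂ : ℕ), A.deltaYTerm Dc α B e v w (α₁, α₂, b0, c, l, m, b₂) := by
  obtain ⟨hf, h⟩ := A.delta_Y_eq_finsum h0 hneg hu hS hD v w α B e
  rw [h, finsum_curry _ hf]
  refine finsum_congr fun α₁ => ?_
  replace hf := hf.prodMk α₁
  rw [finsum_curry _ hf]
  refine finsum_congr fun α₂ => ?_
  replace hf := hf.prodMk α₂
  rw [finsum_curry _ hf]
  refine finsum_congr fun b0 => ?_
  replace hf := hf.prodMk b0
  rw [finsum_curry _ hf]
  refine finsum_congr fun c => ?_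
  replace hf := hf.prodMk c
  rw [finsum_curry _ hf]
  refine finsum_congr fun l => ?_
  exact finsum_curry _ (hf.prodMk l)

end VOA
/-- Let `(V,Y,𝟏,ω)` be a vertex operator algebra with `V_(0) = ℂ𝟏`
and `V_(n) = 0` for `n < 0`, and let `u ∈ V_(1)` satisfy `L(1)u = 0`.  Let `S` be the
semisimple part of `Y₀(u)` and let `Δc` record the coefficients of
`Δ_V^{(u)}(x) = x^{Y₀(u)} e^{∫₀^{-x} Y^{≤-2}(u,y)}`.  Then:

(1) for every `v ∈ V`, `Δ_V^{(u)}(x) v` lies in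
`x^{m₁} V[x⁻¹][log x] + ⋯ + x^{m_l} V[x⁻¹][log x]` for finitely many `m₁,…,m_l ∈ ℂ`;
equivalently, only finitely many coefficients of `Δ_V^{(u)}(x) v` are nonzero;

(2) `Δ_V^{(u)}(x) Y(v, x₂) = Y(Δ_V^{(u)}(x + x₂) v, x₂) Δ_V^{(u)}(x)`, stated by
comparing the coefficients of `x^α (log x)^B x₂^{-e-1}` applied to `w ∈ V`, where
`Δ_V^{(u)}(x+x₂)` is expanded via `(x+x₂)^{α₁} = ∑_{l ≥ 0} C(α₁,l) x^{α₁-l} x₂^l` and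
`log(x+x₂) = log x + log(1+x₂/x)` in nonnegative integral powers of `x₂`;

(3) `[L(-1), Δ_V^{(u)}(x)] = -(d/dx) Δ_V^{(u)}(x)`, stated by comparing the
coefficients of `x^α (log x)^B`. -/
theorem Delta_properties {V : Type*} [AddCommGroup V] [Module ℂ V] (A : VOA V)
    (h0 : A.grading 0 = Submodule.span ℂ {A.vac})
    (hneg : ∀ n : ℤ, n < 0 → A.grading n = ⊥)
    (u : V) (hu : u ∈ A.grading 1) (hL1 : A.Y A.ω 2 u = 0)
    (S : Module.End ℂ V) (hS : IsSemisimplePart (A.Y u 0) S)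
    (Dc : V →ₗ[ℂ] ℂ → ℕ → V) (hD : IsDeltaCoeff A u S Dc) :
    (∀ v : V, {p : ℂ × ℕ | Dc v p.1 p.2 ≠ 0}.Finite) ∧
    (∀ (v w : V) (α : ℂ) (B : ℕ) (e : ℤ),
      Dc (A.Y v e w) α B
        = ∑ᶠ (α₁ : ℂ), ∑ᶠ (α₂ : ℂ), ∑ᶠ (b0 : ℕ), ∑ᶠ (c : ℕ), ∑ᶠ (l : ℕ), ∑ᶠ (m : ℕ),
            ∑ᶠ (b₂ : ℕ),
            if α₁ - (l : ℂ) - (m : ℂ) + α₂ = α ∧ b0 + b₂ = B then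
              (cchoose α₁ l * ((Nat.choose (b0 + c) c : ℕ) : ℂ) * lamc c m)
                • A.Y (Dc v α₁ (b0 + c)) ((l : ℤ) + (m : ℤ) + e) (Dc w α₂ b₂)
            else 0) ∧
    (∀ (v : V) (α : ℂ) (B : ℕ),
      A.Y A.ω 0 (Dc v α B) - Dc (A.Y A.ω 0 v) α B
        = -((α + 1) • Dc v (α + 1) B) - ((B : ℂ) + 1) • Dc v (α + 1) (B + 1)) :=
  ⟨A.finite_delta_support h0 hneg hu hS hD,
    fun v w α B e => A.delta_Y h0 hneg hu hS hD v w α B e,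
    A.Lm1_commutator_delta h0 hneg hu hS hD⟩
end
end
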